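/- Let n ≥ 2 and let Ω ⊂ ℝⁿ be a bounded domain with C² boundary. Let Q(u) = Σ_{i,j=1}^n a^{ij}(x,u,Du) D_{ij}u + b(x,u,Du) be an elliptic quasilinear operator with a^{ij}, b ∈ C¹(Ω̄ × ℝ × ℝⁿ). Let φ ∈ C²(Ω̄) and let u ∈ C⁰(Ω̄) ∩ C²(Ω) satisfy Q(u) = 0 in Ω and u = φ on ∂Ω. Assume there exists K > 0 such that |u| + |Du| ≤ K on Ω. Then there exist a constant C > 0 and an exponent τ ∈ (0,1) such that u ∈ C¹(Ω̄) and |Du(x₁) − Du(x₂)| ≤ C |x₁ − x₂|^τ for all x₁, x₂ ∈ Ω̄; in particular u ∈ C^{1,τ}(Ω̄). -/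

import Mathlib

open Set Topology

/-- The gradient of `u : ℝⁿ → ℝ`, as a point of `ℝⁿ`. -/
noncomputable def gradE {n : ℕ} (u : EuclideanSpace ℝ (Fin n) → ℝ)
    (x : EuclideanSpace ℝ (Fin n)) : EuclideanSpace ℝ (Fin n) :=
  (EuclideanSpace.equiv (Fin n) ℝ).symm fun i => fderiv ℝ u x (EuclideanSpace.single i 1)

/-- The second partial derivative `D_{ij} u`. -/
noncomputable def sdE {n : ℕ} (u : EuclideanSpace ℝ (Fin n) → ℝ)
    (x : EuclideanSpace ℝ (Fin n)) (i j : Fin n) : ℝ :=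
  fderiv ℝ (fun y => fderiv ℝ u y (EuclideanSpace.single j 1)) x (EuclideanSpace.single i 1)

/-- `Ω` has a `C^k` boundary near the point `p` : near `p` the boundary of `Ω` is a regular
level set of a `C^k` function, with `Ω` on the negative side (equivalently, locally a `C^k`
graph). -/
def BoundaryCAt {n : ℕ} (k : ℕ) (Ω : Set (EuclideanSpace ℝ (Fin n)))
    (p : EuclideanSpace ℝ (Fin n)) : Prop :=
  ∃ (f : EuclideanSpace ℝ (Fin n) → ℝ) (s : Set (EuclideanSpace ℝ (Fin n))),
    IsOpen s ∧ p ∈ s ∧ ContDiff ℝ (k : ℕ∞) f ∧ (∀ x ∈ s, fderiv ℝ f x ≠ 0) ∧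
    (frontier Ω ∩ s = {x ∈ s | f x = 0}) ∧ (Ω ∩ s = {x ∈ s | f x < 0})

/-- `Ω` has `C^k` boundary. -/
def HasCBoundary {n : ℕ} (k : ℕ) (Ω : Set (EuclideanSpace ℝ (Fin n))) : Prop :=
  ∀ p ∈ frontier Ω, BoundaryCAt k Ω p

section Preliminaries

/-- Euclidean space of dimension `n`. -/
abbrev Eu (n : ℕ) := EuclideanSpace ℝ (Fin n)

/-- Continuous bilinear forms on Euclidean space. -/
abbrev Bil (n : ℕ) := Eu n →L[ℝ] Eu n →L[ℝ] ℝ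

/-- The Hessian of `w` at `x`, as a bilinear form. -/
noncomputable abbrev hess {n : ℕ} (w : Eu n → ℝ) (x : Eu n) : Bil n := fderiv ℝ (fderiv ℝ w) x

/-- The trace of a bilinear form against a coefficient matrix. -/
noncomputable def trB {n : ℕ} (A : Matrix (Fin n) (Fin n) ℝ) (B : Bil n) : ℝ :=
  ∑ i, ∑ j, A i j * B (EuclideanSpace.single i 1) (EuclideanSpace.single j 1)

/-- Symmetric matrices with spectrum in `[lam, Lam]`. -/
structure Ell {n : ℕ} (lam Lam : ℝ) (A : Matrix (Fin n) (Fin n) ℝ) : Prop where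
  symm : ∀ i j, A i j = A j i
  lower : ∀ ξ : Eu n, lam * ‖ξ‖ ^ 2 ≤ ∑ i, ∑ j, A i j * ξ i * ξ j
  upper : ∀ ξ : Eu n, ∑ i, ∑ j, A i j * ξ i * ξ j ≤ Lam * ‖ξ‖ ^ 2

/-- The differential inequality `tr (A B) ≤ f` for some elliptic matrix `A`. -/
def SuperAt {n : ℕ} (lam Lam : ℝ) (B : Bil n) (f : ℝ) : Prop :=
  ∃ A : Matrix (Fin n) (Fin n) ℝ, Ell lam Lam A ∧ trB A B ≤ f

/-- The identification of linear forms with vectors. -/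
noncomputable def gradL (n : ℕ) : (Eu n →L[ℝ] ℝ) →L[ℝ] Eu n :=
  ((EuclideanSpace.equiv (Fin n) ℝ).symm : (Fin n → ℝ) →L[ℝ] Eu n).comp
    (ContinuousLinearMap.pi fun i =>
      ContinuousLinearMap.apply ℝ ℝ (EuclideanSpace.single i (1 : ℝ)))

variable {n : ℕ}

lemma gradE_eq_gradL (u : Eu n → ℝ) (x : Eu n) : gradE u x = gradL n (fderiv ℝ u x) := rfl

lemma gradL_apply (l : Eu n →L[ℝ] ℝ) (i : Fin n) :
    gradL n l i = l (EuclideanSpace.single i 1) := rfl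

lemma eu_eq_sum (x : Eu n) : x = ∑ i, x i • EuclideanSpace.single i (1 : ℝ) := by
  ext j
  simp [Finset.sum_apply, Pi.single_apply]

lemma eu_linear_apply (l : Eu n →L[ℝ] ℝ) (x : Eu n) :
    l x = ∑ i, x i * l (EuclideanSpace.single i 1) := by
  conv_lhs => rw [eu_eq_sum x]
  simp [map_sum]

lemma inner_single_one (x : Eu n) (i : Fin n) :
    inner ℝ x (EuclideanSpace.single i (1 : ℝ)) = x i := by
  simpa using EuclideanSpace.inner_single_right i (1 : ℝ) x

lemma inner_gradL (l : Eu n →L[ℝ] ℝ) (x : Eu n) : inner ℝ (gradL n l) x = l x := by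
  rw [eu_linear_apply l x, PiLp.inner_apply]
  refine Finset.sum_congr rfl fun i _ => ?_
  rw [gradL_apply]
  simp

lemma norm_gradL (l : Eu n →L[ℝ] ℝ) : ‖gradL n l‖ = ‖l‖ := by
  apply le_antisymm
  · have h := l.le_opNorm (gradL n l)
    rw [← inner_gradL, real_inner_self_eq_norm_sq, Real.norm_eq_abs, abs_of_nonneg (sq_nonneg _)] at h
    by_contra! hlt
    have : 0 < ‖gradL n l‖ := (norm_nonneg l).trans_lt hlt
    nlinarith
  · refine l.opNorm_le_bound (norm_nonneg _) fun x => ?_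
    rw [← inner_gradL]
    exact norm_inner_le_norm _ _

/-- The inner product, as a bilinear form. -/
noncomputable def innerB (n : ℕ) : Bil n := innerSL ℝ

lemma innerB_apply (x y : Eu n) : innerB n x y = inner ℝ x y := rfl

lemma gradL_inner (x : Eu n) : gradL n (innerB n x) = x := by
  ext i
  rw [gradL_apply, innerB_apply, inner_single_one]

lemma bil_apply (B : Bil n) (x y : Eu n) :
    B x y = ∑ i, ∑ j, x i * y j * B (EuclideanSpace.single i 1) (EuclideanSpace.single j 1) := by
  rw [eu_linear_apply (B x) y, Finset.sum_comm]
  refine Finset.sum_congr rfl fun j _ => ?_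
  have := eu_linear_apply (B.flip (EuclideanSpace.single j 1)) x
  simp only [ContinuousLinearMap.flip_apply] at this
  rw [this, Finset.mul_sum]
  exact Finset.sum_congr rfl fun i _ => by ring

lemma trB_add (A : Matrix (Fin n) (Fin n) ℝ) (B B' : Bil n) :
    trB A (B + B') = trB A B + trB A B' := by
  simp [trB, mul_add, Finset.sum_add_distrib]

lemma trB_sub (A : Matrix (Fin n) (Fin n) ℝ) (B B' : Bil n) :
    trB A (B - B') = trB A B - trB A B' := by
  simp [trB, mul_sub, Finset.sum_sub_distrib]

lemma trB_smul (A : Matrix (Fin n) (Fin n) ℝ) (c : ℝ) (B : Bil n) :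
    trB A (c • B) = c * trB A B := by
  simp [trB, Finset.mul_sum, mul_left_comm]

lemma trB_nonneg_of_psd {A : Matrix (Fin n) (Fin n) ℝ} (hs : ∀ i j, A i j = A j i)
    (hA : ∀ ξ : Eu n, 0 ≤ ∑ i, ∑ j, A i j * ξ i * ξ j) {B : Bil n} (hB : ∀ v, 0 ≤ B v v) :
    0 ≤ trB A B := by
  have hP : A.PosSemidef := by
    refine Matrix.PosSemidef.of_dotProduct_mulVec_nonneg ?_ fun x => ?_
    · ext i j
      simp [hs i j]
    · refine (hA (WithLp.toLp 2 x)).trans_eq ?_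
      simp only [dotProduct, Matrix.mulVec, Finset.mul_sum]
      refine Finset.sum_congr rfl fun i _ => Finset.sum_congr rfl fun j _ => ?_
      simp only [Pi.star_apply, star_trivial]
      ring
  obtain ⟨m, v, rfl⟩ := Matrix.posSemidef_iff_eq_sum_vecMulVec.mp hP
  have : trB (∑ k, Matrix.vecMulVec (v k) (star (v k))) B
      = ∑ k, B (WithLp.toLp 2 (v k)) (WithLp.toLp 2 (v k)) := by
    simp only [trB, Matrix.sum_apply, Finset.sum_mul]
    rw [Finset.sum_congr rfl fun i _ => Finset.sum_comm, Finset.sum_comm]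
    refine Finset.sum_congr rfl fun k _ => ?_
    rw [bil_apply B (WithLp.toLp 2 (v k))]
    exact Finset.sum_congr rfl fun i _ => Finset.sum_congr rfl fun j _ => by
      simp [Matrix.vecMulVec_apply]
  rw [this]
  exact Finset.sum_nonneg fun k _ => hB _

/-- The bilinear form `ℓ ⊗ ℓ`. -/
noncomputable def tens (l : Eu n →L[ℝ] ℝ) : Bil n := l.smulRight l

lemma tens_apply (l : Eu n →L[ℝ] ℝ) (x y : Eu n) : tens l x y = l x * l y := by
  simp [tens]

lemma trB_tens (A : Matrix (Fin n) (Fin n) ℝ) (l : Eu n →L[ℝ] ℝ) :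
    trB A (tens l) = ∑ i, ∑ j, A i j * gradL n l i * gradL n l j := by
  simp [trB, tens_apply, gradL_apply, mul_assoc]

lemma Ell.trB_tens_ge {lam Lam : ℝ} {A : Matrix (Fin n) (Fin n) ℝ} (hA : Ell lam Lam A)
    (l : Eu n →L[ℝ] ℝ) : lam * ‖l‖ ^ 2 ≤ trB A (tens l) := by
  rw [trB_tens, ← norm_gradL]
  exact hA.lower _

lemma Ell.diag_le {lam Lam : ℝ} {A : Matrix (Fin n) (Fin n) ℝ} (hA : Ell lam Lam A) (i : Fin n) :
    A i i ≤ Lam := by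
  have := hA.upper (EuclideanSpace.single i 1)
  simpa [Pi.single_apply] using this

lemma Ell.trB_inner_le {lam Lam : ℝ} {A : Matrix (Fin n) (Fin n) ℝ} (hA : Ell lam Lam A) :
    trB A (innerB n) ≤ n * Lam := by
  have : trB A (innerB n) = ∑ i, A i i := by
    simp only [trB]
    refine Finset.sum_congr rfl fun i _ => ?_
    rw [Finset.sum_eq_single i]
    · rw [innerB_apply, inner_single_one]
      simp
    · intro j _ hj
      rw [innerB_apply, inner_single_one]
      simp [hj]
    · simp
  rw [this]
  calc ∑ i, A i i ≤ ∑ _i : Fin n, Lam := Finset.sum_le_sum fun i _ => hA.diag_le i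
    _ = n * Lam := by simp

lemma Ell.trB_nonneg {lam Lam : ℝ} {A : Matrix (Fin n) (Fin n) ℝ} (hA : Ell lam Lam A)
    (hlam : 0 ≤ lam) {B : Bil n} (hB : ∀ v, 0 ≤ B v v) : 0 ≤ trB A B :=
  trB_nonneg_of_psd hA.symm (fun ξ => (by positivity : (0 : ℝ) ≤ lam * ‖ξ‖ ^ 2).trans (hA.lower ξ))
    hB

lemma Ell.apply_le_trB {lam Lam : ℝ} {A : Matrix (Fin n) (Fin n) ℝ} (hA : Ell lam Lam A)
    (hlam : 0 ≤ lam) {B : Bil n} (hB : ∀ v, 0 ≤ B v v) {v : Eu n} (hv : ‖v‖ = 1) :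
    lam * B v v ≤ trB A B := by
  have h : 0 ≤ trB (A - lam • Matrix.vecMulVec v v) B := by
    refine trB_nonneg_of_psd (fun i j => ?_) (fun ξ => ?_) hB
    · simp [Matrix.vecMulVec_apply, hA.symm i j, mul_comm]
    · have h1 : ∑ i, ∑ j, (A - lam • Matrix.vecMulVec (v : Fin n → ℝ) v) i j * ξ i * ξ j
          = ∑ i, ∑ j, A i j * ξ i * ξ j - lam * (inner ℝ v ξ) ^ 2 := by
        rw [sq, PiLp.inner_apply, Finset.sum_mul_sum, Finset.mul_sum, ← Finset.sum_sub_distrib]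
        refine Finset.sum_congr rfl fun i _ => ?_
        rw [Finset.mul_sum, ← Finset.sum_sub_distrib]
        refine Finset.sum_congr rfl fun j _ => ?_
        simp [Matrix.vecMulVec_apply]
        ring
      rw [h1]
      have h2 := hA.lower ξ
      have h3 : (inner ℝ v ξ : ℝ) ^ 2 ≤ ‖ξ‖ ^ 2 := by
        have := abs_real_inner_le_norm v ξ
        rw [hv, one_mul] at this
        exact sq_le_sq' (by linarith [neg_abs_le (inner ℝ v ξ : ℝ)]) ((le_abs_self _).trans this)
      nlinarith
  have h1 : trB (A - lam • Matrix.vecMulVec v v) B = trB A B - lam * B v v := by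
    rw [bil_apply B v v, trB, trB, Finset.mul_sum, ← Finset.sum_sub_distrib]
    refine Finset.sum_congr rfl fun i _ => ?_
    rw [Finset.mul_sum, ← Finset.sum_sub_distrib]
    refine Finset.sum_congr rfl fun j _ => ?_
    simp [Matrix.vecMulVec_apply]
    ring
  linarith

lemma bil_opNorm_le_of_diag {B : Bil n} {C : ℝ} (hC : 0 ≤ C) (hs : ∀ v w, B v w = B w v)
    (h0 : ∀ v, 0 ≤ B v v) (h1 : ∀ v, ‖v‖ = 1 → B v v ≤ C) (v : Eu n) : ‖B v‖ ≤ C * ‖v‖ := by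
  have h1' : ∀ v, B v v ≤ C * ‖v‖ ^ 2 := by
    intro v
    rcases eq_or_ne v 0 with rfl | hv
    · simp
    have hv' : 0 < ‖v‖ := norm_pos_iff.2 hv
    have := h1 (‖v‖⁻¹ • v) (by rw [norm_smul, norm_inv, norm_norm]; field_simp)
    simp only [map_smul, smul_apply, smul_eq_mul] at this
    calc B v v = ‖v‖ ^ 2 * (‖v‖⁻¹ * (‖v‖⁻¹ * B v v)) := by field_simp
      _ ≤ ‖v‖ ^ 2 * C := by gcongr
      _ = C * ‖v‖ ^ 2 := by ring
  have key : ∀ v w, B v w ^ 2 ≤ B v v * B w w := by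
    intro v w
    have hq : ∀ t : ℝ, 0 ≤ B w w * (t * t) + 2 * B v w * t + B v v := by
      intro t
      have := h0 (v + t • w)
      simp only [map_add, map_smul, add_apply, smul_apply,
        smul_eq_mul] at this
      rw [hs w v] at this
      linarith
    have := discrim_le_zero hq
    rw [discrim] at this
    nlinarith
  refine ContinuousLinearMap.opNorm_le_bound _ (by positivity) fun w => ?_
  rw [Real.norm_eq_abs]
  refine abs_le_of_sq_le_sq ?_ (by positivity)
  calc B v w ^ 2 ≤ B v v * B w w := key v w
    _ ≤ (C * ‖v‖ ^ 2) * (C * ‖w‖ ^ 2) := by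
        have := h0 v; have := h0 w; have := h1' v; have := h1' w
        gcongr
    _ = (C * ‖v‖ * ‖w‖) ^ 2 := by ring

lemma abs_trB_le {A : Matrix (Fin n) (Fin n) ℝ} {C : ℝ} (hA : ∀ i j, |A i j| ≤ C) (B : Bil n) :
    |trB A B| ≤ n * n * C * ‖B‖ := by
  have hB : ∀ i j : Fin n, |B (EuclideanSpace.single i 1) (EuclideanSpace.single j 1)| ≤ ‖B‖ := by
    intro i j
    have := B.le_opNorm₂ (EuclideanSpace.single i 1) (EuclideanSpace.single j 1)
    simpa using this
  calc |trB A B| ≤ ∑ i : Fin n, ∑ j : Fin n, C * ‖B‖ := by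
        refine (Finset.abs_sum_le_sum_abs _ _).trans (Finset.sum_le_sum fun i _ => ?_)
        refine (Finset.abs_sum_le_sum_abs _ _).trans (Finset.sum_le_sum fun j _ => ?_)
        rw [abs_mul]
        have := hA i j
        exact mul_le_mul this (hB i j) (abs_nonneg _) ((abs_nonneg _).trans this)
    _ = n * n * C * ‖B‖ := by simp; ring

lemma Ell.abs_apply_le {lam Lam : ℝ} {A : Matrix (Fin n) (Fin n) ℝ} (hA : Ell lam Lam A)
    (hlam : 0 ≤ lam) (i j : Fin n) : |A i j| ≤ 2 * Lam := by
  have hLam : 0 ≤ Lam := by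
    have h1 := hA.lower (EuclideanSpace.single i 1)
    have h2 := hA.upper (EuclideanSpace.single i 1)
    simp only [PiLp.norm_single, norm_one, one_pow, mul_one] at h1 h2
    linarith
  rcases eq_or_ne i j with rfl | hij
  · have h1 := hA.lower (EuclideanSpace.single i 1)
    simp at h1
    rw [abs_of_nonneg (by linarith)]
    linarith [hA.diag_le i]
  have hform : ∀ s : ℝ, s ^ 2 = 1 →
      ∑ k, ∑ l, A k l * (EuclideanSpace.single i (1 : ℝ) + s • EuclideanSpace.single j 1 : Eu n) k *
        (EuclideanSpace.single i (1 : ℝ) + s • EuclideanSpace.single j 1 : Eu n) l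
        = A i i + A j j + 2 * s * A i j := by
    intro s hs
    simp [mul_add, add_mul, Finset.sum_add_distrib]
    rw [hA.symm j i]
    linear_combination A j j * hs
  have hnorm : ∀ s : ℝ, s ^ 2 = 1 →
      ‖(EuclideanSpace.single i (1 : ℝ) + s • EuclideanSpace.single j 1 : Eu n)‖ ^ 2 = 2 := by
    intro s hs
    rw [@norm_add_sq_real, norm_smul, inner_smul_right, inner_single_one]
    have : |s| ^ 2 = 1 := by rw [sq_abs, hs]
    simp [hij.symm, this]
    norm_num
  have hu := fun s hs => (hform s hs) ▸ hA.upper _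
  have hl := fun s hs => (hform s hs) ▸ hA.lower _
  have h1 := hu 1 (by norm_num)
  have h2 := hu (-1) (by norm_num)
  rw [hnorm _ (by norm_num)] at h1 h2
  have h3 := hA.lower (EuclideanSpace.single i 1)
  have h4 := hA.lower (EuclideanSpace.single j 1)
  simp at h3 h4
  rw [abs_le]
  constructor <;> linarith

lemma SuperAt.mono {lam Lam f g : ℝ} {B : Bil n} (h : SuperAt lam Lam B f) (hfg : f ≤ g) :
    SuperAt lam Lam B g := by
  obtain ⟨A, hA, hAB⟩ := h
  exact ⟨A, hA, hAB.trans hfg⟩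

end Preliminaries

section HessianCalculus

variable {n : ℕ}

lemma ContDiffAt.differentiableAt_fderiv {w : Eu n → ℝ} {x : Eu n} (hw : ContDiffAt ℝ 2 w x) :
    DifferentiableAt ℝ (fderiv ℝ w) x :=
  (hw.fderiv_right (m := 1) (by norm_num)).differentiableAt (by norm_num)

lemma ContDiffAt.eventually_differentiableAt {w : Eu n → ℝ} {x : Eu n} (hw : ContDiffAt ℝ 2 w x) :
    ∀ᶠ y in 𝓝 x, DifferentiableAt ℝ w y :=
  (hw.eventually (by simp)).mono fun _ h => h.differentiableAt (by norm_num)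

lemma sdE_eq_hess {w : Eu n → ℝ} {x : Eu n} (hw : ContDiffAt ℝ 2 w x) (i j : Fin n) :
    sdE w x i j = hess w x (EuclideanSpace.single i 1) (EuclideanSpace.single j 1) := by
  have h := hw.differentiableAt_fderiv.hasFDerivAt.clm_apply
    (hasFDerivAt_const (EuclideanSpace.single j (1 : ℝ)) x)
  rw [sdE, h.fderiv]
  simp

lemma hess_symm {w : Eu n → ℝ} {x : Eu n} (hw : ContDiffAt ℝ 2 w x) (v v' : Eu n) :
    hess w x v v' = hess w x v' v :=
  (hw.isSymmSndFDerivAt (by simp)).eq v v'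

lemma hess_add {w w' : Eu n → ℝ} {x : Eu n} (hw : ContDiffAt ℝ 2 w x) (hw' : ContDiffAt ℝ 2 w' x) :
    hess (fun y => w y + w' y) x = hess w x + hess w' x := by
  have h : fderiv ℝ (fun y => w y + w' y) =ᶠ[𝓝 x] fun y => fderiv ℝ w y + fderiv ℝ w' y := by
    filter_upwards [hw.eventually_differentiableAt, hw'.eventually_differentiableAt] with y h1 h2
    exact fderiv_fun_add h1 h2
  rw [hess, h.fderiv_eq]
  exact fderiv_fun_add hw.differentiableAt_fderiv hw'.differentiableAt_fderiv

lemma hess_sub {w w' : Eu n → ℝ} {x : Eu n} (hw : ContDiffAt ℝ 2 w x) (hw' : ContDiffAt ℝ 2 w' x) :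
    hess (fun y => w y - w' y) x = hess w x - hess w' x := by
  have h : fderiv ℝ (fun y => w y - w' y) =ᶠ[𝓝 x] fun y => fderiv ℝ w y - fderiv ℝ w' y := by
    filter_upwards [hw.eventually_differentiableAt, hw'.eventually_differentiableAt] with y h1 h2
    exact fderiv_fun_sub h1 h2
  rw [hess, h.fderiv_eq]
  exact fderiv_fun_sub hw.differentiableAt_fderiv hw'.differentiableAt_fderiv

lemma hess_const_mul {w : Eu n → ℝ} {x : Eu n} (hw : ContDiffAt ℝ 2 w x) (c : ℝ) :
    hess (fun y => c * w y) x = c • hess w x := by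
  have h : fderiv ℝ (fun y => c * w y) =ᶠ[𝓝 x] fun y => c • fderiv ℝ w y := by
    filter_upwards [hw.eventually_differentiableAt] with y h1
    exact fderiv_const_mul h1 c
  rw [hess, h.fderiv_eq]
  exact fderiv_fun_const_smul hw.differentiableAt_fderiv c

lemma hess_const_add {w : Eu n → ℝ} {x : Eu n} (c : ℝ) :
    hess (fun y => c + w y) x = hess w x := by
  simp only [hess]
  congr 1
  ext1 y
  exact fderiv_const_add c

lemma hess_sum {ι : Type*} (s : Finset ι) {w : ι → Eu n → ℝ} {x : Eu n}
    (hw : ∀ i ∈ s, ContDiffAt ℝ 2 (w i) x) :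
    hess (fun y => ∑ i ∈ s, w i y) x = ∑ i ∈ s, hess (w i) x := by
  have h : fderiv ℝ (fun y => ∑ i ∈ s, w i y) =ᶠ[𝓝 x] fun y => ∑ i ∈ s, fderiv ℝ (w i) y := by
    have : ∀ᶠ y in 𝓝 x, ∀ i ∈ s, DifferentiableAt ℝ (w i) y :=
      (Filter.eventually_all_finset s).2 fun i hi => (hw i hi).eventually_differentiableAt
    filter_upwards [this] with y h1
    exact fderiv_fun_sum h1
  rw [hess, h.fderiv_eq]
  exact fderiv_fun_sum fun i hi => (hw i hi).differentiableAt_fderiv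

lemma fderiv_comp_real {w : Eu n → ℝ} {x : Eu n} {g : ℝ → ℝ} (hg : DifferentiableAt ℝ g (w x))
    (hw : DifferentiableAt ℝ w x) :
    fderiv ℝ (fun y => g (w y)) x = deriv g (w x) • fderiv ℝ w x := by
  exact (hg.hasDerivAt.comp_hasFDerivAt x hw.hasFDerivAt).fderiv

lemma hess_comp {w : Eu n → ℝ} {x : Eu n} {g : ℝ → ℝ} (hg : ContDiff ℝ 2 g)
    (hw : ContDiffAt ℝ 2 w x) :
    hess (fun y => g (w y)) x
      = deriv (deriv g) (w x) • tens (fderiv ℝ w x) + deriv g (w x) • hess w x := by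
  have hg1 : ContDiff ℝ 1 (deriv g) := by
    have : ContDiff ℝ (1 + 1) g := by simpa [one_add_one_eq_two] using hg
    exact (contDiff_succ_iff_deriv.1 this).2.2
  have h : fderiv ℝ (fun y => g (w y)) =ᶠ[𝓝 x] fun y => deriv g (w y) • fderiv ℝ w y := by
    filter_upwards [hw.eventually_differentiableAt] with y h1
    exact fderiv_comp_real (hg.differentiable (by norm_num) _) h1
  have hw1 : DifferentiableAt ℝ w x := hw.differentiableAt (by norm_num)
  have hd := (hg1.differentiable (by norm_num) (w x)).hasDerivAt.comp_hasFDerivAt x hw1.hasFDerivAt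
  rw [hess, h.fderiv_eq]
  have := hd.smul hw.differentiableAt_fderiv.hasFDerivAt
  rw [HasFDerivAt.fderiv (f := fun y => deriv g (w y) • fderiv ℝ w y) this]
  ext v v'
  simp [tens_apply]
  ring

lemma fderiv_norm_sub_sq (z x : Eu n) :
    fderiv ℝ (fun y => ‖y - z‖ ^ 2) x = (2 : ℝ) • innerB n (x - z) := by
  have h := ((hasFDerivAt_id x).sub_const z).norm_sq
  rw [HasFDerivAt.fderiv (f := fun y => ‖y - z‖ ^ 2) h]
  ext v
  simp [innerB_apply]

lemma contDiff_norm_sub_sq (z : Eu n) {k : WithTop ℕ∞} : ContDiff ℝ k (fun y => ‖y - z‖ ^ 2) :=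
  (contDiff_id.sub contDiff_const).norm_sq ℝ

lemma hess_norm_sub_sq (z x : Eu n) :
    hess (fun y => ‖y - z‖ ^ 2) x = (2 : ℝ) • innerB n := by
  have h : fderiv ℝ (fun y => ‖y - z‖ ^ 2) = fun x => (2 : ℝ) • innerB n (x - z) :=
    funext fun x => fderiv_norm_sub_sq z x
  rw [hess, h]
  have h2 : HasFDerivAt (fun x : Eu n => (2 : ℝ) • innerB n (x - z)) ((2 : ℝ) • innerB n) x := by
    have := ((innerB n).hasFDerivAt (x := x - z)).comp x
      ((hasFDerivAt_id x).sub_const z)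
    exact (this.const_smul (2 : ℝ))
  exact h2.fderiv

/-- Second order necessary condition at a local minimum. -/
lemma hess_nonneg_of_isLocalMin {w : Eu n → ℝ} {x : Eu n} (hw : ContDiffAt ℝ 2 w x)
    (hmin : IsLocalMin w x) (v : Eu n) : 0 ≤ hess w x v v := by
  by_contra! hneg
  set g : ℝ → ℝ := fun t => w (x + t • v) with hg
  have hline : ∀ t, HasDerivAt (fun t : ℝ => x + t • v) v t := fun t => by
    simpa using ((hasDerivAt_id t).smul_const v).const_add x
  have hcont : ContinuousAt (fun t : ℝ => x + t • v) 0 := (hline 0).continuousAt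
  have h0 : x + (0 : ℝ) • v = x := by simp
  have hg1 : deriv g =ᶠ[𝓝 0] fun t => fderiv ℝ w (x + t • v) v := by
    have : ∀ᶠ y in 𝓝 (x + (0 : ℝ) • v), DifferentiableAt ℝ w y := by
      rw [h0]
      exact hw.eventually_differentiableAt
    filter_upwards [hcont.eventually this] with t ht
    exact (ht.hasFDerivAt.comp_hasDerivAt t (hline t)).deriv
  have hdd : HasDerivAt (fun t : ℝ => fderiv ℝ w (x + t • v) v) (hess w x v v) 0 := by
    have h1 : HasFDerivAt (fderiv ℝ w) (hess w x) (x + (0 : ℝ) • v) := by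
      rw [h0]
      exact hw.differentiableAt_fderiv.hasFDerivAt
    have h2 : HasDerivAt (fun t : ℝ => fderiv ℝ w (x + t • v)) (hess w x v) 0 :=
      h1.comp_hasDerivAt (0 : ℝ) (hline 0)
    exact (ContinuousLinearMap.apply ℝ ℝ v).hasFDerivAt.comp_hasDerivAt (0 : ℝ) h2
  have hdd' : deriv (deriv g) 0 = hess w x v v := by
    rw [hg1.deriv_eq]
    exact hdd.deriv
  have hgmin : IsLocalMin g 0 := by
    have : Filter.Tendsto (fun t : ℝ => x + t • v) (𝓝 0) (𝓝 x) := by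
      simpa [h0] using hcont.tendsto
    filter_upwards [this.eventually hmin] with t ht
    simpa [hg] using ht
  have hgc : ContinuousAt g 0 := by
    have : ContinuousAt w (x + (0 : ℝ) • v) := by
      rw [h0]
      exact hw.continuousAt
    exact this.comp (f := fun t : ℝ => x + t • v) hcont
  have hgmax : IsLocalMax g 0 :=
    isLocalMax_of_deriv_deriv_neg (by rw [hdd']; exact hneg) hgmin.deriv_eq_zero hgc
  have hconst : g =ᶠ[𝓝 0] fun _ => g 0 := by
    filter_upwards [hgmin, hgmax] with t h1 h2
    exact le_antisymm h2 h1
  have : deriv (deriv g) 0 = 0 := by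
    have h1 : deriv g =ᶠ[𝓝 0] fun _ => (0 : ℝ) := by
      have := hconst.deriv
      refine this.trans (Filter.Eventually.of_forall fun t => ?_)
      simp
    rw [h1.deriv_eq]
    simp
  linarith

end HessianCalculus

section TouchingParaboloids

open MeasureTheory Metric

variable {n : ℕ}

lemma volume_closedBall_eq (z : Eu n) {r : ℝ} (hr : 0 ≤ r) :
    volume (closedBall z r) = ENNReal.ofReal (r ^ n) * volume (closedBall (0 : Eu n) 1) := by
  rw [Measure.addHaar_closedBall' volume z hr]
  simp

lemma volume_closedBall_mul (z z' : Eu n) {r c : ℝ} (hr : 0 ≤ r) (hc : 0 ≤ c) :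
    volume (closedBall z (c * r)) = ENNReal.ofReal (c ^ n) * volume (closedBall z' r) := by
  rw [volume_closedBall_eq z (by positivity), volume_closedBall_eq z' hr, mul_pow,
    ENNReal.ofReal_mul (by positivity), mul_assoc]

lemma volume_closedBall_ne_zero (z : Eu n) {r : ℝ} (hr : 0 < r) : volume (closedBall z r) ≠ 0 :=
  (measure_closedBall_pos volume z hr).ne'

lemma volume_closedBall_ne_top (z : Eu n) (r : ℝ) : volume (closedBall z r) ≠ ⊤ :=
  measure_closedBall_lt_top.ne

lemma abs_det_le_pow {f : Eu n →L[ℝ] Eu n} {C : ℝ} (hC : 0 ≤ C) (hf : ∀ v, ‖f v‖ ≤ C * ‖v‖) :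
    |f.det| ≤ C ^ n := by
  have h1 := Measure.addHaar_image_continuousLinearMap volume f (closedBall (0 : Eu n) 1)
  have h2 : f '' closedBall (0 : Eu n) 1 ⊆ closedBall 0 C := by
    rintro _ ⟨v, hv, rfl⟩
    rw [mem_closedBall_zero_iff] at hv ⊢
    exact (hf v).trans (mul_le_of_le_one_right hC hv)
  have h3 := measure_mono (μ := volume) h2
  rw [h1, volume_closedBall_eq 0 hC] at h3
  have h4 := (ENNReal.mul_le_mul_iff_left (volume_closedBall_ne_zero 0 one_pos)
    (volume_closedBall_ne_top 0 1)).1 h3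
  exact (ENNReal.ofReal_le_ofReal_iff (by positivity)).1 h4

/-- At a point where a paraboloid of opening `k` touches `w` from below, the differential inequality
bounds the derivative of the map recording the vertex of the paraboloid. -/
lemma norm_vertex_fderiv_le {lam Lam k : ℝ} (hlam : 0 < lam) (hLam : 0 ≤ Lam) (hk : 0 < k)
    {B : Bil n} (hs : ∀ v v', B v v' = B v' v) (hB : ∀ v, 0 ≤ (B + k • innerB n) v v)
    (hsup : SuperAt lam Lam B k) (v : Eu n) :
    ‖v + k⁻¹ • gradL n (B v)‖ ≤ (1 + n * Lam) / lam * ‖v‖ := by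
  obtain ⟨A, hA, hAB⟩ := hsup
  have htr : trB A (B + k • innerB n) ≤ k * (1 + n * Lam) := by
    rw [trB_add, trB_smul]
    have := mul_le_mul_of_nonneg_left hA.trB_inner_le hk.le
    linarith
  have hdiag : ∀ v, ‖v‖ = 1 → (B + k • innerB n) v v ≤ k * ((1 + n * Lam) / lam) := by
    intro v hv
    have := hA.apply_le_trB hlam.le hB hv
    rw [← mul_div_assoc, le_div_iff₀ hlam]
    linarith
  have hsym : ∀ v v', (B + k • innerB n) v v' = (B + k • innerB n) v' v := by
    intro v v'
    simp only [add_apply, smul_apply, innerB_apply, hs v v', real_inner_comm v v']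
  have h := bil_opNorm_le_of_diag (by positivity) hsym hB hdiag v
  have hv : v + k⁻¹ • gradL n (B v) = k⁻¹ • gradL n ((B + k • innerB n) v) := by
    rw [add_apply, map_add, smul_add, smul_apply, map_smul, gradL_inner,
      smul_smul, inv_mul_cancel₀ hk.ne', one_smul, add_comm]
  rw [hv, norm_smul, norm_gradL, norm_inv, Real.norm_eq_abs, abs_of_pos hk]
  calc k⁻¹ * _ ≤ k⁻¹ * (k * ((1 + n * Lam) / lam) * ‖v‖) := by gcongr
    _ = _ := by field_simp

/-- Sliding paraboloids from below: if `w` is small somewhere near the centre of a ball, then it is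
not large on a definite portion of the ball. -/
lemma volume_le_of_touching {lam Lam : ℝ} (hlam : 0 < lam) (hLam : 0 ≤ Lam)
    {w : Eu n → ℝ} {U : Set (Eu n)} {z x₀ : Eu n} {r κ : ℝ} (hr : 0 < r) (hκ : 0 < κ)
    (hU : IsOpen U) (hzU : closedBall z r ⊆ U) (hw : ContDiffOn ℝ 2 w U)
    (hw0 : ∀ x ∈ closedBall z r, 0 ≤ w x)
    (hsup : ∀ x ∈ closedBall z r, SuperAt lam Lam (hess w x) (κ / r ^ 2))
    (hx₀ : x₀ ∈ closedBall z (r / 4)) (hwx₀ : w x₀ ≤ κ / 8) :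
    volume (closedBall z (1 / 8 * r)) ≤ ENNReal.ofReal (((1 + n * Lam) / lam) ^ n) *
      volume ({x | w x ≤ κ} ∩ closedBall z r) := by
  set C := (1 + n * Lam) / lam with hC
  have hC0 : 0 ≤ C := by positivity
  set k := κ / r ^ 2 with hk
  have hk0 : 0 < k := by positivity
  have hwat : ∀ x ∈ closedBall z r, ContDiffAt ℝ 2 w x := fun x hx =>
    hw.contDiffAt (hU.mem_nhds (hzU hx))
  have hwc : ContinuousOn w (closedBall z r) := hw.continuousOn.mono hzU
  set T : Eu n → Eu n := fun x => x + k⁻¹ • gradL n (fderiv ℝ w x) with hT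
  set T' : Eu n → Eu n →L[ℝ] Eu n := fun x =>
    ContinuousLinearMap.id ℝ _ + k⁻¹ • (gradL n).comp (hess w x) with hT'
  have hTd : ∀ x ∈ closedBall z r, HasFDerivAt T (T' x) x := by
    intro x hx
    exact (hasFDerivAt_id x).add
      (((gradL n).hasFDerivAt.comp x (hwat x hx).differentiableAt_fderiv.hasFDerivAt).const_smul k⁻¹)
  have hT'v : ∀ x v, T' x v = v + k⁻¹ • gradL n (hess w x v) := fun x v => by simp [hT']
  have hhc : ContinuousOn (hess w) U := by
    have h1 : ContDiffOn ℝ 1 (fderiv ℝ w) U := hw.fderiv_of_isOpen hU (by norm_num)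
    exact h1.continuousOn_fderiv_of_isOpen hU (by norm_num)
  set S : Set (Eu n) := {x | w x ≤ κ ∧ ‖T' x‖ ≤ C} ∩ closedBall z r with hS
  have hSm : MeasurableSet S := by
    have h1 : ContinuousOn (fun x => (w x, ‖T' x‖)) (closedBall z r) := by
      refine hwc.prodMk (ContinuousOn.norm ?_)
      have : ContinuousOn (fun x => (gradL n).comp (hess w x)) (closedBall z r) :=
        (ContinuousLinearMap.compL ℝ (Eu n) (Eu n →L[ℝ] ℝ) (Eu n) (gradL n)).continuous.comp_continuousOn
          (hhc.mono hzU)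
      exact continuousOn_const.add (this.const_smul k⁻¹)
    have h2 := h1.preimage_isClosed_of_isClosed isClosed_closedBall
      ((isClosed_Iic (a := κ)).prod (isClosed_Iic (a := C)))
    have h3 : S = closedBall z r ∩ (fun x => (w x, ‖T' x‖)) ⁻¹' (Iic κ ×ˢ Iic C) := by
      ext x
      simp [hS, and_comm]
    rw [h3]
    exact h2.measurableSet
  have hsub : closedBall z (1 / 8 * r) ⊆ T '' S := by
    intro y hy
    rw [mem_closedBall] at hy hx₀
    set F : Eu n → ℝ := fun x => w x + k / 2 * ‖x - y‖ ^ 2 with hF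
    have hFc : ContinuousOn F (closedBall z r) := by
      refine hwc.add (Continuous.continuousOn ?_)
      fun_prop
    obtain ⟨x, hx, hxmin⟩ := (isCompact_closedBall z r).exists_isMinOn
      (nonempty_closedBall.2 hr.le) hFc
    have hkr : k * r ^ 2 = κ := by rw [hk]; field_simp
    have hx₀' : ‖x₀ - y‖ ≤ 3 / 8 * r := by
      rw [← dist_eq_norm]
      have := dist_triangle_right x₀ y z
      linarith
    have hFx₀ : F x₀ ≤ 25 / 128 * κ := by
      have h1 : ‖x₀ - y‖ ^ 2 ≤ (3 / 8 * r) ^ 2 := by gcongr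
      have : k / 2 * ‖x₀ - y‖ ^ 2 ≤ k / 2 * (3 / 8 * r) ^ 2 := by gcongr
      simp only [hF]
      nlinarith
    have hx₀mem : x₀ ∈ closedBall z r := by
      rw [mem_closedBall]
      linarith
    have hFx : F x ≤ 25 / 128 * κ := (hxmin hx₀mem).trans hFx₀
    have hxball : x ∈ ball z r := by
      rw [mem_ball]
      by_contra! hge
      have h1 : 7 / 8 * r ≤ ‖x - y‖ := by
        rw [← dist_eq_norm]
        have := dist_triangle x y z
        linarith
      have h2 : (7 / 8 * r) ^ 2 ≤ ‖x - y‖ ^ 2 := by gcongr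
      have h3 : k / 2 * (7 / 8 * r) ^ 2 ≤ k / 2 * ‖x - y‖ ^ 2 := by gcongr
      have h4 := hw0 x hx
      simp only [hF] at hFx
      nlinarith
    have hloc : IsLocalMin F x := hxmin.isLocalMin (closedBall_mem_nhds_of_mem hxball)
    have hquad : ContDiffAt ℝ 2 (fun x => k / 2 * ‖x - y‖ ^ 2) x :=
      contDiffAt_const.mul (contDiff_norm_sub_sq y).contDiffAt
    have hFat : ContDiffAt ℝ 2 F x := (hwat x hx).add hquad
    have hgrad : fderiv ℝ w x = -(k • innerB n (x - y)) := by
      have h1 := hloc.fderiv_eq_zero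
      rw [hF, fderiv_fun_add ((hwat x hx).differentiableAt (by norm_num))
        (hquad.differentiableAt (by norm_num)),
        fderiv_const_mul ((contDiff_norm_sub_sq y (k := 1)).differentiable (by norm_num) x),
        fderiv_norm_sub_sq, smul_smul] at h1
      rw [eq_neg_iff_add_eq_zero, ← h1]
      congr 2
      ring
    have hhess : ∀ v, 0 ≤ (hess w x + k • innerB n) v v := by
      intro v
      have h1 := hess_nonneg_of_isLocalMin hFat hloc v
      rw [hF, hess_add (hwat x hx) hquad, hess_const_mul (contDiff_norm_sub_sq y).contDiffAt,
        hess_norm_sub_sq, smul_smul, div_mul_cancel₀ k two_ne_zero] at h1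
      exact h1
    refine ⟨x, ⟨⟨?_, ?_⟩, hx⟩, ?_⟩
    · have : 0 ≤ k / 2 * ‖x - y‖ ^ 2 := by positivity
      simp only [hF] at hFx
      linarith
    · refine ContinuousLinearMap.opNorm_le_bound _ hC0 fun v => ?_
      rw [hT'v]
      exact norm_vertex_fderiv_le hlam hLam hk0 (hess_symm (hwat x hx)) hhess (hsup x hx) v
    · simp only [hT]
      rw [hgrad, map_neg, map_smul, gradL_inner, smul_neg, smul_smul, inv_mul_cancel₀ hk0.ne',
        one_smul]
      abel
  calc volume (closedBall z (1 / 8 * r)) ≤ volume (T '' S) := measure_mono hsub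
    _ ≤ ∫⁻ x in S, ENNReal.ofReal |(T' x).det| :=
        addHaar_image_le_lintegral_abs_det_fderiv volume hSm
          fun x hx => (hTd x hx.2).hasFDerivWithinAt
    _ ≤ ∫⁻ _ in S, ENNReal.ofReal (C ^ n) := by
        refine setLIntegral_mono' hSm fun x hx => ENNReal.ofReal_le_ofReal ?_
        exact abs_det_le_pow hC0 fun v => (T' x).le_of_opNorm_le hx.1.2 v
    _ = ENNReal.ofReal (C ^ n) * volume S := by rw [setLIntegral_const]
    _ ≤ _ := by
        gcongr
        exact inter_subset_inter_left _ fun x hx => hx.1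

end TouchingParaboloids

section Barrier

open MeasureTheory Metric

variable {n : ℕ}

lemma hess_exp_norm_sub_sq (κ θ : ℝ) (z x : Eu n) :
    hess (fun y => κ * Real.exp (-θ * ‖y - z‖ ^ 2)) x
      = (κ * (θ ^ 2 * Real.exp (-θ * ‖x - z‖ ^ 2))) • tens ((2 : ℝ) • innerB n (x - z))
        + (κ * (-θ * Real.exp (-θ * ‖x - z‖ ^ 2))) • ((2 : ℝ) • innerB n) := by
  set g : ℝ → ℝ := fun t => κ * Real.exp (-θ * t) with hg
  have hgc : ContDiff ℝ 2 g := by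
    simp only [hg]
    fun_prop
  have hder : ∀ c : ℝ, deriv (fun t => c * Real.exp (-θ * t)) = fun t => (c * -θ) * Real.exp (-θ * t) := by
    intro c
    ext t
    have h1 : HasDerivAt (fun t => -θ * t) (-θ) t := by
      simpa using (hasDerivAt_id t).const_mul (-θ)
    rw [(h1.exp.const_mul c).deriv]
    ring
  have h := hess_comp (w := fun y => ‖y - z‖ ^ 2) (x := x) hgc (contDiff_norm_sub_sq z).contDiffAt
  rw [hess_norm_sub_sq, fderiv_norm_sub_sq] at h
  simp only [hg, hder] at h
  rw [h]
  congr 2 <;> ring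

lemma norm_innerB (x : Eu n) : ‖innerB n x‖ = ‖x‖ := by
  rw [← norm_gradL, gradL_inner]

/-- A Hopf type lower bound: a nonnegative supersolution that is large near the centre of a ball
grows at least linearly from the boundary of the ball. -/
lemma exists_hopf_lower_bound (n : ℕ) {lam Lam : ℝ} (hlam : 0 < lam) (hLam : 0 ≤ Lam) :
    ∃ c > 0, ∃ δ > 0, ∀ (w : Eu n → ℝ) (U : Set (Eu n)) (z : Eu n) (R κ : ℝ), 0 < R → 0 < κ →
      IsOpen U → closedBall z R ⊆ U → ContDiffOn ℝ 2 w U → (∀ x ∈ closedBall z R, 0 ≤ w x) →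
      (∀ x ∈ closedBall z (R / 16), κ ≤ w x) →
      (∀ x ∈ closedBall z R, SuperAt lam Lam (hess w x) (δ * κ / R ^ 2)) →
      ∀ x ∈ closedBall z R, c * κ * (1 - ‖x - z‖ / R) ≤ w x := by
  set α := 64 * (2 * n * Lam + 1) / lam with hα
  have hα0 : 0 < α := by positivity
  have hαlam : α * lam = 64 * (2 * n * Lam + 1) := by rw [hα]; field_simp
  refine ⟨α * Real.exp (-α), by positivity, α * Real.exp (-α) / 2, by positivity, ?_⟩
  intro w U z R κ hR hκ hU hzU hw hw0 hwκ hsup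
  have hwat : ∀ x ∈ closedBall z R, ContDiffAt ℝ 2 w x := fun x hx =>
    hw.contDiffAt (hU.mem_nhds (hzU hx))
  set θ := α / R ^ 2 with hθ
  have hθ0 : 0 < θ := by positivity
  have hθR : θ * R ^ 2 = α := by rw [hθ]; field_simp
  set e : Eu n → ℝ := fun x => κ * Real.exp (-θ * ‖x - z‖ ^ 2) with he
  have hec : ∀ x, ContDiffAt ℝ 2 e x := by
    intro x
    have : ContDiff ℝ 2 (fun t : ℝ => κ * Real.exp (-θ * t)) := by fun_prop
    exact (this.comp (contDiff_norm_sub_sq z)).contDiffAt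
  have hsq : ∀ x ∈ closedBall z R, θ * ‖x - z‖ ^ 2 ≤ α := by
    intro x hx
    rw [mem_closedBall, dist_eq_norm] at hx
    rw [← hθR]
    gcongr
  have hmain : ∀ x ∈ closedBall z R, e x - κ * Real.exp (-α) ≤ w x := by
    have hc : ContinuousOn (fun x => w x - e x) (closedBall z R) := by
      refine (hw.continuousOn.mono hzU).sub (continuousOn_of_forall_continuousAt fun x _ => (hec x).continuousAt)
    obtain ⟨x, hx, hmin⟩ := (isCompact_closedBall z R).exists_isMinOn
      (nonempty_closedBall.2 hR.le) hc
    suffices h : e x - κ * Real.exp (-α) ≤ w x by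
      intro y hy
      have : w x - e x ≤ w y - e y := hmin hy
      linarith
    by_cases hx1 : x ∈ closedBall z (R / 16)
    · have h1 := hwκ x hx1
      have h2 : e x ≤ κ := by
        simp only [he]
        refine mul_le_of_le_one_right hκ.le (Real.exp_le_one_iff.2 ?_)
        have := mul_nonneg hθ0.le (sq_nonneg ‖x - z‖)
        linarith
      have h3 : 0 < κ * Real.exp (-α) := by positivity
      linarith
    by_cases hx2 : x ∈ ball z R
    · exfalso
      have hloc : IsLocalMin (fun x => w x - e x) x :=
        hmin.isLocalMin (closedBall_mem_nhds_of_mem hx2)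
      obtain ⟨A, hA, hAw⟩ := hsup x hx
      have h1 : 0 ≤ trB A (hess (fun x => w x - e x) x) :=
        hA.trB_nonneg hlam.le (hess_nonneg_of_isLocalMin ((hwat x hx).sub (hec x)) hloc)
      rw [hess_sub (hwat x hx) (hec x), trB_sub, hess_exp_norm_sub_sq, trB_add, trB_smul, trB_smul,
        trB_smul] at h1
      have h2 := hA.trB_tens_ge ((2 : ℝ) • innerB n (x - z))
      rw [norm_smul, norm_innerB] at h2
      have h3 := hA.trB_inner_le
      set E := Real.exp (-θ * ‖x - z‖ ^ 2) with hE
      have hE0 : 0 < E := Real.exp_pos _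
      have hEα : Real.exp (-α) ≤ E := by
        rw [hE, Real.exp_le_exp]
        linarith [hsq x hx]
      have hxn : R / 16 ≤ ‖x - z‖ := by
        rw [mem_closedBall, dist_eq_norm] at hx1
        exact (not_le.1 hx1).le
      have h4 : lam * (R ^ 2 / 64) ≤ trB A (tens ((2 : ℝ) • innerB n (x - z))) := by
        refine le_trans ?_ h2
        gcongr
        rw [Real.norm_two]
        have : (2 * (R / 16)) ^ 2 ≤ (2 * ‖x - z‖) ^ 2 := by gcongr
        linarith
      have h5 : κ * (θ ^ 2 * E) * (lam * (R ^ 2 / 64))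
          ≤ κ * (θ ^ 2 * E) * trB A (tens ((2 : ℝ) • innerB n (x - z))) := by gcongr
      have h6 : κ * (θ * E) * (2 * trB A (innerB n)) ≤ κ * (θ * E) * (2 * (n * Lam)) := by gcongr
      have h7 : κ * (θ ^ 2 * E) * (lam * (R ^ 2 / 64)) = κ * (θ * E) * (2 * n * Lam + 1) := by
        have : θ ^ 2 * E * (lam * (R ^ 2 / 64)) = θ * E * ((θ * R ^ 2) * lam / 64) := by ring
        rw [mul_assoc, this, hθR, hαlam]
        ring
      have h8 : κ * (θ * Real.exp (-α)) ≤ κ * (θ * E) := by gcongr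
      have h9 : α * Real.exp (-α) / 2 * κ / R ^ 2 = κ * (θ * Real.exp (-α)) / 2 := by
        rw [hθ]; field_simp
      have h10 : 0 < κ * (θ * Real.exp (-α)) := by positivity
      rw [h9] at hAw
      nlinarith
    · have hxR : ‖x - z‖ = R := by
        rw [mem_ball, dist_eq_norm] at hx2
        rw [mem_closedBall, dist_eq_norm] at hx
        exact le_antisymm hx (not_lt.1 hx2)
      have : e x = κ * Real.exp (-α) := by
        simp only [he]
        rw [hxR, neg_mul, hθR]
      rw [this, sub_self]
      exact hw0 x hx
  intro x hx
  refine le_trans ?_ (hmain x hx)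
  set t := ‖x - z‖ / R with ht
  have ht0 : 0 ≤ t := by positivity
  have ht1 : t ≤ 1 := by
    rw [mem_closedBall, dist_eq_norm] at hx
    exact (div_le_one hR).2 hx
  have h1 : -θ * ‖x - z‖ ^ 2 = -α + α * (1 - t ^ 2) := by
    rw [ht, ← hθR]
    field_simp
    ring
  have h2 : e x = κ * (Real.exp (-α) * Real.exp (α * (1 - t ^ 2))) := by
    simp only [he]
    rw [h1, Real.exp_add]
  have h3 := Real.add_one_le_exp (α * (1 - t ^ 2))
  have h4 : α * (1 - t) ≤ α * (1 - t ^ 2) := by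
    refine mul_le_mul_of_nonneg_left ?_ hα0.le
    nlinarith
  have h5 : κ * (Real.exp (-α) * (α * (1 - t) + 1)) ≤ κ * (Real.exp (-α) * Real.exp (α * (1 - t ^ 2))) := by
    gcongr
    linarith
  rw [h2]
  linarith

lemma measurableSet_lt_inter {w : Eu n → ℝ} {S : Set (Eu n)} (hw : ContinuousOn w S)
    (hS : MeasurableSet S) (κ : ℝ) : MeasurableSet ({x | κ < w x} ∩ S) := by
  obtain ⟨V, hV, hVe⟩ := (_root_.continuousOn_iff'.1 hw) (Ioi κ) isOpen_Ioi
  have h : {x | κ < w x} ∩ S = V ∩ S := hVe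
  rw [h]
  exact hV.measurableSet.inter hS

/-- If a nonnegative supersolution is large on most of a ball, it is bounded below on a larger
ball. -/
lemma exists_lower_bound_of_almost_full (n : ℕ) {lam Lam : ℝ} (hlam : 0 < lam) (hLam : 0 ≤ Lam) :
    ∃ ε ∈ Ioo (0 : ℝ) 1, ∃ c ∈ Ioo (0 : ℝ) 1, ∃ δ > 0,
      ∀ (w : Eu n → ℝ) (U : Set (Eu n)) (z : Eu n) (s κ : ℝ),
      0 < s → 0 < κ → IsOpen U → closedBall z (4 * s) ⊆ U → ContDiffOn ℝ 2 w U →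
      (∀ x ∈ closedBall z (4 * s), 0 ≤ w x) →
      (∀ x ∈ closedBall z (4 * s), SuperAt lam Lam (hess w x) (δ * κ / s ^ 2)) →
      ENNReal.ofReal (1 - ε) * volume (closedBall z s) ≤ volume ({x | κ < w x} ∩ closedBall z s) →
      ∀ x ∈ closedBall z (3 * s), c * κ < w x := by
  obtain ⟨c, hc, δ, hδ, hopf⟩ := exists_hopf_lower_bound n hlam hLam
  set C := ((1 + n * Lam) / lam) ^ n with hC
  have hC0 : 0 < C := by positivity
  set ε := min (1 / 2) ((1 / 8) ^ n / (2 * C)) with hε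
  have hε0 : 0 < ε := by positivity
  have hε1 : ε ≤ 1 / 2 := min_le_left _ _
  refine ⟨ε, ⟨hε0, by linarith⟩, min (1 / 2) (c / 64), ⟨by positivity, ?_⟩, min 1 (δ / 128),
    by positivity, ?_⟩
  · exact (min_le_left _ _).trans_lt (by norm_num)
  intro w U z s κ hs hκ hU hzU hw hw0 hsup hvol
  have hsub : closedBall z s ⊆ closedBall z (4 * s) := closedBall_subset_closedBall (by linarith)
  have hcore : ∀ x ∈ closedBall z (s / 4), κ / 8 < w x := by
    intro x hx
    by_contra! hle
    have h1 := volume_le_of_touching hlam hLam hs hκ hU (hsub.trans hzU) hw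
      (fun y hy => hw0 y (hsub hy)) (fun y hy => (hsup y (hsub hy)).mono (by
        gcongr
        exact mul_le_of_le_one_left hκ.le (min_le_left _ _))) hx hle
    have hmeas := measurableSet_lt_inter (hw.continuousOn.mono (hsub.trans hzU))
      isClosed_closedBall.measurableSet κ
    have h2 : volume ({x | w x ≤ κ} ∩ closedBall z s) + volume ({x | κ < w x} ∩ closedBall z s)
        = volume (closedBall z s) := by
      rw [← measure_union _ hmeas]
      · congr 1
        ext y
        simp only [mem_union, mem_inter_iff, mem_ofPred_eq]
        have := le_or_gt (w y) κ
        tauto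
      · rw [disjoint_left]
        rintro y ⟨hy1, -⟩ ⟨hy2, -⟩
        exact absurd (show κ < w y from hy2) (not_lt.2 hy1)
    have hV0 := volume_closedBall_ne_zero z hs
    have hVt := volume_closedBall_ne_top z s
    have hVt1 : volume ({x | w x ≤ κ} ∩ closedBall z s) ≠ ⊤ :=
      measure_ne_top_of_subset inter_subset_right hVt
    have hVt2 : volume ({x | κ < w x} ∩ closedBall z s) ≠ ⊤ :=
      measure_ne_top_of_subset inter_subset_right hVt
    rw [volume_closedBall_mul z z hs.le (by norm_num)] at h1
    have h1' := ENNReal.toReal_mono (ENNReal.mul_ne_top ENNReal.ofReal_ne_top hVt1) h1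
    have hvol' := ENNReal.toReal_mono hVt2 hvol
    have h2' := congrArg ENNReal.toReal h2
    rw [ENNReal.toReal_add hVt1 hVt2] at h2'
    rw [ENNReal.toReal_mul, ENNReal.toReal_mul, ENNReal.toReal_ofReal (by positivity),
      ENNReal.toReal_ofReal hC0.le] at h1'
    rw [ENNReal.toReal_mul, ENNReal.toReal_ofReal (by linarith)] at hvol'
    have hVpos : 0 < (volume (closedBall z s)).toReal := ENNReal.toReal_pos hV0 hVt
    set V := (volume (closedBall z s)).toReal
    set V1 := (volume ({x | w x ≤ κ} ∩ closedBall z s)).toReal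
    have h3 : V1 ≤ ε * V := by linarith
    have h4 : C * V1 ≤ C * (ε * V) := by gcongr
    have h5 : C * ε ≤ (1 / 8) ^ n / 2 := by
      calc C * ε ≤ C * ((1 / 8) ^ n / (2 * C)) := by gcongr; exact min_le_right _ _
        _ = _ := by field_simp
    have h6 : (0 : ℝ) < (1 / 8) ^ n := by positivity
    nlinarith
  intro x hx
  have h4s : (0 : ℝ) < 4 * s := by linarith
  have h := hopf w U z (4 * s) (κ / 8) h4s (by linarith) hU hzU hw hw0 (fun y hy => (hcore y (by
    convert hy using 2; ring)).le) (fun y hy => (hsup y hy).mono (by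
      have : min 1 (δ / 128) ≤ δ / 128 := min_le_right _ _
      calc min 1 (δ / 128) * κ / s ^ 2 ≤ δ / 128 * κ / s ^ 2 := by gcongr
        _ = δ * (κ / 8) / (4 * s) ^ 2 := by field_simp; norm_num)) x
    (closedBall_subset_closedBall (by linarith) hx)
  rw [mem_closedBall, dist_eq_norm] at hx
  have h1 : ‖x - z‖ / (4 * s) ≤ 3 / 4 := by
    rw [div_le_iff₀ h4s]
    linarith
  have h2 : c * (κ / 8) * (1 / 4) ≤ c * (κ / 8) * (1 - ‖x - z‖ / (4 * s)) := by
    gcongr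
    linarith
  have h3 : min (1 / 2) (c / 64) * κ ≤ c / 64 * κ := by gcongr; exact min_le_right _ _
  have h4 : 0 < c * κ := by positivity
  linarith

end Barrier

section InkSpots

open MeasureTheory Metric

variable {n : ℕ}

lemma exists_critical_ball {A : Set (Eu n)} {z : Eu n} {r ε : ℝ} (hr : 0 < r) (hε : 0 < ε)
    (hAlt : volume (A ∩ closedBall z r) < ENNReal.ofReal (1 - ε) * volume (closedBall z r)) :
    ∀ᵐ x ∂(volume.restrict A), x ∈ closedBall z r →
      ∃ (c c' : Eu n) (s : ℝ), 0 < s ∧ s ≤ r ∧ x ∈ closedBall c (2 * s) ∧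
        closedBall c (2 * s) ⊆ closedBall z r ∧ dist c' z + s ≤ r ∧
        closedBall c (2 * s) ⊆ closedBall c' (3 * s) ∧
        volume (A ∩ closedBall c (2 * s)) < ENNReal.ofReal (1 - ε) * volume (closedBall c (2 * s)) ∧
        ENNReal.ofReal (1 - ε) * volume (closedBall c' s) ≤ volume (A ∩ closedBall c' s) := by
  filter_upwards [IsUnifLocDoublingMeasure.ae_tendsto_measure_inter_div (volume : Measure (Eu n)) A 1]
    with x hx hxz
  rw [mem_closedBall, dist_eq_norm] at hxz
  set t : ℕ → ℝ := fun k => (1 / 2) ^ k with ht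
  have ht0 : ∀ k, 0 < t k := fun k => by positivity
  have ht1 : ∀ k, t k ≤ 1 := fun k => pow_le_one₀ (by norm_num) (by norm_num)
  set c : ℕ → Eu n := fun k => z + (1 - t k) • (x - z) with hc
  have hxc : ∀ k, ‖x - c k‖ ≤ t k * r := by
    intro k
    have : x - c k = t k • (x - z) := by
      simp only [hc]
      module
    rw [this, norm_smul, Real.norm_eq_abs, abs_of_pos (ht0 k)]
    gcongr
  have hdist : ∀ k, dist (c k) z + t k * r ≤ r := by
    intro k
    have : c k - z = (1 - t k) • (x - z) := by
      simp only [hc]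
      module
    rw [dist_eq_norm, this, norm_smul, Real.norm_eq_abs, abs_of_nonneg (by linarith [ht1 k])]
    have := mul_le_mul_of_nonneg_left hxz (by linarith [ht1 k] : 0 ≤ 1 - t k)
    linarith
  have hlim := hx (l := Filter.atTop) c (fun k => t k * r) (by
    refine tendsto_nhdsWithin_iff.2 ⟨?_, Filter.Eventually.of_forall fun k => mul_pos (ht0 k) hr⟩
    have : Filter.Tendsto t Filter.atTop (𝓝 0) :=
      tendsto_pow_atTop_nhds_zero_of_lt_one (by norm_num) (by norm_num)
    simpa using this.mul_const r) (Filter.Eventually.of_forall fun k => by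
      rw [mem_closedBall, dist_eq_norm, one_mul]
      exact hxc k)
  have hex : ∃ k, ENNReal.ofReal (1 - ε) * volume (closedBall (c k) (t k * r))
      ≤ volume (A ∩ closedBall (c k) (t k * r)) := by
    have hlt : ENNReal.ofReal (1 - ε) < 1 := by
      rw [ENNReal.ofReal_lt_one]
      linarith
    obtain ⟨k, hk⟩ := (hlim.eventually (lt_mem_nhds hlt)).exists
    refine ⟨k, ?_⟩
    rw [ENNReal.lt_div_iff_mul_lt (Or.inl (volume_closedBall_ne_zero _ (mul_pos (ht0 k) hr)))
      (Or.inl (volume_closedBall_ne_top _ _))] at hk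
    exact hk.le
  classical
  have hk := Nat.find_spec hex
  have hkmin := fun m => Nat.find_min hex (m := m)
  generalize Nat.find hex = k at hk hkmin
  have hk0 : k ≠ 0 := by
    rintro rfl
    have h0 : t 0 = 1 := by simp [ht]
    have h1 : c 0 = z := by simp [hc, h0]
    rw [h0, h1, one_mul] at hk
    exact absurd hAlt (not_lt.2 hk)
  obtain ⟨j, rfl⟩ := Nat.exists_eq_succ_of_ne_zero hk0
  have hj := hkmin j (Nat.lt_succ_self j)
  have htj : t j * r = 2 * (t (j + 1) * r) := by
    simp only [ht, pow_succ]
    ring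
  rw [not_le, htj] at hj
  refine ⟨c j, c (j + 1), t (j + 1) * r, mul_pos (ht0 _) hr, mul_le_of_le_one_left hr.le (ht1 _),
    ?_, ?_, hdist _, ?_, hj, hk⟩
  · rw [mem_closedBall, dist_eq_norm, ← htj]
    exact hxc j
  · rw [← htj]
    exact closedBall_subset_closedBall' (by linarith [hdist j])
  · refine closedBall_subset_closedBall' ?_
    have : c j - c (j + 1) = -(t (j + 1) • (x - z)) := by
      simp only [hc, ht, pow_succ]
      module
    rw [dist_eq_norm, this, norm_neg, norm_smul, Real.norm_eq_abs, abs_of_pos (ht0 _)]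
    have := mul_le_mul_of_nonneg_left hxz (ht0 (j + 1)).le
    linarith

/-- Growing ink spots: if every ball on which `A` has large density can be enlarged within `E`, then
`E` has definitely more volume than `A`. -/
lemma volume_ink_spots {A E : Set (Eu n)} {z : Eu n} {r ε : ℝ} (hr : 0 < r) (hε : 0 < ε)
    (hε1 : ε < 1) (hA : MeasurableSet A) (hAB : A ⊆ closedBall z r) (hAE : A ⊆ E)
    (hAlt : volume A < ENNReal.ofReal (1 - ε) * volume (closedBall z r))
    (hE : ∀ (c : Eu n) (s : ℝ), 0 < s → dist c z + s ≤ r →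
      ENNReal.ofReal (1 - ε) * volume (closedBall c s) ≤ volume (A ∩ closedBall c s) →
      closedBall c (3 * s) ∩ closedBall z r ⊆ E) :
    volume A + ENNReal.ofReal (ε / 5 ^ n) * volume A ≤ volume (E ∩ closedBall z r) := by
  have hcrit := exists_critical_ball (A := A) (z := z) hr hε (by
    rwa [inter_eq_self_of_subset_left hAB])
  rw [ae_restrict_iff' hA] at hcrit
  set T : Set (Eu n) := {x | x ∈ A ∧ ∃ (c : Eu n) (s : ℝ), 0 < s ∧ s ≤ r ∧
    x ∈ closedBall c (2 * s) ∧ closedBall c (2 * s) ⊆ E ∩ closedBall z r ∧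
    volume (A ∩ closedBall c (2 * s)) < ENNReal.ofReal (1 - ε) * volume (closedBall c (2 * s))}
    with hT
  have hAT : volume A ≤ volume T := by
    refine measure_mono_ae ?_
    filter_upwards [hcrit] with x hx hxA
    obtain ⟨c, c', s, hs, hsr, hxc, hcz, hcz', hcc, h1, h2⟩ := hx hxA (hAB hxA)
    exact ⟨hxA, c, s, hs, hsr, hxc, subset_inter ((subset_inter hcc hcz).trans (hE c' s hs hcz' h2)) hcz,
      h1⟩
  have hch : ∀ x : T, ∃ (c : Eu n) (s : ℝ), 0 < s ∧ s ≤ r ∧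
    (x : Eu n) ∈ closedBall c (2 * s) ∧ closedBall c (2 * s) ⊆ E ∩ closedBall z r ∧
    volume (A ∩ closedBall c (2 * s)) < ENNReal.ofReal (1 - ε) * volume (closedBall c (2 * s)) :=
    fun x => x.2.2
  choose c s hs hsr hxc hcE hdens using hch
  obtain ⟨u, -, hdisj, hcov⟩ := Vitali.exists_disjoint_subfamily_covering_enlargement_closedBall
    (univ : Set T) c (fun x => 2 * s x) (2 * r) (fun x _ => by linarith [hsr x]) 5 (by norm_num)
  have hucount : u.Countable := by
    refine hdisj.countable_of_nonempty_interior fun x _ => ?_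
    exact (nonempty_ball.2 (by linarith [hs x])).mono ball_subset_interior_closedBall
  set S : Set (Eu n) := ⋃ x ∈ u, closedBall (c x) (2 * s x) with hS
  have hSvol : volume S = ∑' x : u, volume (closedBall (c x) (2 * s x)) :=
    measure_biUnion hucount hdisj fun x _ => isClosed_closedBall.measurableSet
  have hTcov : volume T ≤ ENNReal.ofReal (5 ^ n) * volume S := by
    calc volume T ≤ volume (⋃ x ∈ u, closedBall (c x) (5 * (2 * s x))) := by
          refine measure_mono fun x hx => ?_
          obtain ⟨y, hy, hxy⟩ := hcov ⟨x, hx⟩ (mem_univ _)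
          exact mem_biUnion hy (hxy (hxc ⟨x, hx⟩))
      _ ≤ ∑' x : u, volume (closedBall (c x) (5 * (2 * s x))) := measure_biUnion_le _ hucount _
      _ = ∑' x : u, ENNReal.ofReal (5 ^ n) * volume (closedBall (c x) (2 * s x)) := by
          refine tsum_congr fun x => ?_
          exact volume_closedBall_mul _ _ (by linarith [hs x]) (by norm_num)
      _ = _ := by rw [ENNReal.tsum_mul_left, hSvol]
  have hdiff : ENNReal.ofReal ε * volume S ≤ volume (S \ A) := by
    have h1 : volume (S \ A) = ∑' x : u, volume (closedBall (c x) (2 * s x) \ A) := by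
      rw [← measure_biUnion hucount (f := fun x => closedBall (c x) (2 * s x) \ A)]
      · congr 1
        simp only [hS, iUnion_sdiff]
      · exact hdisj.mono fun x => sdiff_subset
      · exact fun x _ => isClosed_closedBall.measurableSet.diff hA
    rw [h1, hSvol, ← ENNReal.tsum_mul_left]
    refine ENNReal.tsum_le_tsum fun x => ?_
    have h2 := measure_inter_add_sdiff (μ := volume) (closedBall (c x) (2 * s x)) hA
    have h3 := (hdens x).le
    have hVt := volume_closedBall_ne_top (c x) (2 * s x)
    set V := volume (closedBall (c x) (2 * s x))
    rw [inter_comm] at h3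
    have h4 : ENNReal.ofReal ε * V + ENNReal.ofReal (1 - ε) * V = V := by
      rw [← add_mul, ← ENNReal.ofReal_add hε.le (by linarith)]
      simp
    have h5 : ENNReal.ofReal (1 - ε) * V ≠ ⊤ := ENNReal.mul_ne_top ENNReal.ofReal_ne_top hVt
    refine (ENNReal.add_le_add_iff_right h5).1 ?_
    rw [h4]
    calc V = _ := h2.symm
      _ ≤ ENNReal.ofReal (1 - ε) * V + _ := by gcongr
      _ = _ := add_comm _ _
  have hSE : S ⊆ E ∩ closedBall z r := iUnion₂_subset fun x _ => hcE x
  calc volume A + ENNReal.ofReal (ε / 5 ^ n) * volume A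
      ≤ volume A + ENNReal.ofReal (ε / 5 ^ n) * (ENNReal.ofReal (5 ^ n) * volume S) := by
        gcongr
        exact hAT.trans hTcov
    _ = volume A + ENNReal.ofReal ε * volume S := by
        rw [← mul_assoc, ← ENNReal.ofReal_mul (by positivity), div_mul_cancel₀ _ (by positivity)]
    _ ≤ volume A + volume (S \ A) := by gcongr
    _ = volume (A ∪ S) := by
        rw [add_comm, ← measure_union (disjoint_sdiff_left) hA, sdiff_union_self, union_comm]
    _ ≤ _ := measure_mono (union_subset (subset_inter hAE hAB) hSE)

end InkSpots

section Growth

open MeasureTheory Metric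

/-- The growth lemma of Krylov and Safonov for nonnegative supersolutions. -/
lemma exists_growth (n : ℕ) {lam Lam : ℝ} (hlam : 0 < lam) (hLam : 0 ≤ Lam) :
    ∃ c ∈ Ioo (0 : ℝ) 1, ∃ δ > 0, ∀ (w : Eu n → ℝ) (U : Set (Eu n)) (z : Eu n) (r κ : ℝ),
      0 < r → 0 < κ → IsOpen U → closedBall z (4 * r) ⊆ U → ContDiffOn ℝ 2 w U →
      (∀ x ∈ closedBall z (4 * r), 0 ≤ w x) →
      (∀ x ∈ closedBall z (4 * r), SuperAt lam Lam (hess w x) (δ * κ / r ^ 2)) →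
      ENNReal.ofReal (1 / 2) * volume (closedBall z r) ≤ volume ({x | κ < w x} ∩ closedBall z r) →
      ∀ x ∈ closedBall z r, c * κ < w x := by
  obtain ⟨ε, ⟨hε0, hε1⟩, c, ⟨hc0, hc1⟩, δ, hδ, hfull⟩ :=
    exists_lower_bound_of_almost_full n hlam hLam
  set q : ℝ := 1 + ε / 5 ^ n with hq
  have hq1 : 1 < q := by
    rw [hq]
    have : 0 < ε / 5 ^ n := by positivity
    linarith
  obtain ⟨m, hm⟩ := pow_unbounded_of_one_lt 2 hq1
  refine ⟨c ^ (m + 1), ⟨by positivity, pow_lt_one₀ hc0.le hc1 (by omega)⟩, δ * c ^ m, by positivity, ?_⟩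
  intro w U z r κ hr hκ hU hzU hw hw0 hsup hvol
  have hsub : closedBall z r ⊆ closedBall z (4 * r) := closedBall_subset_closedBall (by linarith)
  have hcm : ∀ j ≤ m, c ^ m ≤ c ^ j := fun j hj => pow_le_pow_of_le_one hc0.le hc1.le hj
  have hstep : ∀ j ≤ m, ∀ (z' : Eu n) (s : ℝ), 0 < s → dist z' z + s ≤ r →
      ENNReal.ofReal (1 - ε) * volume (closedBall z' s)
        ≤ volume ({x | κ * c ^ j < w x} ∩ closedBall z' s) →
      ∀ x ∈ closedBall z' (3 * s), κ * c ^ (j + 1) < w x := by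
    intro j hj z' s hs hzs hden x hx
    have hd : 0 ≤ dist z' z := dist_nonneg
    have hsub' : closedBall z' (4 * s) ⊆ closedBall z (4 * r) :=
      closedBall_subset_closedBall' (by linarith)
    have := hfull w U z' s (κ * c ^ j) hs (by positivity) hU (hsub'.trans hzU) hw
      (fun y hy => hw0 y (hsub' hy)) (fun y hy => (hsup y (hsub' hy)).mono (by
        have h1 := hcm j hj
        have h2 : s ≤ r := by linarith
        calc δ * c ^ m * κ / r ^ 2 ≤ δ * c ^ j * κ / s ^ 2 := by gcongr
          _ = _ := by ring)) hden x hx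
    calc κ * c ^ (j + 1) = c * (κ * c ^ j) := by ring
      _ < _ := this
  set V := volume (closedBall z r) with hV
  have hV0 : V ≠ 0 := volume_closedBall_ne_zero z hr
  have hVt : V ≠ ⊤ := volume_closedBall_ne_top z r
  have hiter : ∀ k ≤ m, (∃ j ≤ m, ENNReal.ofReal (1 - ε) * V
        ≤ volume ({x | κ * c ^ j < w x} ∩ closedBall z r)) ∨
      ENNReal.ofReal (q ^ k / 2) * V ≤ volume ({x | κ * c ^ k < w x} ∩ closedBall z r) := by
    intro k
    induction k with
    | zero =>
      intro _
      right
      simpa using hvol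
    | succ k ih =>
      intro hk
      rcases ih (by omega) with h | h
      · exact Or.inl h
      rcases le_or_gt (ENNReal.ofReal (1 - ε) * V)
        (volume ({x | κ * c ^ k < w x} ∩ closedBall z r)) with h' | h'
      · exact Or.inl ⟨k, by omega, h'⟩
      right
      have hlevel : κ * c ^ (k + 1) ≤ κ * c ^ k :=
        mul_le_mul_of_nonneg_left (pow_le_pow_of_le_one hc0.le hc1.le (by omega)) hκ.le
      have hink := volume_ink_spots (A := {x | κ * c ^ k < w x} ∩ closedBall z r)
        (E := {x | κ * c ^ (k + 1) < w x}) hr hε0 hε1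
        (measurableSet_lt_inter (hw.continuousOn.mono (hsub.trans hzU))
          isClosed_closedBall.measurableSet _) inter_subset_right
        (fun x hx => hlevel.trans_lt (show κ * c ^ k < w x from hx.1)) h'
        (fun z' s hs hzs hden x hx => hstep k (by omega) z' s hs hzs (hden.trans
          (measure_mono (inter_subset_inter_left _ inter_subset_left))) x hx.1)
      refine le_trans ?_ hink
      calc ENNReal.ofReal (q ^ (k + 1) / 2) * V
          = (1 + ENNReal.ofReal (ε / 5 ^ n)) * (ENNReal.ofReal (q ^ k / 2) * V) := by
            rw [← ENNReal.ofReal_one, ← ENNReal.ofReal_add (by norm_num) (by positivity), ← hq,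
              ← mul_assoc, ← ENNReal.ofReal_mul (by linarith)]
            congr 2
            ring
        _ ≤ (1 + ENNReal.ofReal (ε / 5 ^ n)) *
              volume ({x | κ * c ^ k < w x} ∩ closedBall z r) := by gcongr
        _ = _ := by rw [add_mul, one_mul]
  have hj : ∃ j ≤ m, ENNReal.ofReal (1 - ε) * V
        ≤ volume ({x | κ * c ^ j < w x} ∩ closedBall z r) := by
    rcases hiter m le_rfl with h | h
    · exact h
    exfalso
    have h1 := h.trans (measure_mono inter_subset_right)
    have h2 : 1 < ENNReal.ofReal (q ^ m / 2) := by
      rw [ENNReal.one_lt_ofReal]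
      linarith
    have h3 : 1 * V < ENNReal.ofReal (q ^ m / 2) * V :=
      (ENNReal.mul_lt_mul_iff_left hV0 hVt).2 h2
    rw [one_mul] at h3
    exact absurd h1 (not_le.2 h3)
  obtain ⟨j, hjm, hj⟩ := hj
  intro x hx
  have h := hstep j hjm z r hr (by simp) hj x (closedBall_subset_closedBall (by linarith) hx)
  refine lt_of_le_of_lt ?_ h
  rw [mul_comm]
  exact mul_le_mul_of_nonneg_left (pow_le_pow_of_le_one hc0.le hc1.le (by omega)) hκ.le

/-- The growth lemma for uniform limits of supersolutions. -/
lemma exists_growth_of_approx (n : ℕ) {lam Lam : ℝ} (hlam : 0 < lam) (hLam : 0 ≤ Lam) :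
    ∃ c ∈ Ioo (0 : ℝ) 1, ∃ δ > 0, ∀ (w : Eu n → ℝ) (z : Eu n) (r κ : ℝ),
      0 < r → 0 < κ → (∀ x ∈ closedBall z (4 * r), 0 ≤ w x) →
      (∀ η > 0, ∃ (v : Eu n → ℝ) (U : Set (Eu n)), IsOpen U ∧ closedBall z (4 * r) ⊆ U ∧
        ContDiffOn ℝ 2 v U ∧ ∀ x ∈ closedBall z (4 * r), |v x - w x| ≤ η ∧
          SuperAt lam Lam (hess v x) (δ * κ / r ^ 2)) →
      ENNReal.ofReal (1 / 2) * volume (closedBall z r) ≤ volume ({x | κ < w x} ∩ closedBall z r) →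
      ∀ x ∈ closedBall z r, c * κ ≤ w x := by
  obtain ⟨c, hc, δ, hδ, hgrow⟩ := exists_growth n hlam hLam
  refine ⟨c, hc, δ, hδ, ?_⟩
  intro w z r κ hr hκ hw0 happ hvol x hx
  refine le_of_forall_pos_le_add fun η hη => ?_
  obtain ⟨v, U, hU, hzU, hv, hvw⟩ := happ (η / 2) (by linarith)
  have hsub : closedBall z r ⊆ closedBall z (4 * r) := closedBall_subset_closedBall (by linarith)
  have h := hgrow (fun y => η / 2 + v y) U z r κ hr hκ hU hzU (contDiffOn_const.add hv)
    (fun y hy => by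
      have h1 := (abs_le.1 (hvw y hy).1).1
      have h2 := hw0 y hy
      linarith) (fun y hy => by
        rw [hess_const_add]
        exact (hvw y hy).2) (hvol.trans (measure_mono fun y hy => ⟨by
          have h1 := (abs_le.1 (hvw y (hsub hy.2)).1).1
          have h2 : κ < w y := hy.1
          change κ < η / 2 + v y
          linarith, hy.2⟩)) x hx
  have h1 := (abs_le.1 (hvw x (hsub hx)).1).2
  linarith

end Growth

section Iteration

/-- Geometric decay of a quantity that contracts at each scale, up to a linear error. -/
lemma exists_decay {θ q : ℝ} (hθ0 : 0 < θ) (hθ1 : θ < 1) (hq : 1 < q) :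
    ∃ β ∈ Ioo (0 : ℝ) 1, ∃ C > 0, ∀ (ω : ℝ → ℝ) (M B R : ℝ), 0 < R → 0 ≤ M → 0 ≤ B →
      (∀ r s, 0 < r → r ≤ s → s ≤ R → ω r ≤ ω s) → ω R ≤ M →
      (∀ r, 0 < r → r ≤ R → ω (r / q) ≤ θ * ω r + B * (r / R)) →
      ∀ r, 0 < r → r ≤ R → ω r ≤ C * (M + B) * (r / R) ^ β := by
  have hq0 : 0 < q := by linarith
  have hqi : q⁻¹ < 1 := inv_lt_one_of_one_lt₀ hq
  have hqi0 : 0 < q⁻¹ := by positivity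
  set t := max ((1 + θ) / 2) ((1 + q⁻¹) / 2) with ht
  have ht1 : t < 1 := max_lt (by linarith) (by linarith)
  have htθ : θ < t := lt_of_lt_of_le (by linarith) (le_max_left _ _)
  have htq : q⁻¹ < t := lt_of_lt_of_le (by linarith) (le_max_right _ _)
  have ht0 : 0 < t := hθ0.trans htθ
  set β := Real.logb q⁻¹ t with hβ
  have hβt : (q⁻¹) ^ β = t := Real.rpow_logb hqi0 hqi.ne ht0
  have hβ0 : 0 < β := Real.logb_pos_of_base_lt_one hqi0 hqi ht0 ht1
  have hβ1 : β < 1 := by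
    by_contra! h
    have := Real.rpow_le_rpow_of_exponent_ge hqi0 hqi.le h
    rw [hβt, Real.rpow_one] at this
    linarith
  have htθ' : 0 < t - θ := by linarith
  refine ⟨β, ⟨hβ0, hβ1⟩, (1 + 1 / (t - θ)) / t, by positivity, ?_⟩
  intro ω M B R hR hM hB hmono hωR hstep r hr hrR
  set N := M + B / (t - θ) with hN
  have hN0 : 0 ≤ N := by positivity
  have hNB : B ≤ N * (t - θ) := by
    rw [hN, add_mul, div_mul_cancel₀ _ htθ'.ne']
    have := mul_nonneg hM htθ'.le
    linarith
  have hiter : ∀ k : ℕ, ω (R * q⁻¹ ^ k) ≤ N * t ^ k := by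
    intro k
    induction k with
    | zero =>
      simp only [pow_zero, mul_one]
      refine hωR.trans ?_
      rw [hN]
      have : 0 ≤ B / (t - θ) := by positivity
      linarith
    | succ k ih =>
      have hk1 : q⁻¹ ^ k ≤ 1 := pow_le_one₀ hqi0.le hqi.le
      have h1 := hstep (R * q⁻¹ ^ k) (by positivity) (mul_le_of_le_one_right hR.le hk1)
      have h2 : R * q⁻¹ ^ k / q = R * q⁻¹ ^ (k + 1) := by
        rw [pow_succ, div_eq_mul_inv]
        ring
      have h3 : R * q⁻¹ ^ k / R = q⁻¹ ^ k := by field_simp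
      rw [h2, h3] at h1
      have h4 : q⁻¹ ^ k ≤ t ^ k := pow_le_pow_left₀ hqi0.le htq.le k
      have h5 : B * q⁻¹ ^ k ≤ N * (t - θ) * t ^ k := by gcongr
      have h6 : θ * ω (R * q⁻¹ ^ k) ≤ θ * (N * t ^ k) := by gcongr
      rw [pow_succ t]
      linarith
  obtain ⟨k, hk1, hk2⟩ := exists_nat_pow_near_of_lt_one (div_pos hr hR) ((div_le_one hR).2 hrR)
    hqi0 hqi
  have h1 : r ≤ R * q⁻¹ ^ k := by
    rw [div_le_iff₀ hR] at hk2
    linarith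
  have h2 := (hmono r _ hr h1 (mul_le_of_le_one_right hR.le (pow_le_one₀ hqi0.le hqi.le))).trans
    (hiter k)
  have h3 : t ^ (k + 1) ≤ (r / R) ^ β := by
    calc t ^ (k + 1) = (q⁻¹ ^ (k + 1)) ^ β := by
          rw [← hβt, ← Real.rpow_natCast, ← Real.rpow_natCast, ← Real.rpow_mul hqi0.le,
            ← Real.rpow_mul hqi0.le, mul_comm]
      _ ≤ _ := Real.rpow_le_rpow (by positivity) hk1.le hβ0.le
  have h4 : N ≤ (1 + 1 / (t - θ)) * (M + B) := by
    rw [hN, div_eq_mul_one_div B]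
    have : 0 ≤ 1 / (t - θ) := by positivity
    nlinarith [mul_nonneg hM this]
  calc ω r ≤ N * t ^ k := h2
    _ = N / t * t ^ (k + 1) := by rw [pow_succ]; field_simp
    _ ≤ N / t * (r / R) ^ β := by gcongr
    _ ≤ (1 + 1 / (t - θ)) * (M + B) / t * (r / R) ^ β := by gcongr
    _ = _ := by ring

/-- The supremum of `g` over `S`. -/
noncomputable def supOn {X : Type*} (g : X → ℝ) (S : Set X) : ℝ := sSup (g '' S)

/-- The oscillation of `g` over `S`. -/
noncomputable def oscOn {X : Type*} (g : X → ℝ) (S : Set X) : ℝ := supOn g S + supOn (-g) S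

variable {X : Type*} {g : X → ℝ} {S T : Set X} {M : ℝ}

lemma le_supOn (hb : ∀ x ∈ S, |g x| ≤ M) {x : X} (hx : x ∈ S) : g x ≤ supOn g S := by
  refine le_csSup ⟨M, ?_⟩ (mem_image_of_mem g hx)
  rintro _ ⟨y, hy, rfl⟩
  exact (le_abs_self _).trans (hb y hy)

lemma supOn_le (hS : S.Nonempty) {a : ℝ} (h : ∀ x ∈ S, g x ≤ a) : supOn g S ≤ a := by
  refine csSup_le (hS.image g) ?_
  rintro _ ⟨y, hy, rfl⟩
  exact h y hy

lemma bound_neg (hb : ∀ x ∈ S, |g x| ≤ M) : ∀ x ∈ S, |(-g) x| ≤ M := fun x hx => by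
  rw [Pi.neg_apply, abs_neg]
  exact hb x hx

lemma sub_le_oscOn (hb : ∀ x ∈ S, |g x| ≤ M) {x y : X} (hx : x ∈ S) (hy : y ∈ S) :
    g x - g y ≤ oscOn g S := by
  have h1 := le_supOn hb hx
  have h2 := le_supOn (bound_neg hb) hy
  rw [Pi.neg_apply] at h2
  rw [oscOn]
  linarith

lemma oscOn_le (hS : S.Nonempty) {a : ℝ} (h : ∀ x ∈ S, ∀ y ∈ S, g x - g y ≤ a) : oscOn g S ≤ a := by
  have h1 : ∀ y ∈ S, supOn g S ≤ a + g y := fun y hy => supOn_le hS fun x hx => by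
    have := h x hx y hy
    linarith
  have h2 : supOn (-g) S ≤ a - supOn g S := supOn_le hS fun y hy => by
    have := h1 y hy
    rw [Pi.neg_apply]
    linarith
  rw [oscOn]
  linarith

lemma oscOn_mono (hS : S.Nonempty) (hST : S ⊆ T) (hb : ∀ x ∈ T, |g x| ≤ M) :
    oscOn g S ≤ oscOn g T :=
  oscOn_le hS fun _ hx _ hy => sub_le_oscOn hb (hST hx) (hST hy)

lemma oscOn_nonneg (hS : S.Nonempty) (hb : ∀ x ∈ S, |g x| ≤ M) : 0 ≤ oscOn g S := by
  obtain ⟨x, hx⟩ := hS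
  simpa using sub_le_oscOn hb hx hx

end Iteration

section DifferenceQuotients

open Filter

variable {n : ℕ}

/-- The difference quotient of `u` in direction `e` with step `h`. -/
noncomputable def dq (u : Eu n → ℝ) (e : Eu n) (h : ℝ) (y : Eu n) : ℝ := h⁻¹ * (u (y + h • e) - u y)

/-- The filter of pairs `(h, y)` with `h → 0`, `h ≠ 0` and `y → x`. -/
noncomputable abbrev stepNhds (x : Eu n) : Filter (ℝ × Eu n) := 𝓝[{p | p.1 ≠ 0}] ((0 : ℝ), x)

lemma tendsto_shift (x e : Eu n) :
    Tendsto (fun p : ℝ × Eu n => p.2 + p.1 • e) (stepNhds x) (𝓝 x) := by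
  have h : Continuous (fun p : ℝ × Eu n => p.2 + p.1 • e) := by fun_prop
  have h2 : Tendsto (fun p : ℝ × Eu n => p.2 + p.1 • e) (𝓝 (0, x)) (𝓝 x) := by
    simpa using h.tendsto (0, x)
  exact h2.mono_left nhdsWithin_le_nhds

lemma tendsto_snd_stepNhds (x : Eu n) : Tendsto (fun p : ℝ × Eu n => p.2) (stepNhds x) (𝓝 x) :=
  (continuous_snd.tendsto ((0 : ℝ), x)).mono_left nhdsWithin_le_nhds

lemma tendsto_diffQuot {G : Type*} [NormedAddCommGroup G] [NormedSpace ℝ G] {F : Eu n → G}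
    {F' : Eu n →L[ℝ] G} {x : Eu n} (hF : HasStrictFDerivAt F F' x) (e : Eu n) :
    Tendsto (fun p : ℝ × Eu n => p.1⁻¹ • (F (p.2 + p.1 • e) - F p.2)) (stepNhds x) (𝓝 (F' e)) := by
  have h1 : Tendsto (fun p : ℝ × Eu n => (p.2 + p.1 • e, p.2)) (stepNhds x) (𝓝 (x, x)) :=
    (tendsto_shift x e).prodMk_nhds (tendsto_snd_stepNhds x)
  have h2 := hF.isLittleO.comp_tendsto h1
  have h3 : (fun p : ℝ × Eu n => F (p.2 + p.1 • e) - F p.2 - p.1 • F' e) =o[stepNhds x]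
      fun p => p.1 := by
    refine (h2.congr_left fun p => ?_).trans_isBigO ?_
    · simp
    · refine Asymptotics.IsBigO.of_bound ‖e‖ (Eventually.of_forall fun p => ?_)
      simp [norm_smul, mul_comm]
  have h4 := h3.tendsto_inv_smul_nhds_zero
  have h5 := h4.add_const (F' e)
  rw [zero_add] at h5
  refine h5.congr' ?_
  filter_upwards [self_mem_nhdsWithin] with p hp
  have hp' : p.1 ≠ 0 := hp
  rw [smul_sub, smul_smul, inv_mul_cancel₀ hp', one_smul, sub_add_cancel]

lemma ContDiffAt.dq {u : Eu n → ℝ} {e : Eu n} {h : ℝ} {y : Eu n} {k : WithTop ℕ∞}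
    (h1 : ContDiffAt ℝ k u y)
    (h2 : ContDiffAt ℝ k u (y + h • e)) : ContDiffAt ℝ k (dq u e h) y := by
  have h3 : ContDiffAt ℝ k (fun y => u (y + h • e)) y :=
    ContDiffAt.comp (f := fun y => y + h • e) y h2 (contDiffAt_id.add contDiffAt_const)
  exact contDiffAt_const.mul (h3.sub h1)

lemma fderiv_dq {u : Eu n → ℝ} {e : Eu n} {h : ℝ} {y : Eu n}
    (h1 : DifferentiableAt ℝ u y) (h2 : DifferentiableAt ℝ u (y + h • e)) :
    fderiv ℝ (dq u e h) y = h⁻¹ • (fderiv ℝ u (y + h • e) - fderiv ℝ u y) := by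
  have h3 : DifferentiableAt ℝ (fun y => u (y + h • e)) y :=
    DifferentiableAt.comp (f := fun y => y + h • e) y h2 (differentiableAt_id.add_const _)
  have : dq u e h = fun y => h⁻¹ * (u (y + h • e) - u y) := rfl
  rw [this, fderiv_const_mul (h3.fun_sub h1), fderiv_fun_sub h3 h1, fderiv_comp_add_right]

lemma hess_dq {u : Eu n → ℝ} {e : Eu n} {h : ℝ} {y : Eu n}
    (h1 : ContDiffAt ℝ 2 u y) (h2 : ContDiffAt ℝ 2 u (y + h • e)) :
    hess (dq u e h) y = h⁻¹ • (hess u (y + h • e) - hess u y) := by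
  have h3 : ContDiffAt ℝ 2 (fun y => u (y + h • e)) y :=
    ContDiffAt.comp (f := fun y => y + h • e) y h2 (contDiffAt_id.add contDiffAt_const)
  have : dq u e h = fun y => h⁻¹ * (u (y + h • e) - u y) := rfl
  rw [this, hess_const_mul (h3.sub h1), hess_sub h3 h1]
  congr 2
  simp only [hess]
  have : fderiv ℝ (fun y => u (y + h • e)) = fun y => fderiv ℝ u (y + h • e) := by
    ext1 y
    exact fderiv_comp_add_right _
  rw [this, fderiv_comp_add_right]

/-- The data of a linearised quasilinear equation: `u` solves `tr (A D²u) + f = 0`, where the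
coefficients are differentiable with derivatives controlled by the Hessian of `u` in the same
direction. -/
structure GradSys (lam Lam K D : ℝ) (Ω : Set (Eu n)) (u : Eu n → ℝ)
    (A : Eu n → Matrix (Fin n) (Fin n) ℝ) (f : Eu n → ℝ) : Prop where
  isOpen : IsOpen Ω
  contDiffOn : ContDiffOn ℝ 2 u Ω
  norm_fderiv_le : ∀ x ∈ Ω, ‖fderiv ℝ u x‖ ≤ K
  contDiffOn_coeff : ∀ i j, ContDiffOn ℝ 1 (fun x => A x i j) Ω
  contDiffOn_rhs : ContDiffOn ℝ 1 f Ω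
  ell : ∀ x ∈ Ω, Ell lam Lam (A x)
  eq_zero : ∀ x ∈ Ω, trB (A x) (hess u x) + f x = 0
  fderiv_coeff_le : ∀ x ∈ Ω, ∀ i j v, |fderiv ℝ (fun x => A x i j) x v| ≤ D * (‖hess u x v‖ + ‖v‖)
  fderiv_rhs_le : ∀ x ∈ Ω, ∀ v, |fderiv ℝ f x v| ≤ D * (‖hess u x v‖ + ‖v‖)

variable {lam Lam K D : ℝ} {Ω : Set (Eu n)} {u : Eu n → ℝ}
    {A : Eu n → Matrix (Fin n) (Fin n) ℝ} {f : Eu n → ℝ}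

/-- The right-hand side of the equation obtained by differentiating the equation for `u`. -/
noncomputable def diffRhs (u : Eu n → ℝ) (A : Eu n → Matrix (Fin n) (Fin n) ℝ) (f : Eu n → ℝ)
    (x v : Eu n) : ℝ :=
  ∑ i, ∑ j, fderiv ℝ (fun x => A x i j) x v *
    hess u x (EuclideanSpace.single i 1) (EuclideanSpace.single j 1) + fderiv ℝ f x v

lemma GradSys.eventually_mem (S : GradSys lam Lam K D Ω u A f) {x : Eu n} (hx : x ∈ Ω) (e : Eu n) :
    ∀ᶠ p in stepNhds x, p.2 ∈ Ω ∧ p.2 + p.1 • e ∈ Ω :=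
  ((tendsto_snd_stepNhds x).eventually (S.isOpen.mem_nhds hx)).and
    ((tendsto_shift x e).eventually (S.isOpen.mem_nhds hx))

lemma GradSys.contDiffAt (S : GradSys lam Lam K D Ω u A f) {x : Eu n} (hx : x ∈ Ω) :
    ContDiffAt ℝ 2 u x := S.contDiffOn.contDiffAt (S.isOpen.mem_nhds hx)

lemma GradSys.tendsto_dq (S : GradSys lam Lam K D Ω u A f) {x : Eu n} (hx : x ∈ Ω) (e : Eu n) :
    Tendsto (fun p : ℝ × Eu n => dq u e p.1 p.2) (stepNhds x) (𝓝 (fderiv ℝ u x e)) := by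
  have h := tendsto_diffQuot ((S.contDiffAt hx).hasStrictFDerivAt (by norm_num)) e
  exact h

lemma GradSys.tendsto_fderiv_dq (S : GradSys lam Lam K D Ω u A f) {x : Eu n} (hx : x ∈ Ω)
    (e : Eu n) :
    Tendsto (fun p : ℝ × Eu n => fderiv ℝ (dq u e p.1) p.2) (stepNhds x) (𝓝 (hess u x e)) := by
  have h1 : ContDiffAt ℝ 1 (fderiv ℝ u) x := (S.contDiffAt hx).fderiv_right (by norm_num)
  refine (tendsto_diffQuot (h1.hasStrictFDerivAt (by norm_num)) e).congr' ?_
  filter_upwards [S.eventually_mem hx e] with p hp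
  exact (fderiv_dq ((S.contDiffAt hp.1).differentiableAt (by norm_num))
    ((S.contDiffAt hp.2).differentiableAt (by norm_num))).symm

lemma GradSys.continuousAt_hess (S : GradSys lam Lam K D Ω u A f) {x : Eu n} (hx : x ∈ Ω) :
    ContinuousAt (hess u) x := by
  have h1 : ContDiffAt ℝ 1 (fderiv ℝ u) x := (S.contDiffAt hx).fderiv_right (by norm_num)
  exact (h1.fderiv_right (m := 0) (by norm_num)).continuousAt

lemma GradSys.tendsto_trB_hess_dq (S : GradSys lam Lam K D Ω u A f) {x : Eu n} (hx : x ∈ Ω)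
    (e : Eu n) :
    Tendsto (fun p : ℝ × Eu n => trB (A p.2) (hess (dq u e p.1) p.2)) (stepNhds x)
      (𝓝 (-diffRhs u A f x e)) := by
  have hcoef : ∀ i j, Tendsto (fun p : ℝ × Eu n => p.1⁻¹ • (A (p.2 + p.1 • e) i j - A p.2 i j))
      (stepNhds x) (𝓝 (fderiv ℝ (fun x => A x i j) x e)) := fun i j =>
    tendsto_diffQuot (((S.contDiffOn_coeff i j).contDiffAt (S.isOpen.mem_nhds hx)).hasStrictFDerivAt
      (by norm_num)) e
  have hrhs := tendsto_diffQuot ((S.contDiffOn_rhs.contDiffAt (S.isOpen.mem_nhds hx)).hasStrictFDerivAt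
      (by norm_num)) e
  have hH : ∀ i j : Fin n, Tendsto (fun p : ℝ × Eu n => hess u (p.2 + p.1 • e)
      (EuclideanSpace.single i 1) (EuclideanSpace.single j 1)) (stepNhds x)
      (𝓝 (hess u x (EuclideanSpace.single i 1) (EuclideanSpace.single j 1))) := fun i j => by
    have hc : ContinuousAt (fun y => hess u y (EuclideanSpace.single i (1 : ℝ))
        (EuclideanSpace.single j (1 : ℝ))) x :=
      ((S.continuousAt_hess hx).clm_apply continuousAt_const).clm_apply continuousAt_const
    exact hc.tendsto.comp (tendsto_shift x e)
  have hlim := ((tendsto_finsetSum Finset.univ fun i _ => tendsto_finsetSum Finset.univ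
    fun j _ => (hcoef i j).mul (hH i j)).add hrhs).neg
  refine hlim.congr' ?_
  filter_upwards [S.eventually_mem hx e] with p hp
  rw [hess_dq (S.contDiffAt hp.1) (S.contDiffAt hp.2), trB_smul, trB_sub]
  have h1 := S.eq_zero _ hp.1
  have h2 := S.eq_zero _ hp.2
  have h3 : trB (A p.2) (hess u p.2) = -f p.2 := by linarith
  have h4 : f (p.2 + p.1 • e) = -trB (A (p.2 + p.1 • e)) (hess u (p.2 + p.1 • e)) := by linarith
  rw [h3, h4]
  have h5 : ∑ i, ∑ j, p.1⁻¹ • (A (p.2 + p.1 • e) i j - A p.2 i j) *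
      hess u (p.2 + p.1 • e) (EuclideanSpace.single i 1) (EuclideanSpace.single j 1)
      = p.1⁻¹ * (trB (A (p.2 + p.1 • e)) (hess u (p.2 + p.1 • e))
        - trB (A p.2) (hess u (p.2 + p.1 • e))) := by
    simp only [trB, ← Finset.sum_sub_distrib, Finset.mul_sum, smul_eq_mul]
    exact Finset.sum_congr rfl fun i _ => Finset.sum_congr rfl fun j _ => by ring
  rw [h5, smul_eq_mul]
  ring

end DifferenceQuotients

section Bernstein

open Filter

variable {n : ℕ}

/-- Bernstein's auxiliary function `D_e u + ε |Du|²`. -/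
noncomputable def bern (u : Eu n → ℝ) (ε : ℝ) (e x : Eu n) : ℝ :=
  fderiv ℝ u x e + ε * ∑ l, fderiv ℝ u x (EuclideanSpace.single l 1) ^ 2

/-- The finite difference version of Bernstein's auxiliary function. -/
noncomputable def bernDq (u : Eu n → ℝ) (ε : ℝ) (e : Eu n) (h : ℝ) (y : Eu n) : ℝ :=
  dq u e h y + ε * ∑ l, dq u (EuclideanSpace.single l 1) h y ^ 2

lemma contDiffAt_bernDq {u : Eu n → ℝ} {ε : ℝ} {e : Eu n} {h : ℝ} {y : Eu n}
    (he : ContDiffAt ℝ 2 (dq u e h) y)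
    (hl : ∀ l, ContDiffAt ℝ 2 (dq u (EuclideanSpace.single l 1) h) y) :
    ContDiffAt ℝ 2 (bernDq u ε e h) y :=
  he.add (contDiffAt_const.mul (ContDiffAt.sum fun l _ => (hl l).pow 2))

lemma fderiv_bernDq {u : Eu n → ℝ} {ε : ℝ} {e : Eu n} {h : ℝ} {y : Eu n}
    (he : ContDiffAt ℝ 2 (dq u e h) y)
    (hl : ∀ l, ContDiffAt ℝ 2 (dq u (EuclideanSpace.single l 1) h) y) :
    fderiv ℝ (bernDq u ε e h) y = fderiv ℝ (dq u e h) y +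
      ε • ∑ l, (2 * dq u (EuclideanSpace.single l 1) h y) •
        fderiv ℝ (dq u (EuclideanSpace.single l 1) h) y := by
  have h1 : ∀ l, HasFDerivAt (fun y => dq u (EuclideanSpace.single l 1) h y ^ 2)
      ((2 * dq u (EuclideanSpace.single l 1) h y) •
        fderiv ℝ (dq u (EuclideanSpace.single l 1) h) y) y := fun l => by
    have := ((hl l).differentiableAt (by norm_num)).hasFDerivAt.pow 2
    simpa using this
  have h2 := HasFDerivAt.fun_sum (u := Finset.univ) fun l _ => h1 l
  exact ((he.differentiableAt (by norm_num)).hasFDerivAt.add (h2.const_mul ε)).fderiv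

lemma hess_sq {w : Eu n → ℝ} {x : Eu n} (hw : ContDiffAt ℝ 2 w x) :
    hess (fun y => w y ^ 2) x = (2 : ℝ) • tens (fderiv ℝ w x) + (2 * w x) • hess w x := by
  have h := hess_comp (g := fun t => t ^ 2) (by fun_prop) hw
  have h1 : deriv (fun t : ℝ => t ^ 2) = fun t => 2 * t := by
    ext t; simp
  have h2 : deriv (fun t : ℝ => 2 * t) = fun _ => 2 := by
    ext t; simp
  rw [h1, h2] at h
  exact h

lemma trB_sum {ι : Type*} (s : Finset ι) (A : Matrix (Fin n) (Fin n) ℝ) (B : ι → Bil n) :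
    trB A (∑ l ∈ s, B l) = ∑ l ∈ s, trB A (B l) := by
  classical
  induction s using Finset.induction_on with
  | empty => simp [trB]
  | insert a s ha ih => rw [Finset.sum_insert ha, Finset.sum_insert ha, trB_add, ih]

lemma trB_hess_bernDq {u : Eu n → ℝ} {ε : ℝ} {e : Eu n} {h : ℝ} {y : Eu n}
    (A : Matrix (Fin n) (Fin n) ℝ) (he : ContDiffAt ℝ 2 (dq u e h) y)
    (hl : ∀ l, ContDiffAt ℝ 2 (dq u (EuclideanSpace.single l 1) h) y) :
    trB A (hess (bernDq u ε e h) y) = trB A (hess (dq u e h) y) +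
      ε * ∑ l, (2 * trB A (tens (fderiv ℝ (dq u (EuclideanSpace.single l 1) h) y)) +
        2 * dq u (EuclideanSpace.single l 1) h y *
          trB A (hess (dq u (EuclideanSpace.single l 1) h) y)) := by
  have h1 : ContDiffAt ℝ 2 (fun y => ∑ l, dq u (EuclideanSpace.single l 1) h y ^ 2) y :=
    ContDiffAt.sum fun l _ => (hl l).pow 2
  have h2 : hess (bernDq u ε e h) y = _ :=
    hess_add he (contDiffAt_const.mul h1 : ContDiffAt ℝ 2 (fun y => ε * _) y)
  rw [h2, hess_const_mul h1, hess_sum _ fun l _ => (hl l).pow 2, trB_add, trB_smul, trB_sum]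
  simp only [hess_sq (hl _), trB_add, trB_smul]

variable {lam Lam K D : ℝ} {Ω : Set (Eu n)} {u : Eu n → ℝ}
    {A : Eu n → Matrix (Fin n) (Fin n) ℝ} {f : Eu n → ℝ}

lemma diffRhs_add (x v w : Eu n) :
    diffRhs u A f x (v + w) = diffRhs u A f x v + diffRhs u A f x w := by
  simp only [diffRhs, map_add, add_mul, Finset.sum_add_distrib]
  ring

lemma diffRhs_smul (x v : Eu n) (c : ℝ) :
    diffRhs u A f x (c • v) = c * diffRhs u A f x v := by
  simp only [diffRhs, map_smul, smul_eq_mul, mul_add, Finset.mul_sum, mul_assoc]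

lemma diffRhs_eq_sum (x v : Eu n) :
    diffRhs u A f x v = ∑ l, v l * diffRhs u A f x (EuclideanSpace.single l 1) := by
  let L : Eu n →ₗ[ℝ] ℝ :=
    { toFun := diffRhs u A f x, map_add' := diffRhs_add x, map_smul' := fun c v => diffRhs_smul x v c }
  have := eu_linear_apply (LinearMap.toContinuousLinearMap L) v
  exact this

/-- The direction of differentiation attached to Bernstein's auxiliary function. -/
noncomputable def bernDir (u : Eu n → ℝ) (ε : ℝ) (e x : Eu n) : Eu n :=
  e + (2 * ε) • gradL n (fderiv ℝ u x)

lemma norm_bernDir_le {ε : ℝ} {e x : Eu n} (hε : 0 ≤ ε) (he : ‖e‖ ≤ 1)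
    (hK : ‖fderiv ℝ u x‖ ≤ K) (hεK : 2 * ε * K ≤ 1) : ‖bernDir u ε e x‖ ≤ 2 := by
  refine (norm_add_le _ _).trans ?_
  rw [norm_smul, norm_gradL, Real.norm_eq_abs, abs_of_nonneg (by positivity)]
  have : 2 * ε * ‖fderiv ℝ u x‖ ≤ 2 * ε * K := by gcongr
  linarith

lemma abs_diffRhs_le (S : GradSys lam Lam K D Ω u A f) (hD : 0 ≤ D) {x : Eu n} (hx : x ∈ Ω)
    (v : Eu n) :
    |diffRhs u A f x v| ≤ D * (n ^ 2 + 1) * (‖hess u x v‖ + ‖v‖) * (‖hess u x‖ + 1) := by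
  have hH : ∀ i j : Fin n, |hess u x (EuclideanSpace.single i 1) (EuclideanSpace.single j 1)|
      ≤ ‖hess u x‖ := by
    intro i j
    have := (hess u x).le_opNorm₂ (EuclideanSpace.single i 1) (EuclideanSpace.single j 1)
    simpa using this
  set q := D * (‖hess u x v‖ + ‖v‖) with hq
  have hq0 : 0 ≤ q := by positivity
  have h1 : |∑ i, ∑ j, fderiv ℝ (fun x => A x i j) x v *
      hess u x (EuclideanSpace.single i 1) (EuclideanSpace.single j 1)|
      ≤ ∑ i : Fin n, ∑ j : Fin n, q * ‖hess u x‖ := by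
    refine (Finset.abs_sum_le_sum_abs _ _).trans (Finset.sum_le_sum fun i _ => ?_)
    refine (Finset.abs_sum_le_sum_abs _ _).trans (Finset.sum_le_sum fun j _ => ?_)
    rw [abs_mul]
    exact mul_le_mul (S.fderiv_coeff_le x hx i j v) (hH i j) (abs_nonneg _) hq0
  have h2 := S.fderiv_rhs_le x hx v
  have h3 : ∑ i : Fin n, ∑ j : Fin n, q * ‖hess u x‖ = n ^ 2 * (q * ‖hess u x‖) := by
    simp; ring
  have h4 : |diffRhs u A f x v| ≤ n ^ 2 * (q * ‖hess u x‖) + q :=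
    (abs_add_le _ _).trans (add_le_add (h1.trans_eq h3) h2)
  have h5 : 0 ≤ (n : ℝ) ^ 2 * q := by positivity
  have h6 : 0 ≤ q * ‖hess u x‖ := by positivity
  calc _ ≤ _ := h4
    _ ≤ q * (n ^ 2 + 1) * (‖hess u x‖ + 1) := by nlinarith
    _ = _ := by rw [hq]; ring

lemma sq_norm_le_sum (H : Bil n) : ‖H‖ ^ 2 ≤ ∑ l, ‖H (EuclideanSpace.single l 1)‖ ^ 2 := by
  have h0 : (0 : ℝ) ≤ ∑ l, ‖H (EuclideanSpace.single l 1)‖ ^ 2 := by positivity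
  have h : ‖H‖ ≤ √(∑ l, ‖H (EuclideanSpace.single l 1)‖ ^ 2) := by
    refine H.opNorm_le_bound (Real.sqrt_nonneg _) fun v => ?_
    have h1 : H v = ∑ l, v l • H (EuclideanSpace.single l 1) := by
      conv_lhs => rw [eu_eq_sum v]
      simp [map_sum]
    have h2 : ‖H v‖ ≤ ∑ l, ‖H (EuclideanSpace.single l 1)‖ * |v l| := by
      rw [h1]
      refine (norm_sum_le _ _).trans (Finset.sum_le_sum fun l _ => ?_)
      rw [norm_smul, mul_comm, Real.norm_eq_abs]
    refine h2.trans ((Real.sum_mul_le_sqrt_mul_sqrt _ _ _).trans_eq ?_)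
    rw [EuclideanSpace.norm_eq]
    simp
  calc ‖H‖ ^ 2 ≤ √(∑ l, ‖H (EuclideanSpace.single l 1)‖ ^ 2) ^ 2 := by gcongr
    _ = _ := Real.sq_sqrt h0

lemma GradSys.continuousAt_fderiv (S : GradSys lam Lam K D Ω u A f) {x : Eu n} (hx : x ∈ Ω) :
    ContinuousAt (fderiv ℝ u) x :=
  ((S.contDiffAt hx).fderiv_right (m := 1) (by norm_num)).continuousAt

lemma GradSys.continuousAt_bern (S : GradSys lam Lam K D Ω u A f) {x : Eu n} (hx : x ∈ Ω)
    (ε : ℝ) (e : Eu n) : ContinuousAt (bern u ε e) x := by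
  have h := S.continuousAt_fderiv hx
  have h' : ∀ v, ContinuousAt (fun x => fderiv ℝ u x v) x := fun v =>
    h.clm_apply continuousAt_const
  exact (h' e).add (continuousAt_const.mul (tendsto_finsetSum _ fun l _ => (h' _).pow 2))

lemma GradSys.eventually_contDiffAt_dq (S : GradSys lam Lam K D Ω u A f) {x : Eu n} (hx : x ∈ Ω)
    (e : Eu n) : ∀ᶠ p in stepNhds x, ContDiffAt ℝ 2 (dq u e p.1) p.2 ∧
      ∀ l, ContDiffAt ℝ 2 (dq u (EuclideanSpace.single l 1) p.1) p.2 := by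
  have h : ∀ e : Eu n, ∀ᶠ p in stepNhds x, ContDiffAt ℝ 2 (dq u e p.1) p.2 := fun e => by
    filter_upwards [S.eventually_mem hx e] with p hp
    exact (S.contDiffAt hp.1).dq (S.contDiffAt hp.2)
  exact (h e).and (eventually_all.2 fun _ => h _)

lemma GradSys.tendsto_bernDq (S : GradSys lam Lam K D Ω u A f) {x : Eu n} (hx : x ∈ Ω)
    (ε : ℝ) (e : Eu n) :
    Tendsto (fun p : ℝ × Eu n => bernDq u ε e p.1 p.2) (stepNhds x) (𝓝 (bern u ε e x)) :=
  (S.tendsto_dq hx e).add ((tendsto_finsetSum _ fun _ _ => (S.tendsto_dq hx _).pow 2).const_mul ε)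

lemma GradSys.tendsto_fderiv_bernDq (S : GradSys lam Lam K D Ω u A f) {x : Eu n} (hx : x ∈ Ω)
    (ε : ℝ) (e : Eu n) :
    Tendsto (fun p : ℝ × Eu n => fderiv ℝ (bernDq u ε e p.1) p.2) (stepNhds x)
      (𝓝 (hess u x (bernDir u ε e x))) := by
  have h := (S.tendsto_fderiv_dq hx e).add ((tendsto_finsetSum Finset.univ fun l _ =>
    ((S.tendsto_dq hx (EuclideanSpace.single l 1)).const_mul 2).smul
      (S.tendsto_fderiv_dq hx (EuclideanSpace.single l 1))).const_smul ε)
  have h2 : hess u x (bernDir u ε e x) = hess u x e + ε • ∑ l,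
      (2 * fderiv ℝ u x (EuclideanSpace.single l 1)) • hess u x (EuclideanSpace.single l 1) := by
    rw [bernDir, map_add, map_smul]
    conv_lhs => rw [eu_eq_sum (gradL n (fderiv ℝ u x))]
    rw [map_sum, mul_comm 2 ε, mul_smul, Finset.smul_sum]
    simp only [map_smul, smul_smul, gradL_apply]
  rw [h2]
  refine h.congr' ?_
  filter_upwards [S.eventually_contDiffAt_dq hx e] with p hp
  exact (fderiv_bernDq hp.1 hp.2).symm

lemma GradSys.tendsto_trB_tens (S : GradSys lam Lam K D Ω u A f) {x : Eu n} (hx : x ∈ Ω)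
    {F : ℝ × Eu n → Eu n →L[ℝ] ℝ} {l : Eu n →L[ℝ] ℝ} (hF : Tendsto F (stepNhds x) (𝓝 l)) :
    Tendsto (fun p : ℝ × Eu n => trB (A p.2) (tens (F p))) (stepNhds x)
      (𝓝 (trB (A x) (tens l))) := by
  simp only [trB, tens_apply]
  have hA : ∀ i j, Tendsto (fun p : ℝ × Eu n => A p.2 i j) (stepNhds x) (𝓝 (A x i j)) := fun i j =>
    ((S.contDiffOn_coeff i j).contDiffAt (S.isOpen.mem_nhds hx)).continuousAt.tendsto.comp
      (tendsto_snd_stepNhds x)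
  have hl : ∀ v, Tendsto (fun p => F p v) (stepNhds x) (𝓝 (l v)) := fun v =>
    ((ContinuousLinearMap.apply ℝ ℝ v).continuous.tendsto l).comp hF
  exact tendsto_finsetSum _ fun i _ => tendsto_finsetSum _ fun j _ =>
    (hA i j).mul ((hl _).mul (hl _))

lemma GradSys.tendsto_trB_hess_bernDq (S : GradSys lam Lam K D Ω u A f) {x : Eu n} (hx : x ∈ Ω)
    (ε : ℝ) (e : Eu n) :
    Tendsto (fun p : ℝ × Eu n => trB (A p.2) (hess (bernDq u ε e p.1) p.2)) (stepNhds x)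
      (𝓝 (-diffRhs u A f x (bernDir u ε e x) +
        2 * ε * ∑ l, trB (A x) (tens (hess u x (EuclideanSpace.single l 1))))) := by
  have h := (S.tendsto_trB_hess_dq hx e).add ((tendsto_finsetSum Finset.univ fun l _ =>
    ((S.tendsto_trB_tens hx (S.tendsto_fderiv_dq hx (EuclideanSpace.single l 1))).const_mul 2).add
      (((S.tendsto_dq hx (EuclideanSpace.single l 1)).const_mul 2).mul
        (S.tendsto_trB_hess_dq hx (EuclideanSpace.single l 1)))).const_mul ε)
  have h2 : -diffRhs u A f x (bernDir u ε e x) +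
        2 * ε * ∑ l, trB (A x) (tens (hess u x (EuclideanSpace.single l 1)))
      = -diffRhs u A f x e + ε * ∑ l, (2 * trB (A x) (tens (hess u x (EuclideanSpace.single l 1))) +
        2 * fderiv ℝ u x (EuclideanSpace.single l 1) *
          -diffRhs u A f x (EuclideanSpace.single l 1)) := by
    rw [bernDir, diffRhs_add, diffRhs_smul, diffRhs_eq_sum x (gradL n _), Finset.sum_add_distrib,
      ← Finset.mul_sum]
    simp only [gradL_apply, mul_neg, Finset.sum_neg_distrib, mul_assoc]
    rw [← Finset.mul_sum]
    ring
  rw [h2]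
  refine h.congr' ?_
  filter_upwards [S.eventually_contDiffAt_dq hx e] with p hp
  exact (trB_hess_bernDq _ hp.1 hp.2).symm

end Bernstein

section BernsteinApprox

open Filter

variable {n : ℕ} {lam Lam K D : ℝ} {Ω : Set (Eu n)} {u : Eu n → ℝ}
    {A : Eu n → Matrix (Fin n) (Fin n) ℝ} {f : Eu n → ℝ}

lemma bernstein_lower_bound (S : GradSys lam Lam K D Ω u A f) (hlam : 0 < lam) (hD : 0 ≤ D)
    {ε C₁ : ℝ} (hε : 0 < ε) (hεK : 2 * ε * K ≤ 1)
    (hC₁ : (D * (n ^ 2 + 1)) ^ 2 / (4 * (ε * lam)) + 1 ≤ C₁ * lam) {e : Eu n} (he : ‖e‖ ≤ 1)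
    {x : Eu n} (hx : x ∈ Ω) (hC₁0 : 0 ≤ C₁) :
    -((D * (n ^ 2 + 1)) ^ 2 / (ε * lam) + (D * (n ^ 2 + 1)) ^ 2 / 4 + 2 * (D * (n ^ 2 + 1)))
      ≤ C₁ * trB (A x) (tens (hess u x (bernDir u ε e x))) +
        (-diffRhs u A f x (bernDir u ε e x) +
        2 * ε * ∑ l, trB (A x) (tens (hess u x (EuclideanSpace.single l 1)))) := by
  have hA := S.ell x hx
  set ξ := bernDir u ε e x
  have hξ : ‖ξ‖ ≤ 2 := norm_bernDir_le hε.le he (S.norm_fderiv_le x hx) hεK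
  have h1 := hA.trB_tens_ge (hess u x ξ)
  have h2 : lam * ‖hess u x‖ ^ 2 ≤ ∑ l, trB (A x) (tens (hess u x (EuclideanSpace.single l 1))) := by
    calc lam * ‖hess u x‖ ^ 2 ≤ lam * ∑ l, ‖hess u x (EuclideanSpace.single l 1)‖ ^ 2 := by
          gcongr; exact sq_norm_le_sum _
      _ = ∑ l, lam * ‖hess u x (EuclideanSpace.single l 1)‖ ^ 2 := Finset.mul_sum _ _ _
      _ ≤ _ := Finset.sum_le_sum fun l _ => hA.trB_tens_ge _
  have h3 := (le_abs_self _).trans (abs_diffRhs_le S hD hx ξ)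
  set C := D * (n ^ 2 + 1)
  have hC : 0 ≤ C := by positivity
  set p := ‖hess u x ξ‖
  set s := ‖hess u x‖
  have hp : 0 ≤ p := norm_nonneg (hess u x ξ)
  have hs : 0 ≤ s := norm_nonneg (hess u x)
  have h4 : C * (p + ‖ξ‖) * (s + 1) ≤ C * (p + 2) * (s + 1) := by gcongr
  set q := ε * lam with hq
  have hq0 : 0 < q := by positivity
  have h5 : C * p * s ≤ q * s ^ 2 + C ^ 2 / (4 * q) * p ^ 2 := by
    have : q * s ^ 2 + C ^ 2 / (4 * q) * p ^ 2 - C * p * s = q * (s - C * p / (2 * q)) ^ 2 := by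
      field_simp
      ring
    nlinarith [mul_nonneg hq0.le (sq_nonneg (s - C * p / (2 * q)))]
  have h6 : 2 * C * s ≤ q * s ^ 2 + C ^ 2 / q := by
    have : q * s ^ 2 + C ^ 2 / q - 2 * C * s = q * (s - C / q) ^ 2 := by
      field_simp
      ring
    nlinarith [mul_nonneg hq0.le (sq_nonneg (s - C / q))]
  have h7 : C * p ≤ p ^ 2 + C ^ 2 / 4 := by nlinarith [sq_nonneg (p - C / 2)]
  have h8 : (C ^ 2 / (4 * q) + 1) * p ^ 2 ≤ C₁ * lam * p ^ 2 := by gcongr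
  have h9 : C₁ * (lam * p ^ 2) ≤ C₁ * trB (A x) (tens (hess u x ξ)) := by gcongr
  have h10 : 2 * ε * (lam * s ^ 2) ≤
    2 * ε * ∑ l, trB (A x) (tens (hess u x (EuclideanSpace.single l 1))) := by gcongr
  have h11 : 2 * ε * (lam * s ^ 2) = 2 * (q * s ^ 2) := by rw [hq]; ring
  nlinarith

lemma trB_hess_one_sub_exp {w : Eu n → ℝ} {x : Eu n} (B : Matrix (Fin n) (Fin n) ℝ) (C₁ W : ℝ)
    (hw : ContDiffAt ℝ 2 w x) :
    trB B (hess (fun y => 1 - Real.exp (C₁ * (w y - W))) x)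
      = -(C₁ * Real.exp (C₁ * (w x - W))) *
        (C₁ * trB B (tens (fderiv ℝ w x)) + trB B (hess w x)) := by
  have hd1 : deriv (fun t : ℝ => 1 - Real.exp (C₁ * (t - W)))
      = fun t => -C₁ * Real.exp (C₁ * (t - W)) := by
    ext t
    have h : HasDerivAt (fun t : ℝ => C₁ * (t - W)) C₁ t := by
      simpa using ((hasDerivAt_id t).sub_const W).const_mul C₁
    rw [(h.exp.const_sub 1).deriv]
    ring
  have hd2 : deriv (fun t : ℝ => -C₁ * Real.exp (C₁ * (t - W)))
      = fun t => -C₁ ^ 2 * Real.exp (C₁ * (t - W)) := by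
    ext t
    have h : HasDerivAt (fun t : ℝ => C₁ * (t - W)) C₁ t := by
      simpa using ((hasDerivAt_id t).sub_const W).const_mul C₁
    rw [(h.exp.const_mul (-C₁)).deriv]
    ring
  rw [hess_comp (g := fun t : ℝ => 1 - Real.exp (C₁ * (t - W))) (by fun_prop) hw, hd1, hd2,
    trB_add, trB_smul, trB_smul]
  ring

/-- A solution `u` of the differentiated system gives, after an exponential change of variable in
Bernstein's function `D_e u + ε |Du|²`, uniform limits of `C²` supersolutions. -/
theorem exists_bern_approx (n : ℕ) {lam Lam K D ε : ℝ} (hlam : 0 < lam) (hD : 0 ≤ D)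
    (hε : 0 < ε) (hεK : 2 * ε * K ≤ 1) :
    ∃ C₁ > 0, ∃ C₂ > 0, ∀ (Ω : Set (Eu n)) (u : Eu n → ℝ) (A : Eu n → Matrix (Fin n) (Fin n) ℝ)
      (f : Eu n → ℝ), GradSys lam Lam K D Ω u A f → ∀ e : Eu n, ‖e‖ ≤ 1 → ∀ (z : Eu n) (ρ W : ℝ),
      Metric.closedBall z ρ ⊆ Ω → (∀ x ∈ Metric.closedBall z ρ, bern u ε e x ≤ W) → ∀ η > 0,
      ∃ (v : Eu n → ℝ) (U : Set (Eu n)), IsOpen U ∧ Metric.closedBall z ρ ⊆ U ∧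
        ContDiffOn ℝ 2 v U ∧ ∀ x ∈ Metric.closedBall z ρ,
          |v x - (1 - Real.exp (C₁ * (bern u ε e x - W)))| ≤ η ∧ SuperAt lam Lam (hess v x) C₂ := by
  set C₁ := ((D * (n ^ 2 + 1)) ^ 2 / (4 * (ε * lam)) + 1) / lam with hC₁
  set B := (D * (n ^ 2 + 1)) ^ 2 / (ε * lam) + (D * (n ^ 2 + 1)) ^ 2 / 4 + 2 * (D * (n ^ 2 + 1))
    with hB
  have hC₁0 : 0 < C₁ := by positivity
  have hB0 : 0 ≤ B := by positivity
  refine ⟨C₁, hC₁0, C₁ * B + 1, by positivity, ?_⟩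
  intro Ω u A f S e he z ρ W hsub hW η hη
  let dirs : Option (Fin n) → Eu n := fun o => o.elim e fun l => EuclideanSpace.single l 1
  let U : ℝ → Set (Eu n) := fun h => {y | y ∈ Ω ∧ ∀ o, y + h • dirs o ∈ Ω}
  have hUopen : ∀ h, IsOpen (U h) := by
    intro h
    have : U h = Ω ∩ ⋂ o, (fun y => y + h • dirs o) ⁻¹' Ω := by
      ext y; simp [U]
    rw [this]
    exact S.isOpen.inter (isOpen_iInter_of_finite fun o => S.isOpen.preimage (by fun_prop))
  let v : ℝ → Eu n → ℝ := fun h y => 1 - Real.exp (C₁ * (bernDq u ε e h y - W))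
  have hcd : ∀ h, ∀ y ∈ U h, ContDiffAt ℝ 2 (bernDq u ε e h) y := by
    intro h y hy
    exact contDiffAt_bernDq ((S.contDiffAt hy.1).dq (S.contDiffAt (hy.2 none)))
      fun l => (S.contDiffAt hy.1).dq (S.contDiffAt (hy.2 (some l)))
  have key : ∀ y ∈ Metric.closedBall z ρ, ∀ᶠ p in stepNhds y, p.2 ∈ U p.1 ∧
      |v p.1 p.2 - (1 - Real.exp (C₁ * (bern u ε e p.2 - W)))| ≤ η ∧
      trB (A p.2) (hess (v p.1) p.2) ≤ C₁ * B + 1 ∧ p.2 ∈ Ω := by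
    intro y hy
    have hyΩ := hsub hy
    have hmem : ∀ᶠ p in stepNhds y, p.2 ∈ U p.1 := by
      have h1 : ∀ᶠ p in stepNhds y, ∀ o, p.2 ∈ Ω ∧ p.2 + p.1 • dirs o ∈ Ω :=
        eventually_all.2 fun o => S.eventually_mem hyΩ _
      filter_upwards [h1] with p hp
      exact ⟨(hp none).1, fun o => (hp o).2⟩
    have hexp : Tendsto (fun p : ℝ × Eu n => Real.exp (C₁ * (bernDq u ε e p.1 p.2 - W)))
        (stepNhds y) (𝓝 (Real.exp (C₁ * (bern u ε e y - W)))) :=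
      (Real.continuous_exp.tendsto _).comp (((S.tendsto_bernDq hyΩ ε e).sub_const W).const_mul C₁)
    have hexp' : Tendsto (fun p : ℝ × Eu n => Real.exp (C₁ * (bern u ε e p.2 - W)))
        (stepNhds y) (𝓝 (Real.exp (C₁ * (bern u ε e y - W)))) :=
      (Real.continuous_exp.tendsto _).comp ((((S.continuousAt_bern hyΩ ε e).tendsto.comp
        (tendsto_snd_stepNhds y)).sub_const W).const_mul C₁)
    have hclose : ∀ᶠ p in stepNhds y,
        |v p.1 p.2 - (1 - Real.exp (C₁ * (bern u ε e p.2 - W)))| < η := by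
      have h1 := ((hexp.const_sub 1).sub (hexp'.const_sub 1)).abs
      rw [sub_self, abs_zero] at h1
      exact h1.eventually (eventually_lt_nhds hη)
    have htr := ((hexp.const_mul C₁).neg).mul
      (((S.tendsto_trB_tens hyΩ (S.tendsto_fderiv_bernDq hyΩ ε e)).const_mul C₁).add
        (S.tendsto_trB_hess_bernDq hyΩ ε e))
    have hlow := bernstein_lower_bound S hlam hD hε hεK (C₁ := C₁)
      (by rw [hC₁]; field_simp; rfl) he hyΩ hC₁0.le
    rw [← hB] at hlow
    have hE1 : Real.exp (C₁ * (bern u ε e y - W)) ≤ 1 := by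
      rw [Real.exp_le_one_iff]
      exact mul_nonpos_of_nonneg_of_nonpos hC₁0.le (by linarith [hW y hy])
    have hlt := htr.eventually (eventually_lt_nhds (b := C₁ * B + 1) (by
      set E := Real.exp (C₁ * (bern u ε e y - W)) with hE
      have hE0 : 0 < E := Real.exp_pos _
      set T := C₁ * trB (A y) (tens (hess u y (bernDir u ε e y))) +
        (-diffRhs u A f y (bernDir u ε e y) +
        2 * ε * ∑ l, trB (A y) (tens (hess u y (EuclideanSpace.single l 1))))
      have h1 : C₁ * E * (-T) ≤ C₁ * E * B := by gcongr; linarith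
      have h2 : C₁ * E * B ≤ C₁ * 1 * B := by gcongr
      linarith))
    filter_upwards [hmem, hclose, hlt] with p h1 h2 h3
    refine ⟨h1, h2.le, ?_, h1.1⟩
    rw [trB_hess_one_sub_exp _ _ _ (hcd p.1 p.2 h1)]
    exact h3.le
  have hev := (isCompact_closedBall z ρ).eventually_forall_of_forall_eventually
    (x₀ := (0 : ℝ)) (P := fun h y => h ≠ 0 → y ∈ U h ∧
      |v h y - (1 - Real.exp (C₁ * (bern u ε e y - W)))| ≤ η ∧
      trB (A y) (hess (v h) y) ≤ C₁ * B + 1 ∧ y ∈ Ω)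
    fun y hy => eventually_nhdsWithin_iff.1 (key y hy)
  obtain ⟨h, hP, hne⟩ := ((hev.filter_mono nhdsWithin_le_nhds).and
    (self_mem_nhdsWithin (s := {0}ᶜ) (a := (0 : ℝ)))).exists
  refine ⟨v h, U h, hUopen h, fun y hy => (hP y hy hne).1, fun y hy => ?_, fun x hx => ?_⟩
  · exact (contDiffAt_const.sub (Real.contDiff_exp.contDiffAt.comp y
      (contDiffAt_const.mul ((hcd h y hy).sub contDiffAt_const)))).contDiffWithinAt
  · obtain ⟨h1, h2, h3, h4⟩ := hP x hx hne
    exact ⟨h2, A x, S.ell x h4, h3⟩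

end BernsteinApprox

section InteriorEstimate

open Metric MeasureTheory

variable {n : ℕ}

lemma half_volume_le_or {E P Q : Set (Eu n)} (h : E ⊆ P ∪ Q) :
    ENNReal.ofReal (1 / 2) * volume E ≤ volume (P ∩ E) ∨
      ENNReal.ofReal (1 / 2) * volume E ≤ volume (Q ∩ E) := by
  by_contra! hc
  have h1 : volume E ≤ volume (P ∩ E) + volume (Q ∩ E) := by
    refine (measure_mono ?_).trans (measure_union_le _ _)
    intro x hx
    rcases h hx with h | h
    · exact Or.inl ⟨h, hx⟩
    · exact Or.inr ⟨h, hx⟩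
  have h2 := ENNReal.add_lt_add hc.1 hc.2
  rw [← add_mul, ← ENNReal.ofReal_add (by norm_num) (by norm_num)] at h2
  norm_num at h2
  exact absurd h1 (not_le.2 h2)

/-- Decrease of the supremum of Bernstein's function under a measure condition. -/
lemma exists_bern_drop (n : ℕ) {lam Lam K D ε : ℝ} (hlam : 0 < lam) (hLam : 0 ≤ Lam) (hK : 0 ≤ K)
    (hD : 0 ≤ D) (hε : 0 < ε) (hεK : 2 * ε * K ≤ 1) :
    ∃ c ∈ Ioo (0 : ℝ) 1, ∃ B > 0, ∀ (Ω : Set (Eu n)) (u : Eu n → ℝ)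
      (A : Eu n → Matrix (Fin n) (Fin n) ℝ) (f : Eu n → ℝ), GradSys lam Lam K D Ω u A f →
      ∀ e : Eu n, ‖e‖ ≤ 1 → ∀ (z : Eu n) (r W N : ℝ), 0 < r → 0 < N → N ≤ 2 * K →
      closedBall z (4 * r) ⊆ Ω → (∀ x ∈ closedBall z (4 * r), bern u ε e x ≤ W) →
      ENNReal.ofReal (1 / 2) * volume (closedBall z r) ≤
        volume ({x | 3 / 10 * N < W - bern u ε e x} ∩ closedBall z r) →
      N ≤ B * r ^ 2 ∨ ∀ x ∈ closedBall z r, bern u ε e x ≤ W - c * N := by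
  obtain ⟨C₁, hC₁, C₂, hC₂, happ⟩ := exists_bern_approx n (Lam := Lam) hlam hD hε hεK
  obtain ⟨c, ⟨hc0, hc1⟩, δ, hδ, hgrow⟩ := exists_growth_of_approx n hlam hLam
  set q := 1 + C₁ * K with hq
  have hq1 : 1 ≤ q := by
    have : 0 ≤ C₁ * K := by positivity
    linarith
  refine ⟨c * (3 / 10) / q, ⟨by positivity, ?_⟩, C₂ * q / (δ * (3 / 10 * C₁)), by positivity, ?_⟩
  · rw [div_lt_one (by linarith)]
    nlinarith
  intro Ω u A f S e he z r W N hr hN hN2 hsub hW hvol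
  set κ := 1 - Real.exp (-(C₁ * (3 / 10 * N))) with hκ
  have hκ0 : 0 < κ := by
    rw [hκ, sub_pos, Real.exp_lt_one_iff]
    have : 0 < C₁ * (3 / 10 * N) := by positivity
    linarith
  have hκN : 3 / 10 * C₁ * N / q ≤ κ := by
    set t := C₁ * (3 / 10 * N) with ht
    have ht0 : 0 < t := by positivity
    have h1 : t + 1 ≤ Real.exp t := Real.add_one_le_exp t
    have h2 : Real.exp (-t) ≤ 1 / (t + 1) := by
      rw [Real.exp_neg, ← one_div]
      exact one_div_le_one_div_of_le (by linarith) h1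
    have h3 : t / (t + 1) = 1 - 1 / (t + 1) := by field_simp; ring
    have h4 : t + 1 ≤ q := by
      have : C₁ * (3 / 10 * N) ≤ C₁ * K := by gcongr; linarith
      linarith
    have h5 : t / q ≤ t / (t + 1) := by gcongr
    have h6 : 3 / 10 * C₁ * N = t := by rw [ht]; ring
    rw [h6, hκ]
    linarith
  by_cases hcase : C₂ ≤ δ * κ / r ^ 2
  · right
    have hZ := hgrow (fun x => 1 - Real.exp (C₁ * (bern u ε e x - W))) z r κ hr hκ0
      (fun x hx => by
        have h1 : Real.exp (C₁ * (bern u ε e x - W)) ≤ 1 := by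
          rw [Real.exp_le_one_iff]
          exact mul_nonpos_of_nonneg_of_nonpos hC₁.le (by linarith [hW x hx])
        linarith)
      (fun η hη => by
        obtain ⟨v, U, hU, hsU, hv, hvp⟩ := happ Ω u A f S e he z (4 * r) W hsub hW η hη
        exact ⟨v, U, hU, hsU, hv, fun x hx => ⟨(hvp x hx).1, (hvp x hx).2.mono hcase⟩⟩)
      (hvol.trans (measure_mono (by
        rintro x ⟨hx, hx2⟩
        refine ⟨?_, hx2⟩
        have hx' : 3 / 10 * N < W - bern u ε e x := hx
        change κ < 1 - Real.exp (C₁ * (bern u ε e x - W))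
        rw [hκ, sub_lt_sub_iff_left, Real.exp_lt_exp]
        nlinarith)))
    intro x hx
    have h1 := hZ x hx
    have h2 := Real.add_one_le_exp (C₁ * (bern u ε e x - W))
    have h3 : c * κ ≤ C₁ * (W - bern u ε e x) := by linarith
    have h4 : c * (3 / 10 * C₁ * N / q) ≤ c * κ := by gcongr
    have h5 : c * (3 / 10 * C₁ * N / q) = C₁ * (c * (3 / 10) / q * N) := by ring
    have h6 : c * (3 / 10) / q * N ≤ W - bern u ε e x := by
      refine le_of_mul_le_mul_left ?_ hC₁
      linarith
    linarith
  · left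
    push Not at hcase
    rw [div_lt_iff₀ (by positivity)] at hcase
    have h1 : δ * (3 / 10 * C₁ * N / q) ≤ C₂ * r ^ 2 := by
      refine le_trans ?_ hcase.le
      gcongr
    have h2 : N = δ * (3 / 10 * C₁ * N / q) * (q / (δ * (3 / 10 * C₁))) := by field_simp
    rw [h2]
    calc _ ≤ C₂ * r ^ 2 * (q / (δ * (3 / 10 * C₁))) := by gcongr
      _ = _ := by ring

/-- The signed coordinate vectors. -/
noncomputable def sgnVec (i : Fin n × Bool) : Eu n :=
  (if i.2 then (1 : ℝ) else -1) • EuclideanSpace.single i.1 1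

lemma norm_sgnVec (i : Fin n × Bool) : ‖sgnVec i‖ = 1 := by
  rcases i with ⟨i, b⟩
  cases b <;> simp [sgnVec]

lemma bern_sgnVec_true (u : Eu n → ℝ) (ε : ℝ) (k : Fin n) (x : Eu n) :
    bern u ε (sgnVec (k, true)) x = fderiv ℝ u x (EuclideanSpace.single k 1) +
      ε * ∑ l, fderiv ℝ u x (EuclideanSpace.single l 1) ^ 2 := by
  simp [bern, sgnVec]

lemma bern_sgnVec_false (u : Eu n → ℝ) (ε : ℝ) (k : Fin n) (x : Eu n) :
    bern u ε (sgnVec (k, false)) x = -fderiv ℝ u x (EuclideanSpace.single k 1) +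
      ε * ∑ l, fderiv ℝ u x (EuclideanSpace.single l 1) ^ 2 := by
  simp [bern, sgnVec]

/-- One step of the oscillation decay for the gradient. -/
lemma exists_osc_step (n : ℕ) (hn : 0 < n) {lam Lam K D : ℝ} (hlam : 0 < lam) (hLam : 0 ≤ Lam)
    (hK : 0 ≤ K) (hD : 0 ≤ D) :
    ∃ ε > 0, ε * K ≤ 1 ∧ ∃ θ ∈ Ioo (0 : ℝ) 1, ∃ B > 0, ∀ (Ω : Set (Eu n)) (u : Eu n → ℝ)
      (A : Eu n → Matrix (Fin n) (Fin n) ℝ) (f : Eu n → ℝ), GradSys lam Lam K D Ω u A f →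
      ∀ (z : Eu n) (r : ℝ), 0 < r → closedBall z (4 * r) ⊆ Ω →
      ∑ i, oscOn (bern u ε (sgnVec i)) (closedBall z r) ≤
        θ * ∑ i, oscOn (bern u ε (sgnVec i)) (closedBall z (4 * r)) + B * r ^ 2 := by
  have hn' : (1 : ℝ) ≤ n := by exact_mod_cast hn
  set ε : ℝ := 1 / (20 * n * (K + 1)) with hε
  have hε0 : 0 < ε := by positivity
  have hεKn : 2 * ε * K * n ≤ 1 / 10 := by
    rw [hε]
    have : 2 * (1 / (20 * n * (K + 1))) * K * n = K / (K + 1) / 10 := by field_simp; ring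
    rw [this]
    have : K / (K + 1) ≤ 1 := by rw [div_le_one (by linarith)]; linarith
    linarith
  have hεK' : 2 * ε * K ≤ 1 / 10 := by
    refine le_trans ?_ hεKn
    exact le_mul_of_one_le_right (by positivity) hn'
  obtain ⟨c, ⟨hc0, hc1⟩, B, hB, hdrop⟩ :=
    exists_bern_drop n hlam hLam hK hD hε0 (by linarith : 2 * ε * K ≤ 1)
  refine ⟨ε, hε0, by linarith, 1 - c / (4 * n), ⟨?_, ?_⟩, 4 * n * B, by positivity, ?_⟩
  · have : c / (4 * n) < 1 := by rw [div_lt_one (by positivity)]; linarith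
    linarith
  · have : 0 < c / (4 * n) := by positivity
    linarith
  intro Ω u A f S z r hr hsub
  set P := closedBall z (4 * r) with hP
  set P' := closedBall z r with hP'
  have hPP : P' ⊆ P := closedBall_subset_closedBall (by linarith)
  have hne' : P'.Nonempty := ⟨z, mem_closedBall_self hr.le⟩
  have hne : P.Nonempty := hne'.mono hPP
  let g : Fin n → Eu n → ℝ := fun l x => fderiv ℝ u x (EuclideanSpace.single l 1)
  have hg : ∀ l, ∀ x ∈ P, |g l x| ≤ K := fun l x hx => by
    have := (fderiv ℝ u x).le_opNorm (EuclideanSpace.single l 1)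
    simp only [PiLp.norm_single, norm_one, mul_one, Real.norm_eq_abs] at this
    exact this.trans (S.norm_fderiv_le x (hsub hx))
  obtain ⟨k, -, hk⟩ := Finset.exists_max_image Finset.univ (fun l => oscOn (g l) P)
    ⟨⟨0, hn⟩, Finset.mem_univ _⟩
  set N := oscOn (g k) P with hN
  have hN0 : 0 ≤ N := oscOn_nonneg hne (hg k)
  have hN2 : N ≤ 2 * K := oscOn_le hne fun x hx y hy => by
    linarith [(abs_le.1 (hg k x hx)).2, (abs_le.1 (hg k y hy)).1]
  have hgd : ∀ l, ∀ x ∈ P, ∀ y ∈ P, |g l x - g l y| ≤ N := fun l x hx y hy => by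
    rw [abs_le]
    have h1 := (sub_le_oscOn (hg l) hx hy).trans (hk l (Finset.mem_univ l))
    have h2 := (sub_le_oscOn (hg l) hy hx).trans (hk l (Finset.mem_univ l))
    constructor <;> linarith
  let G : Eu n → ℝ := fun x => ε * ∑ l, g l x ^ 2
  have hGd : ∀ x ∈ P, ∀ y ∈ P, G x - G y ≤ N / 10 := fun x hx y hy => by
    have h1 : ∑ l, g l x ^ 2 - ∑ l, g l y ^ 2 ≤ ∑ _l : Fin n, 2 * K * N := by
      rw [← Finset.sum_sub_distrib]
      refine Finset.sum_le_sum fun l _ => ?_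
      have h2 : g l x ^ 2 - g l y ^ 2 = (g l x + g l y) * (g l x - g l y) := by ring
      rw [h2]
      refine (le_abs_self _).trans ?_
      rw [abs_mul]
      refine mul_le_mul ?_ (hgd l x hx y hy) (abs_nonneg _) (by linarith)
      refine (abs_add_le _ _).trans ?_
      linarith [hg l x hx, hg l y hy]
    have h3 : ∑ _l : Fin n, 2 * K * N = n * (2 * K * N) := by simp
    rw [h3] at h1
    calc G x - G y = ε * (∑ l, g l x ^ 2 - ∑ l, g l y ^ 2) := by simp only [G]; ring
      _ ≤ ε * (n * (2 * K * N)) := by gcongr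
      _ = 2 * ε * K * n * N := by ring
      _ ≤ 1 / 10 * N := by gcongr
      _ = N / 10 := by ring
  have hG0 : ∀ x ∈ P, |G x| ≤ ε * (n * K ^ 2) := fun x hx => by
    have h1 : ∑ l, g l x ^ 2 ≤ ∑ _l : Fin n, K ^ 2 :=
      Finset.sum_le_sum fun l _ => by
        rw [← sq_abs]
        have := hg l x hx
        gcongr
    have h2 : 0 ≤ ∑ l, g l x ^ 2 := by positivity
    rw [abs_of_nonneg (by positivity)]
    simp only [Finset.sum_const, Finset.card_univ, Fintype.card_fin, nsmul_eq_mul] at h1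
    simp only [G]
    gcongr
  have hwt : ∀ l x, bern u ε (sgnVec (l, true)) x = g l x + G x := bern_sgnVec_true u ε
  have hwf : ∀ l x, bern u ε (sgnVec (l, false)) x = -g l x + G x := bern_sgnVec_false u ε
  have hwb : ∀ i, ∀ x ∈ P, |bern u ε (sgnVec i) x| ≤ K + ε * (n * K ^ 2) := by
    rintro ⟨l, b⟩ x hx
    have h1 := hg l x hx
    have h2 := hG0 x hx
    cases b
    · rw [hwf]
      refine (abs_add_le _ _).trans ?_
      rw [abs_neg]
      linarith
    · rw [hwt]
      exact (abs_add_le _ _).trans (by linarith)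
  have hosc2 : ∀ i, oscOn (bern u ε (sgnVec i)) P ≤ 2 * N := by
    rintro ⟨l, b⟩
    refine oscOn_le hne fun x hx y hy => ?_
    have h1 := abs_le.1 (hgd l x hx y hy)
    have h2 := hGd x hx y hy
    cases b
    · rw [hwf, hwf]; linarith
    · rw [hwt, hwt]; linarith
  have hmono : ∀ i, oscOn (bern u ε (sgnVec i)) P' ≤ oscOn (bern u ε (sgnVec i)) P := fun i =>
    oscOn_mono hne' hPP (hwb i)
  have hsum : ∑ i : Fin n × Bool, oscOn (bern u ε (sgnVec i)) P ≤ 4 * n * N := by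
    refine (Finset.sum_le_sum fun i _ => hosc2 i).trans_eq ?_
    simp
    ring
  set ω := ∑ i : Fin n × Bool, oscOn (bern u ε (sgnVec i)) P with hω
  have hω0 : 0 ≤ ω := Finset.sum_nonneg fun i _ => oscOn_nonneg hne (hwb i)
  have hBr : 0 ≤ 4 * n * B * r ^ 2 := by positivity
  have hmain : N ≤ B * r ^ 2 ∨ ∃ i, oscOn (bern u ε (sgnVec i)) P' ≤
      oscOn (bern u ε (sgnVec i)) P - c * N := by
    rcases hN0.eq_or_lt with h0 | hNpos
    · left
      rw [← h0]
      positivity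
    have hfin : ∀ i, (∀ x ∈ P', bern u ε (sgnVec i) x ≤ supOn (bern u ε (sgnVec i)) P - c * N) →
        oscOn (bern u ε (sgnVec i)) P' ≤ oscOn (bern u ε (sgnVec i)) P - c * N := by
      intro i hi
      have h1 := supOn_le hne' hi
      have h2 : supOn (-bern u ε (sgnVec i)) P' ≤ supOn (-bern u ε (sgnVec i)) P :=
        supOn_le hne' fun x hx => le_supOn (bound_neg (hwb i)) (hPP hx)
      simp only [oscOn]
      linarith
    have hcov : P' ⊆ {x | 3 / 10 * N < supOn (bern u ε (sgnVec (k, true))) P -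
        bern u ε (sgnVec (k, true)) x} ∪ {x | 3 / 10 * N <
          supOn (bern u ε (sgnVec (k, false))) P - bern u ε (sgnVec (k, false)) x} := by
      intro x hx
      have hxP := hPP hx
      have h1 : N ≤ supOn (bern u ε (sgnVec (k, true))) P +
          supOn (bern u ε (sgnVec (k, false))) P - 2 * G x + N / 5 := by
        refine oscOn_le hne fun y hy y' hy' => ?_
        have h3 := le_supOn (hwb (k, true)) hy
        have h4 := le_supOn (hwb (k, false)) hy'
        rw [hwt] at h3
        rw [hwf] at h4
        linarith [hGd x hxP y hy, hGd x hxP y' hy']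
      by_contra hcon
      rw [mem_union, not_or] at hcon
      have h5 : ¬ (3 / 10 * N < supOn (bern u ε (sgnVec (k, true))) P -
        bern u ε (sgnVec (k, true)) x) := hcon.1
      have h6 : ¬ (3 / 10 * N < supOn (bern u ε (sgnVec (k, false))) P -
        bern u ε (sgnVec (k, false)) x) := hcon.2
      rw [hwt] at h5
      rw [hwf] at h6
      linarith
    rcases half_volume_le_or hcov with h | h
    · rcases hdrop Ω u A f S (sgnVec (k, true)) (norm_sgnVec _).le z r _ N hr hNpos hN2 hsub
        (fun x hx => le_supOn (hwb (k, true)) hx) h with h' | h'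
      · exact Or.inl h'
      · exact Or.inr ⟨_, hfin _ h'⟩
    · rcases hdrop Ω u A f S (sgnVec (k, false)) (norm_sgnVec _).le z r _ N hr hNpos hN2 hsub
        (fun x hx => le_supOn (hwb (k, false)) hx) h with h' | h'
      · exact Or.inl h'
      · exact Or.inr ⟨_, hfin _ h'⟩
  rcases hmain with h | ⟨i, hi⟩
  · have h1 : ∑ i, oscOn (bern u ε (sgnVec i)) P' ≤ ω := Finset.sum_le_sum fun i _ => hmono i
    have h2 : c / (4 * n) * ω ≤ 1 * ω := by
      refine mul_le_mul_of_nonneg_right ?_ hω0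
      rw [div_le_one (by positivity)]
      linarith
    have h3 : 4 * n * N ≤ 4 * n * (B * r ^ 2) := by gcongr
    nlinarith
  · have h1 : ∑ i, oscOn (bern u ε (sgnVec i)) P' ≤ ω - c * N := by
      rw [hω, ← Finset.add_sum_erase _ _ (Finset.mem_univ i),
        ← Finset.add_sum_erase _ (fun i => oscOn (bern u ε (sgnVec i)) P) (Finset.mem_univ i)]
      have := Finset.sum_le_sum (s := Finset.univ.erase i) fun j _ => hmono j
      linarith
    have h2 : c / (4 * n) * ω ≤ c / (4 * n) * (4 * n * N) := by gcongr
    have h3 : c / (4 * n) * (4 * n * N) = c * N := by field_simp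
    linarith

/-- Interior Hölder estimate for the gradient. -/
theorem exists_interior_holder (n : ℕ) (hn : 0 < n) {lam Lam K D : ℝ} (hlam : 0 < lam)
    (hLam : 0 ≤ Lam) (hK : 0 ≤ K) (hD : 0 ≤ D) :
    ∃ β ∈ Ioo (0 : ℝ) 1, ∃ C > 0, ∀ (Ω : Set (Eu n)) (u : Eu n → ℝ)
      (A : Eu n → Matrix (Fin n) (Fin n) ℝ) (f : Eu n → ℝ), GradSys lam Lam K D Ω u A f →
      ∀ (z : Eu n) (R : ℝ), 0 < R → R ≤ 1 → closedBall z R ⊆ Ω →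
      ∀ x ∈ closedBall z R, ‖fderiv ℝ u x - fderiv ℝ u z‖ ≤ C * (‖x - z‖ / R) ^ β := by
  obtain ⟨ε, hε, hεK, θ, ⟨hθ0, hθ1⟩, B, hB, hstep⟩ := exists_osc_step n hn hlam hLam hK hD
  obtain ⟨β, hβ, C, hC, hdec⟩ := exists_decay hθ0 hθ1 (by norm_num : (1 : ℝ) < 4)
  have hn' : (1 : ℝ) ≤ n := by exact_mod_cast hn
  set M := 2 * n * (2 * (K + ε * (n * K ^ 2))) with hM
  have hM0 : 0 ≤ M := by positivity
  refine ⟨β, hβ, n * (C * (M + B)), by positivity, ?_⟩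
  intro Ω u A f S z R hR hR1 hsub x hx
  rcases eq_or_ne x z with rfl | hxz
  · simp [Real.zero_rpow hβ.1.ne']
  let g : Fin n → Eu n → ℝ := fun l x => fderiv ℝ u x (EuclideanSpace.single l 1)
  have hg : ∀ l, ∀ x ∈ closedBall z R, |g l x| ≤ K := fun l x hx => by
    have := (fderiv ℝ u x).le_opNorm (EuclideanSpace.single l 1)
    simp only [PiLp.norm_single, norm_one, mul_one, Real.norm_eq_abs] at this
    exact this.trans (S.norm_fderiv_le x (hsub hx))
  have hG0 : ∀ x ∈ closedBall z R, |ε * ∑ l, g l x ^ 2| ≤ ε * (n * K ^ 2) := fun x hx => by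
    have h1 : ∑ l, g l x ^ 2 ≤ ∑ _l : Fin n, K ^ 2 :=
      Finset.sum_le_sum fun l _ => by
        rw [← sq_abs]
        have := hg l x hx
        gcongr
    have h2 : 0 ≤ ∑ l, g l x ^ 2 := by positivity
    rw [abs_of_nonneg (by positivity)]
    simp only [Finset.sum_const, Finset.card_univ, Fintype.card_fin, nsmul_eq_mul] at h1
    gcongr
  have hwb : ∀ i, ∀ x ∈ closedBall z R, |bern u ε (sgnVec i) x| ≤ K + ε * (n * K ^ 2) := by
    rintro ⟨l, b⟩ x hx
    have h1 := hg l x hx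
    have h2 := hG0 x hx
    cases b
    · rw [bern_sgnVec_false]
      refine (abs_add_le _ _).trans ?_
      rw [abs_neg]
      exact add_le_add h1 h2
    · rw [bern_sgnVec_true]
      exact (abs_add_le _ _).trans (add_le_add h1 h2)
  have hdecay := hdec (fun r => ∑ i, oscOn (bern u ε (sgnVec i)) (closedBall z r)) M B R hR hM0 hB.le
    (fun r s hr hrs hsR => Finset.sum_le_sum fun i _ => oscOn_mono ⟨z, mem_closedBall_self hr.le⟩
      (closedBall_subset_closedBall hrs)
      fun x hx => hwb i x (closedBall_subset_closedBall hsR hx))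
    (by
      have h1 : ∀ i : Fin n × Bool, oscOn (bern u ε (sgnVec i)) (closedBall z R) ≤
          2 * (K + ε * (n * K ^ 2)) := fun i =>
        oscOn_le ⟨z, mem_closedBall_self hR.le⟩ fun x hx y hy => by
          linarith [(abs_le.1 (hwb i x hx)).2, (abs_le.1 (hwb i y hy)).1]
      refine (Finset.sum_le_sum fun i _ => h1 i).trans_eq ?_
      rw [Finset.sum_const, Finset.card_univ, nsmul_eq_mul, hM]
      simp only [Fintype.card_prod, Fintype.card_fin, Fintype.card_bool, Nat.cast_mul,
        Nat.cast_ofNat]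
      ring)
    (fun r hr hrR => by
      have h1 := hstep Ω u A f S z (r / 4) (by linarith)
        ((closedBall_subset_closedBall (by linarith)).trans hsub)
      rw [mul_div_cancel₀ _ (by norm_num : (4 : ℝ) ≠ 0)] at h1
      refine h1.trans ?_
      gcongr
      rw [le_div_iff₀ hR]
      nlinarith)
  set r := ‖x - z‖ with hr
  have hr0 : 0 < r := norm_pos_iff.2 (sub_ne_zero.2 hxz)
  have hrR : r ≤ R := by rw [hr, ← dist_eq_norm]; exact hx
  have hω := hdecay r hr0 hrR
  have hxr : x ∈ closedBall z r := by rw [mem_closedBall, dist_eq_norm]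
  have hzr : z ∈ closedBall z r := mem_closedBall_self hr0.le
  have hwr : ∀ i, ∀ x ∈ closedBall z r, |bern u ε (sgnVec i) x| ≤ K + ε * (n * K ^ 2) :=
    fun i x hx => hwb i x (closedBall_subset_closedBall hrR hx)
  have hosc0 : ∀ i, 0 ≤ oscOn (bern u ε (sgnVec i)) (closedBall z r) := fun i =>
    oscOn_nonneg ⟨z, hzr⟩ (hwr i)
  have hle : ∀ i, oscOn (bern u ε (sgnVec i)) (closedBall z r) ≤ C * (M + B) * (r / R) ^ β :=
    fun i => (Finset.single_le_sum (fun j _ => hosc0 j) (Finset.mem_univ i)).trans hω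
  have hk : ∀ k, |g k x - g k z| ≤ C * (M + B) * (r / R) ^ β := by
    intro k
    have h1 := (sub_le_oscOn (hwr (k, true)) hxr hzr).trans (hle _)
    have h2 := (sub_le_oscOn (hwr (k, true)) hzr hxr).trans (hle _)
    have h3 := (sub_le_oscOn (hwr (k, false)) hxr hzr).trans (hle _)
    have h4 := (sub_le_oscOn (hwr (k, false)) hzr hxr).trans (hle _)
    rw [bern_sgnVec_true, bern_sgnVec_true] at h1 h2
    rw [bern_sgnVec_false, bern_sgnVec_false] at h3 h4
    simp only [g]
    rw [abs_le]
    constructor <;> linarith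
  set T := C * (M + B) * (r / R) ^ β with hT
  have hT0 : 0 ≤ T := by positivity
  rw [mul_assoc, ← hT]
  refine ContinuousLinearMap.opNorm_le_bound _ (by positivity) fun v => ?_
  rw [eu_linear_apply, Real.norm_eq_abs]
  refine (Finset.abs_sum_le_sum_abs _ _).trans ?_
  have : ∀ l : Fin n, |v l * (fderiv ℝ u x - fderiv ℝ u z) (EuclideanSpace.single l 1)|
      ≤ ‖v‖ * T := fun l => by
    rw [abs_mul]
    refine mul_le_mul ?_ (hk l) (abs_nonneg _) (norm_nonneg _)
    simpa using PiLp.norm_apply_le v l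
  refine (Finset.sum_le_sum fun l _ => this l).trans_eq ?_
  simp
  ring

end InteriorEstimate

section BoundaryStep

open Metric MeasureTheory

variable {n : ℕ}

/-- A normalised `C²` defining function `ψ` of `Ω` in the ball of radius `ρ` around `p`. -/
structure Chart (Ω : Set (Eu n)) (p : Eu n) (ρ M : ℝ) (ψ : Eu n → ℝ) : Prop where
  pos : 0 < ρ
  one_le : 1 ≤ M
  contDiff : ContDiff ℝ 2 ψ
  norm_fderiv : ‖fderiv ℝ ψ p‖ = 1
  fderiv_sub_le : ∀ x ∈ ball p ρ, ‖fderiv ℝ ψ x - fderiv ℝ ψ p‖ ≤ 1 / 100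
  hess_le : ∀ x ∈ ball p ρ, ‖hess ψ x‖ ≤ M
  mem_iff : ∀ x ∈ ball p ρ, (x ∈ Ω ↔ 0 < ψ x)
  frontier_iff : ∀ x ∈ ball p ρ, (x ∈ frontier Ω ↔ ψ x = 0)

namespace Chart

variable {Ω : Set (Eu n)} {p : Eu n} {ρ M : ℝ} {ψ : Eu n → ℝ}

lemma differentiable (h : Chart Ω p ρ M ψ) : Differentiable ℝ ψ :=
  h.contDiff.differentiable (by norm_num)

lemma abs_sub_sub_le (h : Chart Ω p ρ M ψ) {x y : Eu n} (hx : x ∈ ball p ρ) (hy : y ∈ ball p ρ) :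
    |ψ y - ψ x - fderiv ℝ ψ p (y - x)| ≤ 1 / 100 * ‖y - x‖ :=
  (convex_ball p ρ).norm_image_sub_le_of_norm_hasFDerivWithin_le'
    (fun z _ => (h.differentiable z).hasFDerivAt.hasFDerivWithinAt)
    (fun z hz => h.fderiv_sub_le z hz) hx hy

lemma norm_fderiv_sub_le (h : Chart Ω p ρ M ψ) {x y : Eu n} (hx : x ∈ ball p ρ)
    (hy : y ∈ ball p ρ) : ‖fderiv ℝ ψ y - fderiv ℝ ψ x‖ ≤ M * ‖y - x‖ :=
  (convex_ball p ρ).norm_image_sub_le_of_norm_hasFDerivWithin_le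
    (fun _ _ => h.contDiff.contDiffAt.differentiableAt_fderiv.hasFDerivAt.hasFDerivWithinAt)
    (fun z hz => h.hess_le z hz) hx hy

lemma taylor_le (h : Chart Ω p ρ M ψ) {x y : Eu n} (hx : x ∈ ball p ρ) (hy : y ∈ ball p ρ) :
    |ψ y - ψ x - fderiv ℝ ψ x (y - x)| ≤ M * ‖y - x‖ ^ 2 := by
  have hM := h.one_le
  have := ((convex_ball p ρ).inter
    (convex_closedBall x ‖y - x‖)).norm_image_sub_le_of_norm_hasFDerivWithin_le' (f := ψ)
    (f' := fderiv ℝ ψ) (φ := fderiv ℝ ψ x) (C := M * ‖y - x‖) (x := x) (y := y)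
    (fun z _ => (h.differentiable z).hasFDerivAt.hasFDerivWithinAt)
    (fun z hz => (h.norm_fderiv_sub_le hx hz.1).trans (by
      have := mem_closedBall_iff_norm.1 hz.2
      gcongr)) ⟨hx, by simp⟩ ⟨hy, by simp [dist_eq_norm]⟩
  rw [Real.norm_eq_abs] at this
  calc _ ≤ _ := this
    _ = _ := by ring

lemma norm_fderiv_le (h : Chart Ω p ρ M ψ) {x : Eu n} (hx : x ∈ ball p ρ) :
    ‖fderiv ℝ ψ x‖ ≤ 101 / 100 := by
  have h1 := h.fderiv_sub_le x hx
  have h2 := norm_sub_norm_le (fderiv ℝ ψ x) (fderiv ℝ ψ p)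
  rw [h.norm_fderiv] at h2
  linarith

lemma le_norm_fderiv (h : Chart Ω p ρ M ψ) {x : Eu n} (hx : x ∈ ball p ρ) :
    99 / 100 ≤ ‖fderiv ℝ ψ x‖ := by
  have h1 := h.fderiv_sub_le x hx
  have h2 := norm_sub_norm_le (fderiv ℝ ψ p) (fderiv ℝ ψ x)
  rw [h.norm_fderiv, norm_sub_rev] at h2
  linarith

lemma abs_sub_le (h : Chart Ω p ρ M ψ) {x y : Eu n} (hx : x ∈ ball p ρ) (hy : y ∈ ball p ρ) :
    |ψ y - ψ x| ≤ 101 / 100 * ‖y - x‖ :=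
  (convex_ball p ρ).norm_image_sub_le_of_norm_hasFDerivWithin_le
    (fun z _ => (h.differentiable z).hasFDerivAt.hasFDerivWithinAt)
    (fun _ hz => h.norm_fderiv_le hz) hx hy

/-- The inner normal at the centre of the chart. -/
noncomputable def _root_.unitNormal (ψ : Eu n → ℝ) (x : Eu n) : Eu n :=
  ‖fderiv ℝ ψ x‖⁻¹ • gradL n (fderiv ℝ ψ x)

lemma norm_unitNormal (h : Chart Ω p ρ M ψ) {x : Eu n} (hx : x ∈ ball p ρ) :
    ‖unitNormal ψ x‖ = 1 := by
  have := h.le_norm_fderiv hx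
  rw [unitNormal, norm_smul, norm_gradL, norm_inv, norm_norm, inv_mul_cancel₀ (by linarith)]

lemma fderiv_eq_inner (h : Chart Ω p ρ M ψ) {x : Eu n} (hx : x ∈ ball p ρ) (v : Eu n) :
    fderiv ℝ ψ x v = ‖fderiv ℝ ψ x‖ * inner ℝ (unitNormal ψ x) v := by
  have := h.le_norm_fderiv hx
  rw [unitNormal, real_inner_smul_left, inner_gradL, ← mul_assoc, mul_inv_cancel₀ (by linarith),
    one_mul]

lemma center_mem (h : Chart Ω p ρ M ψ) : p ∈ ball p ρ := mem_ball_self h.pos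

lemma fderiv_center_unitNormal (h : Chart Ω p ρ M ψ) : fderiv ℝ ψ p (unitNormal ψ p) = 1 := by
  rw [h.fderiv_eq_inner h.center_mem, real_inner_self_eq_norm_sq, h.norm_unitNormal h.center_mem,
    h.norm_fderiv]
  norm_num

lemma norm_unitNormal_sub_le (h : Chart Ω p ρ M ψ) {x : Eu n} (hx : x ∈ ball p ρ) :
    ‖unitNormal ψ x - unitNormal ψ p‖ ≤ 1 / 50 := by
  have h1 := h.le_norm_fderiv hx
  have h2 := h.norm_fderiv_le hx
  set a := ‖fderiv ℝ ψ x‖ with ha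
  have h3 : unitNormal ψ x - unitNormal ψ p
      = (1 - a) • unitNormal ψ x + gradL n (fderiv ℝ ψ x - fderiv ℝ ψ p) := by
    have e1 : gradL n (fderiv ℝ ψ x) = a • unitNormal ψ x := by
      rw [unitNormal, smul_smul, ← ha, mul_inv_cancel₀ (by linarith), one_smul]
    have e2 : gradL n (fderiv ℝ ψ p) = unitNormal ψ p := by
      rw [unitNormal, h.norm_fderiv, inv_one, one_smul]
    rw [map_sub, e1, e2, sub_smul, one_smul]
    abel
  rw [h3]
  refine (norm_add_le _ _).trans ?_
  rw [norm_smul, norm_gradL, h.norm_unitNormal hx, mul_one, Real.norm_eq_abs]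
  have h4 : |1 - a| ≤ 1 / 100 := abs_le.2 ⟨by linarith, by linarith⟩
  linarith [h.fderiv_sub_le x hx]

lemma mul_le_of_mem_closedBall (h : Chart Ω p ρ M ψ) {x₀ : Eu n} (hx₀ : x₀ ∈ ball p ρ)
    (hψ : 0 ≤ ψ x₀) {R : ℝ} {y : Eu n} (hR : 0 ≤ R) (hyρ : y ∈ ball p ρ)
    (hy : y ∈ closedBall (x₀ + R • unitNormal ψ p) (R / 2)) : 2 / 5 * R ≤ ψ y := by
  set k := y - (x₀ + R • unitNormal ψ p) with hk
  have hk' : ‖k‖ ≤ R / 2 := mem_closedBall_iff_norm.1 hy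
  have e : y - x₀ = R • unitNormal ψ p + k := by rw [hk]; abel
  have h1 := (abs_le.1 (h.abs_sub_sub_le hx₀ hyρ)).1
  have hν := h.norm_unitNormal h.center_mem
  rw [e, map_add, map_smul, h.fderiv_center_unitNormal, smul_eq_mul, mul_one] at h1
  have h2 : |fderiv ℝ ψ p k| ≤ R / 2 := by
    have := (fderiv ℝ ψ p).le_opNorm k
    rw [h.norm_fderiv, one_mul] at this
    exact this.trans hk'
  have h3 : ‖R • unitNormal ψ p + k‖ ≤ R + R / 2 := by
    refine (norm_add_le _ _).trans ?_
    rw [norm_smul, hν, Real.norm_eq_abs, abs_of_nonneg hR]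
    linarith
  linarith [(abs_le.1 h2).1]

/-- The interior ball condition, in a quantitative form. -/
lemma pos_of_mem_closedBall (h : Chart Ω p ρ M ψ) {x y : Eu n} {R d : ℝ} (hx : x ∈ ball p ρ)
    (hψ : 0 < ψ x) (hd : d = ψ x / 4) (hdR : d ≤ R) (hMR : M * R ≤ 1 / 4) (hyρ : y ∈ ball p ρ)
    (hy : y ∈ closedBall (x + (R - d) • unitNormal ψ x) R) : 0 < ψ y := by
  have hM := h.one_le
  have hd0 : 0 < d := by rw [hd]; linarith
  have hR : 0 < R := by linarith
  set ν := unitNormal ψ x with hν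
  set k := y - (x + (R - d) • ν) with hk
  have hk' : ‖k‖ ≤ R := mem_closedBall_iff_norm.1 hy
  have hν1 : ‖ν‖ = 1 := h.norm_unitNormal hx
  have e : y - x = (R - d) • ν + k := by rw [hk]; abel
  have h1 := (abs_le.1 (h.taylor_le hx hyρ)).1
  rw [h.fderiv_eq_inner hx, e, inner_add_right, real_inner_smul_right, ← hν,
    real_inner_self_eq_norm_sq, hν1] at h1
  set t := inner ℝ ν k with ht
  have ht' : |t| ≤ R := by
    have := abs_real_inner_le_norm ν k
    rw [hν1, one_mul] at this
    exact this.trans hk'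
  have h2 : ‖(R - d) • ν + k‖ ^ 2 ≤ (R - d) ^ 2 + 2 * (R - d) * t + R ^ 2 := by
    rw [norm_add_sq_real, norm_smul, hν1, real_inner_smul_left, ← ht, mul_one, Real.norm_eq_abs,
      sq_abs]
    have : ‖k‖ ^ 2 ≤ R ^ 2 := by gcongr
    linarith
  set a := ‖fderiv ℝ ψ x‖ with ha
  have ha1 := h.le_norm_fderiv hx
  have ha2 := h.norm_fderiv_le hx
  have hτ : 0 ≤ R + t := by linarith [(abs_le.1 ht').1]
  have h3 : ‖(R - d) • ν + k‖ ^ 2 ≤ d ^ 2 + 2 * R * (R + t) := by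
    refine h2.trans ?_
    nlinarith
  have h4 : M * ‖(R - d) • ν + k‖ ^ 2 ≤ M * (d ^ 2 + 2 * R * (R + t)) := by gcongr
  have h5 : M * d ≤ 1 / 4 := (mul_le_mul_of_nonneg_left hdR (by linarith)).trans hMR
  have h6 : 0 ≤ (a - 2 * (M * R)) * (R + t) := mul_nonneg (by linarith) hτ
  have h7 : M * d * d ≤ 1 / 4 * d := by gcongr
  have h8 : a * d ≤ 101 / 100 * d := by gcongr
  nlinarith

end Chart

/-- Boundary growth: a nonnegative supersolution which is large on half of a ball at height
comparable to `r` above a boundary point dominates the defining function near that point. -/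
lemma exists_boundary_growth (n : ℕ) {lam Lam : ℝ} (hlam : 0 < lam) (hLam : 0 ≤ Lam) :
    ∃ c ∈ Ioo (0 : ℝ) 1, ∃ δ > 0, ∀ (Ω : Set (Eu n)) (p : Eu n) (ρ M : ℝ) (ψ : Eu n → ℝ),
      IsOpen Ω → Chart Ω p ρ M ψ → ∀ (x₀ : Eu n) (r N : ℝ) (z : Eu n → ℝ), x₀ ∈ ball p (ρ / 2) →
      ψ x₀ = 0 → 0 < r → r ≤ ρ / 2 → M * r ≤ 1 → 0 < N → ContDiffOn ℝ 2 z (Ω ∩ ball p ρ) →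
      (∀ x ∈ Ω ∩ closedBall x₀ r, 0 ≤ z x) →
      (∀ x ∈ Ω ∩ closedBall x₀ r, SuperAt lam Lam (hess z x) (δ * N / r)) →
      ENNReal.ofReal (1 / 2) * volume (closedBall (x₀ + (r / 8) • unitNormal ψ p) (r / 64)) ≤
        volume ({x | N * r / 80 < z x} ∩ closedBall (x₀ + (r / 8) • unitNormal ψ p) (r / 64)) →
      ∀ x ∈ Ω ∩ closedBall x₀ (r / 1000), c * N * ψ x ≤ z x := by
  obtain ⟨c₁, ⟨hc₁, hc₁'⟩, δ₁, hδ₁, hgrow⟩ := exists_growth n hlam hLam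
  obtain ⟨c₂, hc₂, δ₂, hδ₂, hhopf⟩ := exists_hopf_lower_bound n hlam hLam
  set δ := min (δ₁ / 2) (δ₂ * c₁ / 2) with hδ
  have hδ0 : 0 < δ := by positivity
  set c := min (1 / 2) (c₂ * c₁ / 40) with hc
  refine ⟨c, ⟨by positivity, (min_le_left _ _).trans_lt (by norm_num)⟩, δ, hδ0, ?_⟩
  intro Ω p ρ M ψ hΩ h x₀ r N z hx₀ hψ₀ hr hrρ hMr hN hz hz0 hsup hvol x hx
  have hball : ∀ y ∈ closedBall x₀ r, y ∈ ball p ρ := fun y hy => by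
    have h1 := mem_closedBall.1 hy
    have h2 := mem_ball.1 hx₀
    have := dist_triangle y x₀ p
    rw [mem_ball]
    linarith
  have hx₀ρ : x₀ ∈ ball p ρ := hball x₀ (mem_closedBall_self hr.le)
  set ν₀ := unitNormal ψ p with hν₀
  have hν₀1 : ‖ν₀‖ = 1 := h.norm_unitNormal h.center_mem
  set y₀ := x₀ + (r / 8) • ν₀ with hy₀
  have hy₀x₀ : dist y₀ x₀ = r / 8 := by
    rw [dist_eq_norm, hy₀, add_sub_cancel_left, norm_smul, hν₀1, Real.norm_eq_abs,
      abs_of_pos (by linarith), mul_one]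
  have hsubU : closedBall y₀ (4 * (r / 64)) ⊆ Ω ∩ closedBall x₀ r := by
    intro y hy
    have h1 : y ∈ closedBall x₀ r := by
      have := dist_triangle y y₀ x₀
      have h2 := mem_closedBall.1 hy
      rw [mem_closedBall]
      linarith
    refine ⟨(h.mem_iff y (hball y h1)).2 ?_, h1⟩
    have h2 := h.mul_le_of_mem_closedBall hx₀ρ hψ₀.ge (R := r / 8) (by linarith) (hball y h1)
      (by
        have e : r / 8 / 2 = 4 * (r / 64) := by ring
        rw [e]
        exact hy)
    linarith
  have hUopen : IsOpen (Ω ∩ ball p ρ) := hΩ.inter isOpen_ball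
  have hUsub : Ω ∩ closedBall x₀ r ⊆ Ω ∩ ball p ρ := fun y hy => ⟨hy.1, hball y hy.2⟩
  have hκ : 0 < N * r / 80 := by positivity
  have hlow : ∀ y ∈ closedBall y₀ (r / 64), c₁ * (N * r / 80) < z y := by
    refine hgrow z (Ω ∩ ball p ρ) y₀ (r / 64) (N * r / 80) (by linarith) hκ hUopen
      (hsubU.trans hUsub) hz (fun y hy => hz0 y (hsubU hy)) (fun y hy => ?_) hvol
    refine (hsup y (hsubU hy)).mono ?_
    have h1 : δ ≤ δ₁ / 2 := min_le_left _ _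
    have h2 : δ₁ * (N * r / 80) / (r / 64) ^ 2 = 51.2 * δ₁ * (N / r) := by
      field_simp
      norm_num
    rw [h2, mul_div_assoc]
    gcongr
    linarith
  set d := ψ x / 4 with hd
  have hxr : x ∈ closedBall x₀ r := closedBall_subset_closedBall (by linarith) hx.2
  have hxρ := hball x hxr
  have hψx : 0 < ψ x := (h.mem_iff x hxρ).1 hx.1
  have hxx₀ : ‖x - x₀‖ ≤ r / 1000 := mem_closedBall_iff_norm.1 hx.2
  have hψle : ψ x ≤ 101 / 100 * (r / 1000) := by
    have h1 := (abs_le.1 (h.abs_sub_le hx₀ρ hxρ)).2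
    rw [hψ₀, sub_zero] at h1
    linarith
  set y := x + (r / 8 - d) • unitNormal ψ x with hy
  have hνx : ‖unitNormal ψ x‖ = 1 := h.norm_unitNormal hxρ
  have hyx : ‖x - y‖ = r / 8 - d := by
    rw [hy, sub_add_cancel_left, norm_neg, norm_smul, hνx, mul_one, Real.norm_eq_abs,
      abs_of_nonneg (by linarith)]
  have hsub2 : closedBall y (r / 8) ⊆ Ω ∩ closedBall x₀ r := by
    intro q hq
    have h1 : q ∈ closedBall x₀ r := by
      have h2 := mem_closedBall_iff_norm.1 hq
      have h3 : q - x₀ = (q - y) + -(x - y) + (x - x₀) := by abel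
      rw [mem_closedBall_iff_norm, h3]
      have h4 := norm_add_le ((q - y) + -(x - y)) (x - x₀)
      have h5 := norm_add_le (q - y) (-(x - y))
      rw [norm_neg] at h5
      linarith
    refine ⟨(h.mem_iff q (hball q h1)).2 ?_, h1⟩
    exact h.pos_of_mem_closedBall hxρ hψx hd (by linarith)
      (by have : M * (r / 8) = M * r / 8 := by ring
          linarith) (hball q h1) hq
  have hyy₀ : ‖y - y₀‖ ≤ r / 128 := by
    have e : y - y₀ = (x - x₀) + (r / 8) • (unitNormal ψ x - ν₀) + -(d • unitNormal ψ x) := by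
      rw [hy, hy₀, sub_smul, smul_sub]
      abel
    rw [e]
    have h1 := norm_add_le ((x - x₀) + (r / 8) • (unitNormal ψ x - ν₀)) (-(d • unitNormal ψ x))
    have h2 := norm_add_le (x - x₀) ((r / 8) • (unitNormal ψ x - ν₀))
    have h3 := h.norm_unitNormal_sub_le hxρ
    rw [norm_smul, Real.norm_eq_abs, abs_of_pos (by linarith : 0 < r / 8)] at h2
    rw [norm_neg, norm_smul, hνx, Real.norm_eq_abs, abs_of_pos (by linarith : 0 < d)] at h1
    have h4 : r / 8 * ‖unitNormal ψ x - ν₀‖ ≤ r / 8 * (1 / 50) := by gcongr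
    linarith
  have hmain := hhopf z (Ω ∩ ball p ρ) y (r / 8) (c₁ * (N * r / 80)) (by linarith) (by positivity)
    hUopen (hsub2.trans hUsub) hz (fun q hq => hz0 q (hsub2 hq))
    (fun q hq => (hlow q (by
      have h1 := mem_closedBall_iff_norm.1 hq
      have h2 := norm_sub_le_norm_sub_add_norm_sub q y y₀
      rw [mem_closedBall_iff_norm]
      linarith)).le)
    (fun q hq => (hsup q (hsub2 hq)).mono (by
      have h1 : δ ≤ δ₂ * c₁ / 2 := min_le_right _ _
      have h2 : δ₂ * (c₁ * (N * r / 80)) / (r / 8) ^ 2 = 0.8 * (δ₂ * c₁) * (N / r) := by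
        field_simp
        norm_num
      rw [h2, mul_div_assoc]
      gcongr
      have : 0 < δ₂ * c₁ := by positivity
      linarith))
    x (by
      rw [mem_closedBall_iff_norm, hyx]
      linarith)
  rw [hyx] at hmain
  have e : c₂ * (c₁ * (N * r / 80)) * (1 - (r / 8 - d) / (r / 8)) = c₂ * c₁ / 40 * N * ψ x := by
    rw [hd]
    field_simp
    ring
  rw [e] at hmain
  refine le_trans ?_ hmain
  gcongr
  exact min_le_right _ _

end BoundaryStep

section BoundaryQuotient

open Metric MeasureTheory

variable {n : ℕ} {Ω : Set (Eu n)} {p : Eu n} {ρ M : ℝ} {ψ : Eu n → ℝ}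

lemma closedBall_subset_ball_of_mem_half {x₀ : Eu n} {r : ℝ} (hx₀ : x₀ ∈ ball p (ρ / 2))
    (hrρ : r ≤ ρ / 2) : closedBall x₀ r ⊆ ball p ρ := fun y hy => by
  have h1 := mem_closedBall.1 hy
  have h2 := mem_ball.1 hx₀
  have := dist_triangle y x₀ p
  rw [mem_ball]
  linarith

namespace Chart

lemma add_smul_mem (h : Chart Ω p ρ M ψ) {x₀ : Eu n} {r : ℝ} (hx₀ : x₀ ∈ ball p (ρ / 2))
    (hψ₀ : 0 ≤ ψ x₀) (hr : 0 < r) (hrρ : r ≤ ρ / 2) :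
    x₀ + r • unitNormal ψ p ∈ Ω ∩ closedBall x₀ r := by
  have h1 : x₀ + r • unitNormal ψ p ∈ closedBall x₀ r := by
    rw [mem_closedBall_iff_norm, add_sub_cancel_left, norm_smul, h.norm_unitNormal h.center_mem,
      mul_one, Real.norm_eq_abs, abs_of_pos hr]
  have h2 := closedBall_subset_ball_of_mem_half hx₀ hrρ h1
  refine ⟨(h.mem_iff _ h2).2 ?_, h1⟩
  have := h.mul_le_of_mem_closedBall
    (closedBall_subset_ball_of_mem_half hx₀ hrρ (mem_closedBall_self hr.le))
    hψ₀ hr.le h2 (mem_closedBall_self (by linarith))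
  linarith

end Chart

lemma trB_hess_lin_comb_le (h : Chart Ω p ρ M ψ) {lam Lam C₀ M₁ : ℝ} (hlam : 0 < lam)
    (hLam : 0 ≤ Lam) {v : Eu n → ℝ} {x : Eu n} (hx : x ∈ ball p ρ) (hv : ContDiffAt ℝ 2 v x)
    (hL : ∃ A, Ell lam Lam A ∧ |trB A (hess v x)| ≤ C₀) {s t : ℝ} (hs : |s| ≤ 1) (ht : |t| ≤ M₁) :
    SuperAt lam Lam (hess (fun x => s * v x + t * ψ x) x) (C₀ + M₁ * (n * n * (2 * Lam) * M)) := by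
  obtain ⟨A, hA, hAv⟩ := hL
  refine ⟨A, hA, ?_⟩
  have hψ : ContDiffAt ℝ 2 ψ x := h.contDiff.contDiffAt
  rw [hess_add (contDiffAt_const.mul hv) (contDiffAt_const.mul hψ), hess_const_mul hv,
    hess_const_mul hψ, trB_add, trB_smul, trB_smul]
  have h1 : |trB A (hess ψ x)| ≤ n * n * (2 * Lam) * M :=
    (abs_trB_le (fun i j => hA.abs_apply_le hlam.le i j) _).trans (by
      have := h.hess_le x hx
      gcongr)
  have h2 : s * trB A (hess v x) ≤ C₀ := by
    refine (le_abs_self _).trans ?_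
    rw [abs_mul]
    calc _ ≤ 1 * |trB A (hess v x)| := by gcongr
      _ ≤ C₀ := by linarith
  have h3 : t * trB A (hess ψ x) ≤ M₁ * (n * n * (2 * Lam) * M) := by
    refine (le_abs_self _).trans ?_
    rw [abs_mul]
    exact mul_le_mul ht h1 (abs_nonneg _) ((abs_nonneg _).trans ht)
  linarith

/-- Hölder continuity at the boundary of the quotient of a solution by the defining function. -/
theorem exists_boundary_quotient_holder {lam Lam C₀ M₁ : ℝ} (hlam : 0 < lam) (hLam : 0 ≤ Lam)
    (hΩ : IsOpen Ω) (h : Chart Ω p ρ M ψ) {v : Eu n → ℝ} (hC₀ : 0 ≤ C₀) (hM₁ : 0 ≤ M₁)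
    (hv : ContDiffOn ℝ 2 v (Ω ∩ ball p ρ)) (hvψ : ∀ x ∈ Ω ∩ ball p ρ, |v x| ≤ M₁ * ψ x)
    (hL : ∀ x ∈ Ω ∩ ball p ρ, ∃ A, Ell lam Lam A ∧ |trB A (hess v x)| ≤ C₀) :
    ∃ α ∈ Ioo (0 : ℝ) 1, ∃ C > 0, ∃ r₀ > 0, r₀ ≤ ρ / 2 ∧ ∀ x₀ ∈ ball p (ρ / 2), ψ x₀ = 0 →
      ∀ r, 0 < r → r ≤ r₀ → ∀ x ∈ Ω ∩ closedBall x₀ r, ∀ y ∈ Ω ∩ closedBall x₀ r,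
        |v x / ψ x - v y / ψ y| ≤ C * r ^ α := by
  obtain ⟨c, ⟨hc0, hc1⟩, δ, hδ, hgrow⟩ := exists_boundary_growth n hlam hLam
  obtain ⟨α, hα, C, hC, hdec⟩ := exists_decay (θ := 1 - c) (q := 1000) (by linarith) (by linarith)
    (by norm_num)
  have hM := h.one_le
  have hρ := h.pos
  set r₀ := min (ρ / 2) (1 / M) with hr₀
  have hr₀0 : 0 < r₀ := by positivity
  have hr₀ρ : r₀ ≤ ρ / 2 := min_le_left _ _
  set C₃ := C₀ + M₁ * (n * n * (2 * Lam) * M) with hC₃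
  have hC₃0 : 0 ≤ C₃ := by positivity
  set B := C₃ * r₀ / δ with hB
  have hB0 : 0 ≤ B := by positivity
  refine ⟨α, hα, C * (2 * M₁ + B) / r₀ ^ α + 1, by positivity, r₀, hr₀0, hr₀ρ, ?_⟩
  intro x₀ hx₀ hψ₀ r hr hrr₀ x hx y hy
  let g : Eu n → ℝ := fun x => v x / ψ x
  have hpos : ∀ x ∈ Ω ∩ ball p ρ, 0 < ψ x := fun x hx => (h.mem_iff x hx.2).1 hx.1
  have hsub : ∀ s ≤ r₀, Ω ∩ closedBall x₀ s ⊆ Ω ∩ ball p ρ := fun s hs =>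
    inter_subset_inter_right _ (closedBall_subset_ball_of_mem_half hx₀ (hs.trans hr₀ρ))
  have hg : ∀ x ∈ Ω ∩ ball p ρ, |g x| ≤ M₁ := fun x hx => by
    rw [abs_div, abs_of_pos (hpos x hx), div_le_iff₀ (hpos x hx)]
    exact hvψ x hx
  have hne : ∀ s, 0 < s → s ≤ r₀ → (Ω ∩ closedBall x₀ s).Nonempty := fun s hs hs' =>
    ⟨_, h.add_smul_mem hx₀ hψ₀.ge hs (hs'.trans hr₀ρ)⟩
  have hdecay := hdec (fun s => oscOn g (Ω ∩ closedBall x₀ s)) (2 * M₁) B r₀ hr₀0 (by positivity) hB0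
    (fun s t hs hst ht => oscOn_mono (hne s hs (hst.trans ht))
      (inter_subset_inter_right _ (closedBall_subset_closedBall hst))
      fun x hx => hg x (hsub t ht hx))
    (oscOn_le (hne r₀ hr₀0 le_rfl) fun x hx y hy => by
      linarith [(abs_le.1 (hg x (hsub r₀ le_rfl hx))).2, (abs_le.1 (hg y (hsub r₀ le_rfl hy))).1])
    (by
      intro s hs hsr₀
      set P := Ω ∩ closedBall x₀ s with hP
      set P' := Ω ∩ closedBall x₀ (s / 1000) with hP'
      have hPP : P' ⊆ P := inter_subset_inter_right _ (closedBall_subset_closedBall (by linarith))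
      have hPne' : P'.Nonempty := hne _ (by linarith) (by linarith)
      have hPne : P.Nonempty := hPne'.mono hPP
      have hgP : ∀ x ∈ P, |g x| ≤ M₁ := fun x hx => hg x (hsub s hsr₀ hx)
      set T := supOn g P with hT
      set m := -supOn (-g) P with hm
      set N := oscOn g P with hN
      have hNTm : N = T - m := by rw [hN, hT, hm, oscOn]; ring
      have hN0 : 0 ≤ N := oscOn_nonneg hPne hgP
      have hgT : ∀ x ∈ P, g x ≤ T := fun x hx => le_supOn hgP hx
      have hmg : ∀ x ∈ P, m ≤ g x := fun x hx => by
        have := le_supOn (bound_neg hgP) hx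
        rw [Pi.neg_apply] at this
        rw [hm]
        linarith
      have hTb : |T| ≤ M₁ := by
        obtain ⟨x, hx⟩ := hPne
        rw [abs_le]
        exact ⟨by linarith [hgT x hx, (abs_le.1 (hgP x hx)).1],
          supOn_le ⟨x, hx⟩ fun y hy => (abs_le.1 (hgP y hy)).2⟩
      have hmb : |m| ≤ M₁ := by
        obtain ⟨x, hx⟩ := hPne
        have := supOn_le ⟨x, hx⟩ fun y hy => (abs_le.1 (bound_neg hgP y hy)).2
        rw [abs_le]
        exact ⟨by rw [hm]; linarith, by linarith [hmg x hx, (abs_le.1 (hgP x hx)).2]⟩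
      have hmono : oscOn g P' ≤ N := oscOn_mono hPne' hPP hgP
      have hBs : B * (s / r₀) = C₃ * s / δ := by rw [hB]; field_simp
      rw [hBs]
      by_cases hcase : N ≤ C₃ * s / δ
      · have : c * N ≤ 1 * N := by gcongr
        linarith
      push Not at hcase
      have hNpos : 0 < N := lt_of_le_of_lt (by positivity) hcase
      have hCδ : C₃ ≤ δ * N / s := by
        rw [le_div_iff₀ hs]
        rw [div_lt_iff₀ hδ] at hcase
        linarith
      have hMs : M * s ≤ 1 := by
        have : s ≤ 1 / M := hsr₀.trans (min_le_right _ _)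
        rw [le_div_iff₀ (by linarith)] at this
        linarith
      have hUopen : IsOpen (Ω ∩ ball p ρ) := hΩ.inter isOpen_ball
      have hcd : ∀ a b : ℝ, ContDiffOn ℝ 2 (fun x => a * v x + b * ψ x) (Ω ∩ ball p ρ) := fun a b =>
        (contDiffOn_const.mul hv).add (contDiffOn_const.mul h.contDiff.contDiffOn)
      have hsup : ∀ a b : ℝ, |a| ≤ 1 → |b| ≤ M₁ → ∀ x ∈ P, SuperAt lam Lam
          (hess (fun x => a * v x + b * ψ x) x) (δ * N / s) := fun a b ha hb x hx =>
        (trB_hess_lin_comb_le h hlam hLam (hsub s hsr₀ hx).2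
          (hv.contDiffAt (hUopen.mem_nhds (hsub s hsr₀ hx))) (hL x (hsub s hsr₀ hx)) ha hb).mono hCδ
      have hdiv : ∀ x ∈ P, v x = g x * ψ x := fun x hx =>
        (div_mul_cancel₀ _ (hpos x (hsub s hsr₀ hx)).ne').symm
      have hcov : closedBall (x₀ + (s / 8) • unitNormal ψ p) (s / 64) ⊆
          {x | N * s / 80 < 1 * v x + (-m) * ψ x} ∪ {x | N * s / 80 < (-1) * v x + T * ψ x} := by
        intro y hy
        have hyx : y ∈ closedBall x₀ s := by
          have h1 := mem_closedBall_iff_norm.1 hy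
          have h2 : y - x₀ = (y - (x₀ + (s / 8) • unitNormal ψ p)) + (s / 8) • unitNormal ψ p := by
            abel
          have h3 := norm_add_le (y - (x₀ + (s / 8) • unitNormal ψ p)) ((s / 8) • unitNormal ψ p)
          rw [norm_smul, h.norm_unitNormal h.center_mem, mul_one, Real.norm_eq_abs,
            abs_of_pos (by linarith : 0 < s / 8)] at h3
          rw [mem_closedBall_iff_norm, h2]
          linarith
        have h1 := h.mul_le_of_mem_closedBall
          (closedBall_subset_ball_of_mem_half hx₀ (hsr₀.trans hr₀ρ)
            (mem_closedBall_self hs.le)) hψ₀.ge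
          (R := s / 8) (by linarith) (closedBall_subset_ball_of_mem_half hx₀ (hsr₀.trans hr₀ρ) hyx)
          (closedBall_subset_closedBall (by linarith) hy)
        by_contra hcon
        rw [mem_union, not_or] at hcon
        have h5 : ¬ (N * s / 80 < 1 * v y + (-m) * ψ y) := hcon.1
        have h6 : ¬ (N * s / 80 < (-1) * v y + T * ψ y) := hcon.2
        have h7 : N * (2 / 5 * (s / 8)) ≤ N * ψ y := by gcongr
        rw [hNTm] at h5 h6 h7
        have h8 : 0 < (T - m) * s := by rw [← hNTm]; positivity
        nlinarith
      have hres : (∀ x ∈ P', m + c * N ≤ g x) ∨ (∀ x ∈ P', g x ≤ T - c * N) := by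
        rcases half_volume_le_or hcov with hvol | hvol
        · left
          intro x hx
          have hψx := hpos x (hsub s hsr₀ (hPP hx))
          have := hgrow Ω p ρ M ψ hΩ h x₀ s N _ hx₀ hψ₀ hs (hsr₀.trans hr₀ρ) hMs hNpos (hcd 1 (-m))
            (fun x hx => by
              rw [hdiv x hx]
              nlinarith [hmg x hx, hpos x (hsub s hsr₀ hx)])
            (hsup 1 (-m) (by simp) (by rwa [abs_neg])) hvol x hx
          rw [hdiv x (hPP hx)] at this
          refine le_of_mul_le_mul_right ?_ hψx
          linarith
        · right
          intro x hx
          have hψx := hpos x (hsub s hsr₀ (hPP hx))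
          have := hgrow Ω p ρ M ψ hΩ h x₀ s N _ hx₀ hψ₀ hs (hsr₀.trans hr₀ρ) hMs hNpos (hcd (-1) T)
            (fun x hx => by
              rw [hdiv x hx]
              nlinarith [hgT x hx, hpos x (hsub s hsr₀ hx)])
            (hsup (-1) T (by simp) hTb) hvol x hx
          rw [hdiv x (hPP hx)] at this
          refine le_of_mul_le_mul_right ?_ hψx
          linarith
      have h0 : 0 ≤ C₃ * s / δ := by positivity
      refine (oscOn_le (a := (1 - c) * N) hPne' fun x hx y hy => ?_).trans (by linarith)
      rcases hres with hres | hres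
      · linarith [hgT x (hPP hx), hres y hy]
      · linarith [hmg y (hPP hy), hres x hx])
  have hω := hdecay r hr hrr₀
  have hgr : ∀ x ∈ Ω ∩ closedBall x₀ r, |g x| ≤ M₁ := fun x hx => hg x (hsub r hrr₀ hx)
  have h1 := (sub_le_oscOn hgr hx hy).trans hω
  have h2 := (sub_le_oscOn hgr hy hx).trans hω
  have h3 : C * (2 * M₁ + B) * (r / r₀) ^ α ≤ (C * (2 * M₁ + B) / r₀ ^ α + 1) * r ^ α := by
    rw [Real.div_rpow hr.le hr₀0.le]
    have : 0 ≤ r ^ α := by positivity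
    have e : C * (2 * M₁ + B) * (r ^ α / r₀ ^ α) = C * (2 * M₁ + B) / r₀ ^ α * r ^ α := by ring
    rw [e]
    linarith
  refine (abs_le.2 ⟨?_, ?_⟩).trans h3
  · change _ ≤ g x - g y
    linarith
  · exact h1

end BoundaryQuotient

section BoundaryData

open Metric

namespace Chart

variable {n : ℕ} {Ω : Set (Eu n)} {p : Eu n} {ρ M : ℝ} {ψ : Eu n → ℝ}

lemma le_sub_of_le (h : Chart Ω p ρ M ψ) {x k : Eu n} {t : ℝ} (hx : x ∈ ball p ρ)
    (hy : x + (t • unitNormal ψ p + k) ∈ ball p ρ) :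
    t - 1 / 100 * |t| - 101 / 100 * ‖k‖ ≤ ψ (x + (t • unitNormal ψ p + k)) - ψ x := by
  have h1 := h.abs_sub_sub_le hx hy
  have h2 : ‖t • unitNormal ψ p + k‖ ≤ |t| + ‖k‖ := by
    refine (norm_add_le _ _).trans (le_of_eq ?_)
    rw [norm_smul, h.norm_unitNormal h.center_mem, mul_one, Real.norm_eq_abs]
  have h3 : |fderiv ℝ ψ p k| ≤ ‖k‖ := by
    have := (fderiv ℝ ψ p).le_opNorm k
    rwa [h.norm_fderiv, one_mul] at this
  rw [add_sub_cancel_left, map_add, map_smul, h.fderiv_center_unitNormal, smul_eq_mul,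
    mul_one] at h1
  have h4 := (abs_le.1 h1).1
  have h5 := (abs_le.1 h3).1
  linarith

lemma exists_foot (h : Chart Ω p ρ M ψ) (hp : ψ p = 0) {x : Eu n} (hx : x ∈ ball p (ρ / 8))
    (hψ : 0 < ψ x) :
    ∃ t, 0 < t ∧ t ≤ 101 / 99 * ψ x ∧ x - t • unitNormal ψ p ∈ ball p (ρ / 2) ∧
      ψ (x - t • unitNormal ψ p) = 0 ∧
      ∀ s ∈ Ico 0 t, x - s • unitNormal ψ p ∈ Ω ∩ ball p ρ := by
  have hρ := h.pos
  rw [mem_ball_iff_norm] at hx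
  have hxρ : x ∈ ball p ρ := by rw [mem_ball_iff_norm]; linarith
  have hψx : ψ x ≤ 101 / 800 * ρ := by
    have := (abs_le.1 (h.abs_sub_le h.center_mem hxρ)).2
    rw [hp] at this
    linarith
  have hmem : ∀ s, 0 ≤ s → s ≤ 101 / 99 * ψ x → x - s • unitNormal ψ p ∈ ball p (ρ / 2) := by
    intro s hs0 hs
    rw [mem_ball_iff_norm]
    have e : x - s • unitNormal ψ p - p = (x - p) - s • unitNormal ψ p := by abel
    rw [e]
    refine (norm_sub_le _ _).trans_lt ?_
    rw [norm_smul, h.norm_unitNormal h.center_mem, mul_one, Real.norm_eq_abs, abs_of_nonneg hs0]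
    linarith
  have hball : ball p (ρ / 2) ⊆ ball p ρ := ball_subset_ball (by linarith)
  have hcont : ContinuousOn (fun s : ℝ => ψ (x - s • unitNormal ψ p)) (Icc 0 (101 / 99 * ψ x)) := by
    have := h.contDiff.continuous
    fun_prop
  have hdec : ∀ s t, 0 ≤ s → s ≤ t → t ≤ 101 / 99 * ψ x →
      99 / 100 * (t - s) ≤ ψ (x - s • unitNormal ψ p) - ψ (x - t • unitNormal ψ p) := by
    intro s t hs hst ht
    have e : x - s • unitNormal ψ p
        = (x - t • unitNormal ψ p) + ((t - s) • unitNormal ψ p + 0) := by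
      rw [sub_smul]; abel
    have := h.le_sub_of_le (x := x - t • unitNormal ψ p) (k := 0) (t := t - s)
      (hball (hmem t (hs.trans hst) ht)) (by rw [← e]; exact hball (hmem s hs (hst.trans ht)))
    rw [← e, norm_zero, abs_of_nonneg (by linarith)] at this
    linarith
  have hlast : ψ (x - (101 / 99 * ψ x) • unitNormal ψ p) ≤ 0 := by
    have := hdec 0 (101 / 99 * ψ x) le_rfl (by positivity) le_rfl
    simp only [zero_smul, sub_zero] at this
    linarith
  obtain ⟨t, ht, ht0⟩ := intermediate_value_Icc' (by positivity) hcont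
    (show (0 : ℝ) ∈ Icc _ _ from ⟨hlast, by simpa using hψ.le⟩)
  have ht0' : ψ (x - t • unitNormal ψ p) = 0 := ht0
  have htpos : 0 < t := by
    rcases ht.1.eq_or_lt with h0 | h0
    · rw [← h0, zero_smul, sub_zero] at ht0'
      linarith
    · exact h0
  refine ⟨t, htpos, ht.2, hmem t ht.1 ht.2, ht0', fun s hs => ?_⟩
  have hsm := hball (hmem s hs.1 (hs.2.le.trans ht.2))
  refine ⟨(h.mem_iff _ hsm).2 ?_, hsm⟩
  have := hdec s t hs.1 hs.2.le ht.2
  rw [ht0'] at this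
  nlinarith [hs.2]

lemma abs_le_mul (h : Chart Ω p ρ M ψ) (hp : ψ p = 0) {v : Eu n → ℝ} {K : ℝ}
    (hK : 0 ≤ K)
    (hv : ContinuousOn v (closure Ω)) (hv0 : ∀ x ∈ frontier Ω, v x = 0)
    (hdiff : ∀ x ∈ Ω ∩ ball p ρ, DifferentiableAt ℝ v x)
    (hder : ∀ x ∈ Ω ∩ ball p ρ, ‖fderiv ℝ v x‖ ≤ K) {x : Eu n}
    (hx : x ∈ Ω ∩ ball p (ρ / 8)) : |v x| ≤ 2 * K * ψ x := by
  have hρ := h.pos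
  have hψ : 0 < ψ x := (h.mem_iff x (ball_subset_ball (by linarith) hx.2)).1 hx.1
  obtain ⟨t, ht, htψ, htm, ht0, hs⟩ := h.exists_foot hp hx.2 hψ
  have htf : x - t • unitNormal ψ p ∈ frontier Ω :=
    (h.frontier_iff _ (ball_subset_ball (by linarith) htm)).2 ht0
  have hcl : ∀ s ∈ Icc 0 t, x - s • unitNormal ψ p ∈ closure Ω := by
    intro s hst
    rcases hst.2.eq_or_lt with h1 | h1
    · rw [h1]; exact frontier_subset_closure htf
    · exact subset_closure (hs s ⟨hst.1, h1⟩).1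
  have hd : ∀ s ∈ Ico 0 t, HasDerivWithinAt (fun s : ℝ => v (x - s • unitNormal ψ p))
      (fderiv ℝ v (x - s • unitNormal ψ p) (-unitNormal ψ p)) (Ici s) s := by
    intro s hst
    have h1 := (hdiff _ (hs s hst)).hasFDerivAt
    have h2 : HasDerivAt (fun s : ℝ => x - s • unitNormal ψ p) (-unitNormal ψ p) s := by
      simpa using ((hasDerivAt_id s).smul_const (unitNormal ψ p)).const_sub x
    exact (h1.comp_hasDerivAt s h2).hasDerivWithinAt
  have hc : ContinuousOn (fun s : ℝ => v (x - s • unitNormal ψ p)) (Icc 0 t) :=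
    hv.comp (by fun_prop) hcl
  have := norm_image_sub_le_of_norm_deriv_right_le_segment hc hd (C := K) (fun s hst => by
    refine ((fderiv ℝ v _).le_opNorm _).trans ?_
    rw [norm_neg, h.norm_unitNormal h.center_mem, mul_one]
    exact hder _ (hs s hst)) t ⟨ht.le, le_rfl⟩
  simp only [zero_smul, sub_zero, hv0 _ htf, zero_sub, norm_neg, Real.norm_eq_abs] at this
  nlinarith

lemma segment_subset (h : Chart Ω p ρ M ψ) {x y : Eu n} (hx : x ∈ Ω ∩ ball p (ρ / 8))
    (hy : y ∈ Ω ∩ ball p (ρ / 8)) :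
    segment ℝ x (x + (2 * ‖y - x‖) • unitNormal ψ p) ⊆ Ω ∩ ball p ρ ∧
    segment ℝ (x + (2 * ‖y - x‖) • unitNormal ψ p) (y + (2 * ‖y - x‖) • unitNormal ψ p)
      ⊆ Ω ∩ ball p ρ := by
  have hρ := h.pos
  have hxb := hx.2
  have hyb := hy.2
  rw [mem_ball_iff_norm] at hxb hyb
  have hxρ : x ∈ ball p ρ := by rw [mem_ball_iff_norm]; linarith
  have hψ : 0 < ψ x := (h.mem_iff x hxρ).1 hx.1
  have hδ : ‖y - x‖ < ρ / 4 := by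
    have : y - x = (y - p) - (x - p) := by abel
    rw [this]
    exact (norm_sub_le _ _).trans_lt (by linarith)
  have key : ∀ (t : ℝ) (k : Eu n), 0 ≤ t → t ≤ 2 * ‖y - x‖ → 2 * ‖k‖ ≤ t → ‖k‖ ≤ ‖y - x‖ →
      x + (t • unitNormal ψ p + k) ∈ Ω ∩ ball p ρ := by
    intro t k ht0 ht hk hk'
    have hm : x + (t • unitNormal ψ p + k) ∈ ball p ρ := by
      rw [mem_ball_iff_norm]
      have e : x + (t • unitNormal ψ p + k) - p = (x - p) + (t • unitNormal ψ p + k) := by abel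
      rw [e]
      refine (norm_add_le _ _).trans_lt ?_
      have h2 : ‖t • unitNormal ψ p + k‖ ≤ t + ‖k‖ := by
        refine (norm_add_le _ _).trans (le_of_eq ?_)
        rw [norm_smul, h.norm_unitNormal h.center_mem, mul_one, Real.norm_eq_abs, abs_of_nonneg ht0]
      linarith
    refine ⟨(h.mem_iff _ hm).2 ?_, hm⟩
    have := h.le_sub_of_le hxρ hm
    rw [abs_of_nonneg ht0] at this
    linarith
  have hn := norm_nonneg (y - x)
  constructor
  · rw [segment_eq_image']
    rintro _ ⟨θ, hθ, rfl⟩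
    have := key (θ * (2 * ‖y - x‖)) 0 (mul_nonneg hθ.1 (by positivity))
      (mul_le_of_le_one_left (by positivity) hθ.2)
      (by rw [norm_zero, mul_zero]; exact mul_nonneg hθ.1 (by positivity)) (by simp)
    convert this using 1
    simp only [add_sub_cancel_left, smul_smul, add_zero]
  · rw [segment_eq_image']
    rintro _ ⟨θ, hθ, rfl⟩
    have hk : ‖θ • (y - x)‖ ≤ ‖y - x‖ := by
      rw [norm_smul, Real.norm_eq_abs, abs_of_nonneg hθ.1]
      exact mul_le_of_le_one_left hn hθ.2
    have := key (2 * ‖y - x‖) (θ • (y - x)) (by positivity) le_rfl (by linarith) hk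
    convert this using 1
    simp only [add_sub_add_right_eq_sub]
    abel

lemma norm_sub_le_of_norm_fderiv_le (h : Chart Ω p ρ M ψ) {E : Type*} [NormedAddCommGroup E]
    [NormedSpace ℝ E] {F : Eu n → E} {K : ℝ}
    (hdiff : ∀ x ∈ Ω ∩ ball p ρ, DifferentiableAt ℝ F x)
    (hder : ∀ x ∈ Ω ∩ ball p ρ, ‖fderiv ℝ F x‖ ≤ K) {x y : Eu n}
    (hx : x ∈ Ω ∩ ball p (ρ / 8)) (hy : y ∈ Ω ∩ ball p (ρ / 8)) :
    ‖F y - F x‖ ≤ 5 * K * ‖y - x‖ := by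
  obtain ⟨h1, h2⟩ := h.segment_subset hx hy
  have h3 := (h.segment_subset hy hx).1
  rw [norm_sub_rev x y] at h3
  have key : ∀ z w : Eu n, segment ℝ z w ⊆ Ω ∩ ball p ρ → ‖F w - F z‖ ≤ K * ‖w - z‖ :=
    fun z w hzw => (convex_segment z w).norm_image_sub_le_of_norm_fderiv_le
      (fun t ht => hdiff t (hzw ht)) (fun t ht => hder t (hzw ht))
      (left_mem_segment ℝ z w) (right_mem_segment ℝ z w)
  have k1 := key _ _ h1
  have k2 := key _ _ h2
  have k3 := key _ _ h3
  have hν : ‖(2 * ‖y - x‖) • unitNormal ψ p‖ = 2 * ‖y - x‖ := by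
    rw [norm_smul, h.norm_unitNormal h.center_mem, mul_one, norm_mul, norm_norm, Real.norm_ofNat]
  rw [add_sub_cancel_left, hν] at k1 k3
  rw [add_sub_add_right_eq_sub] at k2
  set z := x + (2 * ‖y - x‖) • unitNormal ψ p
  set w := y + (2 * ‖y - x‖) • unitNormal ψ p
  have e : F y - F x = (F z - F x) + (F w - F z) - (F w - F y) := by abel
  rw [e]
  refine (norm_sub_le _ _).trans ?_
  have := norm_add_le (F z - F x) (F w - F z)
  linarith

end Chart

end BoundaryData

section LocalHolder

open Metric

variable {n : ℕ} {Ω : Set (Eu n)} {p : Eu n} {ρ M : ℝ} {ψ : Eu n → ℝ}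

lemma norm_fderiv_le_of_abs_le {H : Eu n → ℝ} {x : Eu n} {s ε η : ℝ} (hs : 0 < s)
    (hdiff : ∀ y ∈ closedBall x s, DifferentiableAt ℝ H y)
    (hη : ∀ y ∈ closedBall x s, ‖fderiv ℝ H y - fderiv ℝ H x‖ ≤ η)
    (hε : ∀ y ∈ closedBall x s, |H y| ≤ ε) (hx : H x = 0) : ‖fderiv ℝ H x‖ ≤ ε / s + η := by
  have hxs : x ∈ closedBall x s := mem_closedBall_self hs.le
  have hε0 : 0 ≤ ε := (abs_nonneg _).trans (hε x hxs)
  have hη0 : 0 ≤ η := (norm_nonneg _).trans (hη x hxs)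
  refine ContinuousLinearMap.opNorm_le_of_unit_norm (by positivity) fun e he => ?_
  have hy : x + s • e ∈ closedBall x s := by
    rw [mem_closedBall_iff_norm, add_sub_cancel_left, norm_smul, he, mul_one, Real.norm_eq_abs,
      abs_of_pos hs]
  have h1 := (convex_closedBall x s).norm_image_sub_le_of_norm_hasFDerivWithin_le'
    (fun z hz => (hdiff z hz).hasFDerivAt.hasFDerivWithinAt) hη hxs hy
  rw [add_sub_cancel_left, hx, sub_zero, map_smul, norm_smul, he, mul_one, smul_eq_mul,
    Real.norm_eq_abs, Real.norm_eq_abs, abs_of_pos hs] at h1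
  have h2 := hε _ hy
  have h3 : s * |fderiv ℝ H x e| ≤ ε + η * s := by
    rw [← abs_of_pos hs, ← abs_mul, abs_of_pos hs]
    have := abs_sub_abs_le_abs_sub (s * fderiv ℝ H x e) (H (x + s • e))
    rw [abs_sub_comm] at h1
    linarith
  rw [Real.norm_eq_abs]
  calc |fderiv ℝ H x e| = s * |fderiv ℝ H x e| / s := by field_simp
    _ ≤ (ε + η * s) / s := by gcongr
    _ = ε / s + η := by field_simp

namespace Chart

lemma mono (h : Chart Ω p ρ M ψ) {r : ℝ} (hr : 0 < r) (hrρ : r ≤ ρ) : Chart Ω p r M ψ where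
  pos := hr
  one_le := h.one_le
  contDiff := h.contDiff
  norm_fderiv := h.norm_fderiv
  fderiv_sub_le x hx := h.fderiv_sub_le x (ball_subset_ball hrρ hx)
  hess_le x hx := h.hess_le x (ball_subset_ball hrρ hx)
  mem_iff x hx := h.mem_iff x (ball_subset_ball hrρ hx)
  frontier_iff x hx := h.frontier_iff x (ball_subset_ball hrρ hx)

lemma closedBall_half_subset (h : Chart Ω p ρ M ψ) (hp : ψ p = 0) {x : Eu n}
    (hx : x ∈ ball p (ρ / 8)) (hψ : 0 < ψ x) : closedBall x (ψ x / 2) ⊆ Ω ∩ ball p ρ := by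
  intro y hy
  have hρ := h.pos
  rw [mem_ball_iff_norm] at hx
  rw [mem_closedBall_iff_norm] at hy
  have hxρ : x ∈ ball p ρ := by rw [mem_ball_iff_norm]; linarith
  have h1 := (abs_le.1 (h.abs_sub_le h.center_mem hxρ)).2
  rw [hp] at h1
  have hyρ : y ∈ ball p ρ := by
    rw [mem_ball_iff_norm]
    have := norm_add_le (y - x) (x - p)
    rw [sub_add_sub_cancel] at this
    linarith
  refine ⟨(h.mem_iff y hyρ).2 ?_, hyρ⟩
  have h2 := (abs_le.1 (h.abs_sub_le hxρ hyρ)).1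
  linarith

lemma norm_fderiv_sub_sub_le (h : Chart Ω p ρ M ψ) {x : Eu n} {u φ : Eu n → ℝ}
    {g α β Cq Ci L M₁ : ℝ} (hα : α ∈ Ioo (0 : ℝ) 1) (hβ : β ∈ Ioo (0 : ℝ) 1)
    (hCq : 0 ≤ Cq) (hCi : 0 ≤ Ci) (hL : 0 ≤ L)
    (hxρ : x ∈ ball p ρ) (hψ : 0 < ψ x) (hψ1 : ψ x ≤ 1)
    (hsub : closedBall x (ψ x / 2) ⊆ Ω ∩ ball p ρ)
    (hu : ∀ y ∈ Ω, DifferentiableAt ℝ u y) (hφ : ∀ y ∈ Ω, DifferentiableAt ℝ φ y)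
    (hg : g = (u x - φ x) / ψ x) (hgM : |g| ≤ M₁)
    (hq : ∀ y ∈ closedBall x (ψ x / 2), |(u y - φ y) / ψ y - g| ≤ Cq * ψ x ^ α)
    (hi : ∀ y ∈ closedBall x (ψ x / 2),
      ‖fderiv ℝ u y - fderiv ℝ u x‖ ≤ Ci * (‖y - x‖ / (ψ x / 2)) ^ β)
    (hl : ∀ y ∈ closedBall x (ψ x / 2), ‖fderiv ℝ φ y - fderiv ℝ φ x‖ ≤ L * ‖y - x‖) :
    ‖fderiv ℝ u x - fderiv ℝ φ x - g • fderiv ℝ ψ x‖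
      ≤ (4 * Cq + Ci + L + M₁ * M) * ψ x ^ (α * β / 2) := by
  obtain ⟨hα0, hα1⟩ := hα
  obtain ⟨hβ0, hβ1⟩ := hβ
  have hM := h.one_le
  have hM₁ : 0 ≤ M₁ := (abs_nonneg _).trans hgM
  set d := ψ x with hd
  set s := d ^ (1 + α / 2) / 2 with hs
  have hs0 : 0 < s := by positivity
  have hpow : d ^ (1 + α / 2) = d * d ^ (α / 2) := by rw [Real.rpow_add hψ, Real.rpow_one]
  have hdα : d ^ (α / 2) ≤ 1 := Real.rpow_le_one hψ.le hψ1 (by positivity)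
  have hsd : s ≤ d / 2 := by
    rw [hs, hpow]
    have := mul_le_of_le_one_right hψ.le hdα
    linarith
  have hball : closedBall x s ⊆ closedBall x (d / 2) := closedBall_subset_closedBall hsd
  have hγ : d ^ (α / 2) ≤ d ^ (α * β / 2) :=
    Real.rpow_le_rpow_of_exponent_ge hψ hψ1 (by nlinarith)
  have hdγ : d ≤ d ^ (α * β / 2) := by
    conv_lhs => rw [← Real.rpow_one d]
    exact Real.rpow_le_rpow_of_exponent_ge hψ hψ1 (by nlinarith)
  have hH : ∀ y ∈ Ω, HasFDerivAt (fun y => u y - φ y - g * ψ y)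
      (fderiv ℝ u y - fderiv ℝ φ y - g • fderiv ℝ ψ y) y := fun y hy =>
    ((hu y hy).hasFDerivAt.sub (hφ y hy).hasFDerivAt).sub
      ((h.differentiable y).hasFDerivAt.const_mul g)
  have hxΩ : x ∈ Ω := (hsub (mem_closedBall_self (by positivity))).1
  have key := norm_fderiv_le_of_abs_le (H := fun y => u y - φ y - g * ψ y) (x := x) (s := s)
    (ε := 2 * Cq * d ^ α * d) (η := Ci * d ^ (α * β / 2) + (L + M₁ * M) * s) hs0
    (fun y hy => (hH y (hsub (hball hy)).1).differentiableAt)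
    (fun y hy => by
      have hys : ‖y - x‖ ≤ s := mem_closedBall_iff_norm.1 hy
      rw [(hH y (hsub (hball hy)).1).fderiv, (hH x hxΩ).fderiv]
      have e : fderiv ℝ u y - fderiv ℝ φ y - g • fderiv ℝ ψ y
          - (fderiv ℝ u x - fderiv ℝ φ x - g • fderiv ℝ ψ x)
          = (fderiv ℝ u y - fderiv ℝ u x) - (fderiv ℝ φ y - fderiv ℝ φ x)
            - g • (fderiv ℝ ψ y - fderiv ℝ ψ x) := by rw [smul_sub]; abel
      rw [e]
      have h1 : ‖fderiv ℝ u y - fderiv ℝ u x‖ ≤ Ci * d ^ (α * β / 2) := by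
        refine (hi y (hball hy)).trans ?_
        have : ‖y - x‖ / (d / 2) ≤ d ^ (α / 2) := by
          rw [div_le_iff₀ (by positivity)]
          refine hys.trans (le_of_eq ?_)
          rw [hs, hpow]; ring
        have h2 : (‖y - x‖ / (d / 2)) ^ β ≤ (d ^ (α / 2)) ^ β :=
          Real.rpow_le_rpow (by positivity) this hβ0.le
        rw [← Real.rpow_mul hψ.le, show α / 2 * β = α * β / 2 by ring] at h2
        gcongr
      have h2 : ‖fderiv ℝ φ y - fderiv ℝ φ x‖ ≤ L * s :=
        (hl y (hball hy)).trans (by gcongr)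
      have h3 : ‖g • (fderiv ℝ ψ y - fderiv ℝ ψ x)‖ ≤ M₁ * (M * s) := by
        rw [norm_smul, Real.norm_eq_abs]
        have := h.norm_fderiv_sub_le hxρ (hsub (hball hy)).2
        have : ‖fderiv ℝ ψ y - fderiv ℝ ψ x‖ ≤ M * s := this.trans (by gcongr)
        gcongr
      refine (norm_sub_le _ _).trans ?_
      have := norm_sub_le (fderiv ℝ u y - fderiv ℝ u x) (fderiv ℝ φ y - fderiv ℝ φ x)
      linarith)
    (fun y hy => by
      have hyb := (hsub (hball hy))
      have hψy : 0 < ψ y := (h.mem_iff y hyb.2).1 hyb.1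
      have hyd : ‖y - x‖ ≤ d / 2 := mem_closedBall_iff_norm.1 (hball hy)
      have h2 := (abs_le.1 (h.abs_sub_le hxρ hyb.2)).2
      have e : u y - φ y - g * ψ y = ((u y - φ y) / ψ y - g) * ψ y := by field_simp
      rw [e, abs_mul, abs_of_pos hψy]
      have h4 : ψ y ≤ 2 * d := by linarith
      calc _ ≤ (Cq * d ^ α) * (2 * d) := by
            gcongr
            exact hq y (hball hy)
        _ = _ := by ring)
    (by rw [hg]; field_simp; ring)
  rw [(hH x hxΩ).fderiv] at key
  refine key.trans ?_
  have e : 2 * Cq * d ^ α * d / s = 4 * Cq * d ^ (α / 2) := by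
    rw [hs, hpow, show α = α / 2 + α / 2 by ring, Real.rpow_add hψ]
    have : 0 < d ^ (α / 2) := by positivity
    rw [show (α / 2 + α / 2) / 2 = α / 2 by ring]
    field_simp
    ring
  rw [e]
  have h1 : (L + M₁ * M) * s ≤ (L + M₁ * M) * d ^ (α * β / 2) := by
    have : s ≤ d ^ (α * β / 2) := by linarith
    gcongr
  have h2 : 4 * Cq * d ^ (α / 2) ≤ 4 * Cq * d ^ (α * β / 2) := by gcongr
  linarith

end Chart


set_option maxHeartbeats 1000000 in
theorem exists_local_holder_of_mem_frontier (hn : 0 < n) {lam Lam K D C₀ Kφ : ℝ} (hlam : 0 < lam)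
    (hLam : 0 ≤ Lam) (hK : 0 ≤ K) (hD : 0 ≤ D) (hC₀ : 0 ≤ C₀) (hKφ : 0 ≤ Kφ) {u φ : Eu n → ℝ}
    {A : Eu n → Matrix (Fin n) (Fin n) ℝ} {f : Eu n → ℝ} (S : GradSys lam Lam K D Ω u A f)
    (h : Chart Ω p ρ M ψ) (hp : ψ p = 0) (hf : ∀ x ∈ Ω ∩ ball p ρ, |f x| ≤ C₀)
    (hφ : ContDiffOn ℝ 2 φ Ω) (hφ1 : ∀ x ∈ Ω ∩ ball p ρ, ‖fderiv ℝ φ x‖ ≤ Kφ)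
    (hφ2 : ∀ x ∈ Ω ∩ ball p ρ, ‖hess φ x‖ ≤ Kφ)
    (hv : ContinuousOn (fun x => u x - φ x) (closure Ω)) (hv0 : ∀ x ∈ frontier Ω, u x = φ x) :
    ∃ τ ∈ Ioo (0 : ℝ) 1, ∃ C > (0 : ℝ), ∃ r > (0 : ℝ), ∀ x ∈ Ω ∩ ball p r, ∀ y ∈ Ω ∩ ball p r,
      ‖fderiv ℝ u x - fderiv ℝ u y‖ ≤ C * ‖x - y‖ ^ τ := by
  have hρ := h.pos
  have hM := h.one_le
  have hφat : ∀ x ∈ Ω, ContDiffAt ℝ 2 φ x := fun x hx => hφ.contDiffAt (S.isOpen.mem_nhds hx)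
  have hud : ∀ x ∈ Ω, DifferentiableAt ℝ u x := fun x hx =>
    (S.contDiffAt hx).differentiableAt (by norm_num)
  have hφd : ∀ x ∈ Ω, DifferentiableAt ℝ φ x := fun x hx =>
    (hφat x hx).differentiableAt (by norm_num)
  set σ := ρ / 8 with hσ
  have hσ0 : 0 < σ := by positivity
  have h' : Chart Ω p σ M ψ := h.mono hσ0 (by linarith)
  have hσρ : ball p σ ⊆ ball p ρ := ball_subset_ball (by linarith)
  set M₁ := 2 * (K + Kφ) with hM₁
  have hM₁0 : 0 ≤ M₁ := by positivity
  have hvψ : ∀ x ∈ Ω ∩ ball p σ, |u x - φ x| ≤ M₁ * ψ x := fun x hx =>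
    h.abs_le_mul hp (K := K + Kφ) (by positivity) hv
      (fun x hx => sub_eq_zero.2 (hv0 x hx)) (fun x hx => (hud x hx.1).sub (hφd x hx.1))
      (fun x hx => by
        rw [fderiv_fun_sub (hud x hx.1) (hφd x hx.1)]
        exact (norm_sub_le _ _).trans (add_le_add (S.norm_fderiv_le x hx.1) (hφ1 x hx))) hx
  obtain ⟨α, hα, Cq, hCq, r₀, hr₀, hr₀σ, hquot⟩ := exists_boundary_quotient_holder hlam hLam
    S.isOpen h' (v := fun x => u x - φ x) (C₀ := C₀ + n * n * (2 * Lam) * Kφ) (by positivity) hM₁0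
    ((S.contDiffOn.sub hφ).mono inter_subset_left) hvψ
    (fun x hx => ⟨A x, S.ell x hx.1, by
      rw [hess_sub (S.contDiffAt hx.1) (hφat x hx.1), trB_sub]
      have e := S.eq_zero x hx.1
      have h1 : |trB (A x) (hess φ x)| ≤ n * n * (2 * Lam) * Kφ :=
        (abs_trB_le ((S.ell x hx.1).abs_apply_le hlam.le) _).trans
          (by gcongr; exact hφ2 x ⟨hx.1, hσρ hx.2⟩)
      have h2 := hf x ⟨hx.1, hσρ hx.2⟩
      rw [eq_neg_of_add_eq_zero_left e]
      refine (abs_sub _ _).trans ?_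
      rw [abs_neg]
      linarith⟩)
  obtain ⟨β, hβ, Ci, hCi, hinner⟩ := exists_interior_holder n hn hlam hLam hK hD
  set r := min (r₀ / 8) (1 / 8) with hr
  have hr0 : 0 < r := by positivity
  have hrr₀ : r ≤ r₀ / 8 := min_le_left _ _
  have hr1 : r ≤ 1 / 8 := min_le_right _ _
  set γ := α * β / 2 with hγ
  have hγ0 : 0 < γ := div_pos (mul_pos hα.1 hβ.1) two_pos
  have hγα : γ ≤ α := by nlinarith only [hγ, hα.1, hα.2, hβ.1, hβ.2]
  have hγβ : γ ≤ β := by nlinarith only [hγ, hα.1, hα.2, hβ.1, hβ.2]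
  set g : Eu n → ℝ := fun x => (u x - φ x) / ψ x with hg
  have hxσ : ∀ x ∈ ball p r, x ∈ ball p (σ / 8) := fun x hx =>
    ball_subset_ball (by linarith) hx
  have hxψ : ∀ x ∈ Ω ∩ ball p r, 0 < ψ x ∧ ψ x ≤ 2 * r := by
    intro x hx
    have hxr := mem_ball_iff_norm.1 hx.2
    have hxb : x ∈ ball p σ := ball_subset_ball (by linarith) hx.2
    refine ⟨(h'.mem_iff x hxb).1 hx.1, ?_⟩
    have h1 := (abs_le.1 (h'.abs_sub_le h'.center_mem hxb)).2
    rw [hp] at h1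
    linarith
  have hgM : ∀ x ∈ Ω ∩ ball p σ, |g x| ≤ M₁ := by
    intro x hx
    have hψ := (h'.mem_iff x hx.2).1 hx.1
    simp only [hg]
    rw [abs_div, abs_of_pos hψ, div_le_iff₀ hψ]
    exact hvψ x hx
  have hlip : ∀ x ∈ Ω ∩ ball p σ, ∀ y ∈ Ω ∩ ball p σ,
      ‖fderiv ℝ φ y - fderiv ℝ φ x‖ ≤ 5 * Kφ * ‖y - x‖ := fun x hx y hy =>
    h.norm_sub_le_of_norm_fderiv_le (fun z hz => (hφat z hz.1).differentiableAt_fderiv) hφ2 hx hy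
  have hinterior : ∀ x ∈ Ω ∩ ball p r, ∀ y ∈ closedBall x (ψ x / 2),
      ‖fderiv ℝ u y - fderiv ℝ u x‖ ≤ Ci * (‖y - x‖ / (ψ x / 2)) ^ β := by
    intro x hx y hy
    obtain ⟨h1, h2⟩ := hxψ x hx
    exact hinner Ω u A f S x (ψ x / 2) (by positivity) (by linarith)
      ((h'.closedBall_half_subset hp (hxσ x hx.2) h1).trans inter_subset_left) y hy
  have hgg : ∀ x ∈ Ω ∩ ball p r, ∀ y ∈ Ω, ‖y - x‖ + 2 * ψ x ≤ r₀ →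
      |g y - g x| ≤ Cq * (‖y - x‖ + 2 * ψ x) ^ α := by
    intro x hx y hy hle
    obtain ⟨h1, h2⟩ := hxψ x hx
    obtain ⟨t, ht, htψ, htm, ht0, -⟩ := h'.exists_foot hp (hxσ x hx.2) h1
    have e : ‖x - (x - t • unitNormal ψ p)‖ = t := by
      rw [sub_sub_cancel, norm_smul, h'.norm_unitNormal h'.center_mem, mul_one, Real.norm_eq_abs,
        abs_of_pos ht]
    have hyx := norm_nonneg (y - x)
    refine hquot _ htm ht0 (‖y - x‖ + 2 * ψ x) (by linarith) hle y ⟨hy, ?_⟩ x ⟨hx.1, ?_⟩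
    · rw [mem_closedBall_iff_norm]
      have := norm_add_le (y - x) (x - (x - t • unitNormal ψ p))
      rw [sub_add_sub_cancel] at this
      linarith
    · rw [mem_closedBall_iff_norm]
      linarith
  have hpt : ∀ x ∈ Ω ∩ ball p r, ‖fderiv ℝ u x - fderiv ℝ φ x - g x • fderiv ℝ ψ x‖
      ≤ (4 * (Cq * 4) + Ci + 5 * Kφ + M₁ * M) * ψ x ^ γ := by
    intro x hx
    obtain ⟨h1, h2⟩ := hxψ x hx
    have hsub := h'.closedBall_half_subset hp (hxσ x hx.2) h1
    have hxb : x ∈ ball p σ := ball_subset_ball (by linarith) hx.2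
    refine h'.norm_fderiv_sub_sub_le hα hβ (by positivity) hCi.le (by positivity) hxb h1
      (by linarith) hsub hud hφd rfl (hgM x ⟨hx.1, hxb⟩) (fun y hy => ?_)
      (hinterior x hx) (fun y hy => hlip x ⟨hx.1, hxb⟩ y (hsub hy))
    have hyd := mem_closedBall_iff_norm.1 hy
    refine (hgg x hx y (hsub hy).1 (by linarith)).trans ?_
    have h3 : (‖y - x‖ + 2 * ψ x) ^ α ≤ (4 * ψ x) ^ α :=
      Real.rpow_le_rpow (by positivity) (by linarith) hα.1.le
    rw [Real.mul_rpow (by norm_num) h1.le] at h3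
    have h4 : (4 : ℝ) ^ α ≤ 4 := by
      conv_rhs => rw [← Real.rpow_one 4]
      exact Real.rpow_le_rpow_of_exponent_le (by norm_num) hα.2.le
    have h5 : (0 : ℝ) ≤ ψ x ^ α := by positivity
    calc _ ≤ Cq * (4 ^ α * ψ x ^ α) := by gcongr
      _ ≤ Cq * (4 * ψ x ^ α) := by gcongr
      _ = _ := by ring
  set C₁ := 4 * (Cq * 4) + Ci + 5 * Kφ + M₁ * M with hC₁
  have hC₁0 : 0 ≤ C₁ := by positivity
  have hC₂ : 0 < 2 * Ci + 4 * C₁ + 5 * Kφ + 16 * Cq + M₁ * M := by positivity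
  refine ⟨γ / 2, ⟨by positivity, by linarith [hβ.2]⟩, _, hC₂, r, hr0, ?_⟩
  have key : ∀ x ∈ Ω ∩ ball p r, ∀ y ∈ Ω ∩ ball p r, ψ y ≤ ψ x →
      ‖fderiv ℝ u y - fderiv ℝ u x‖ ≤
        (2 * Ci + 4 * C₁ + 5 * Kφ + 16 * Cq + M₁ * M) * ‖y - x‖ ^ (γ / 2) := by
    intro x hx y hy hyx
    obtain ⟨hx0, hx2⟩ := hxψ x hx
    obtain ⟨hy0, hy2⟩ := hxψ y hy
    have hxb : x ∈ ball p σ := ball_subset_ball (by linarith) hx.2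
    have hyb : y ∈ ball p σ := ball_subset_ball (by linarith) hy.2
    set δ := ‖y - x‖ with hδ
    rcases (norm_nonneg (y - x)).eq_or_lt with h0 | h0
    · have : y = x := sub_eq_zero.1 (norm_eq_zero.1 h0.symm)
      rw [this, sub_self, norm_zero]
      positivity
    rw [← hδ] at h0
    have hδr : δ ≤ 2 * r := by
      have := norm_sub_le (y - p) (x - p)
      rw [sub_sub_sub_cancel_right] at this
      have h1 := mem_ball_iff_norm.1 hx.2
      have h2 := mem_ball_iff_norm.1 hy.2
      linarith
    have hδ1 : δ ≤ 1 := by linarith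
    have hw0 : 0 < δ ^ (1 / 2 : ℝ) := by positivity
    set w := δ ^ (1 / 2 : ℝ) with hw
    have hww : w * w = δ := by rw [hw, ← Real.rpow_add h0]; norm_num
    have hw1 : w ≤ 1 := Real.rpow_le_one h0.le hδ1 (by norm_num)
    have hwγ : δ ^ (γ / 2) = w ^ γ := by
      rw [hw, ← Real.rpow_mul h0.le]; congr 1; ring
    have hpow : ∀ (c e : ℝ), 1 ≤ c → γ ≤ e → e ≤ 1 → (c * w) ^ e ≤ c * w ^ γ := by
      intro c e hc he he1
      rw [Real.mul_rpow (by linarith) hw0.le]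
      have h1 : c ^ e ≤ c := by
        conv_rhs => rw [← Real.rpow_one c]
        exact Real.rpow_le_rpow_of_exponent_le hc he1
      have h2 : w ^ e ≤ w ^ γ := Real.rpow_le_rpow_of_exponent_ge hw0 hw1 he
      gcongr
    rw [hwγ]
    have hwγ0 : 0 < w ^ γ := by positivity
    rcases le_or_gt w (ψ x / 2) with hcase | hcase
    · have hδd : δ ≤ ψ x / 2 := by rw [← hww]; exact (mul_le_of_le_one_left hw0.le hw1).trans hcase
      refine (hinterior x hx y (mem_closedBall_iff_norm.2 hδd)).trans ?_
      have h1 : δ / (ψ x / 2) ≤ 1 * w := by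
        rw [div_le_iff₀ (by positivity), ← hww, one_mul]
        gcongr
      have h2 : (δ / (ψ x / 2)) ^ β ≤ (1 * w) ^ β :=
        Real.rpow_le_rpow (by positivity) h1 hβ.1.le
      have h3 := hpow 1 β le_rfl hγβ hβ.2.le
      have h4 : Ci * (δ / (ψ x / 2)) ^ β ≤ Ci * (1 * w ^ γ) := by
        gcongr
        exact h2.trans h3
      refine h4.trans ?_
      rw [one_mul]
      gcongr
      linarith [mul_nonneg hM₁0 (by linarith : 0 ≤ M)]
    · have hp1 : ∀ z ∈ Ω ∩ ball p r, ψ z ≤ ψ x →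
          ‖fderiv ℝ u z - fderiv ℝ φ z - g z • fderiv ℝ ψ z‖ ≤ C₁ * (2 * w ^ γ) := by
        intro z hz hzx
        refine (hpt z hz).trans ?_
        have h1 : ψ z ^ γ ≤ (2 * w) ^ γ :=
          Real.rpow_le_rpow (hxψ z hz).1.le (by linarith) hγ0.le
        have h2 := hpow 2 γ (by norm_num) le_rfl (by linarith [hβ.2])
        gcongr
        exact h1.trans h2
      have hx1 := hp1 x hx le_rfl
      have hy1 := hp1 y hy hyx
      have hφ3 : ‖fderiv ℝ φ y - fderiv ℝ φ x‖ ≤ 5 * Kφ * w ^ γ := by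
        refine (hlip x ⟨hx.1, hxb⟩ y ⟨hy.1, hyb⟩).trans ?_
        have := hpow 1 1 le_rfl (by linarith [hβ.2]) le_rfl
        rw [Real.rpow_one, one_mul, one_mul] at this
        have : δ ≤ w ^ γ := by rw [← hww]; exact (mul_le_of_le_one_left hw0.le hw1).trans this
        gcongr
      have hg3 : |g y - g x| ≤ Cq * (8 * w ^ γ) := by
        refine (hgg x hx y hy.1 (by linarith)).trans ?_
        have h1 : (‖y - x‖ + 2 * ψ x) ^ α ≤ (8 * w) ^ α := by
          refine Real.rpow_le_rpow (by positivity) ?_ hα.1.le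
          rw [← hδ, ← hww]
          linarith [mul_le_of_le_one_left hw0.le hw1]
        have h2 := hpow 8 α (by norm_num) hγα hα.2.le
        gcongr
        exact h1.trans h2
      have hψ3 : ‖fderiv ℝ ψ y - fderiv ℝ ψ x‖ ≤ M * w ^ γ := by
        refine (h'.norm_fderiv_sub_le hxb hyb).trans ?_
        have := hpow 1 1 le_rfl (by linarith [hβ.2]) le_rfl
        rw [Real.rpow_one, one_mul, one_mul] at this
        have : δ ≤ w ^ γ := by rw [← hww]; exact (mul_le_of_le_one_left hw0.le hw1).trans this
        gcongr
      have hgx := hgM x ⟨hx.1, hxb⟩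
      have e : fderiv ℝ u y - fderiv ℝ u x
          = (fderiv ℝ u y - fderiv ℝ φ y - g y • fderiv ℝ ψ y)
            - (fderiv ℝ u x - fderiv ℝ φ x - g x • fderiv ℝ ψ x)
            + (fderiv ℝ φ y - fderiv ℝ φ x) + (g y - g x) • fderiv ℝ ψ y
            + g x • (fderiv ℝ ψ y - fderiv ℝ ψ x) := by
        rw [sub_smul, smul_sub]; abel
      have n1 : ‖(g y - g x) • fderiv ℝ ψ y‖ ≤ Cq * (8 * w ^ γ) * (101 / 100) := by
        rw [norm_smul, Real.norm_eq_abs]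
        have := h'.norm_fderiv_le hyb
        gcongr
      have n2 : ‖g x • (fderiv ℝ ψ y - fderiv ℝ ψ x)‖ ≤ M₁ * (M * w ^ γ) := by
        rw [norm_smul, Real.norm_eq_abs]
        gcongr
      rw [e]
      refine (norm_add_le _ _).trans ((add_le_add ((norm_add_le _ _).trans (add_le_add
        ((norm_add_le _ _).trans (add_le_add ((norm_sub_le _ _).trans (add_le_add hy1 hx1)) hφ3))
        n1)) n2).trans ?_)
      have := mul_pos hCq hwγ0
      have := mul_pos hCi hwγ0
      linarith
  intro x hx y hy
  rcases le_total (ψ y) (ψ x) with hle | hle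
  · rw [norm_sub_rev, norm_sub_rev x y]
    exact key x hx y hy hle
  · exact key y hy x hx hle

end LocalHolder

section CompactBounds

open Metric

lemma IsCompact.exists_forall_inter_le {X : Type*} [TopologicalSpace X] {Z U : Set X} {F : X → ℝ}
    (hZ : IsCompact Z) (h : ∀ p ∈ Z, ∃ C, ∃ V ∈ 𝓝 p, ∀ x ∈ U ∩ V, F x ≤ C) :
    ∃ C, 0 ≤ C ∧ ∀ x ∈ U ∩ Z, F x ≤ C := by
  refine hZ.induction_on (p := fun s => ∃ C, 0 ≤ C ∧ ∀ x ∈ U ∩ s, F x ≤ C) ⟨0, le_rfl, by simp⟩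
    (fun s t hst ⟨C, hC, h⟩ => ⟨C, hC, fun x hx => h x ⟨hx.1, hst hx.2⟩⟩) ?_ ?_
  · rintro s t ⟨C, hC, h⟩ ⟨C', -, h'⟩
    refine ⟨max C C', hC.trans (le_max_left _ _), fun x hx => ?_⟩
    rcases hx.2 with hxs | hxt
    · exact (h x ⟨hx.1, hxs⟩).trans (le_max_left _ _)
    · exact (h' x ⟨hx.1, hxt⟩).trans (le_max_right _ _)
  · intro p hp
    obtain ⟨C, V, hV, hC⟩ := h p hp
    exact ⟨V, mem_nhdsWithin_of_mem_nhds hV, max C 0, le_max_right _ _,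
      fun x hx => (hC x hx).trans (le_max_left _ _)⟩

lemma ContinuousWithinAt.exists_norm_le {X G : Type*} [TopologicalSpace X]
    [SeminormedAddCommGroup G] {T : Set X} {g : X → G} {p : X} (hg : ContinuousWithinAt g T p) :
    ∃ V ∈ 𝓝 p, ∀ x ∈ T ∩ V, ‖g x‖ ≤ ‖g p‖ + 1 := by
  have h : ∀ᶠ x in 𝓝[T] p, ‖g x‖ < ‖g p‖ + 1 := hg.norm.eventually_lt_const (lt_add_one _)
  obtain ⟨V, hV, hpV, h⟩ := mem_nhdsWithin.1 h
  exact ⟨V, hV.mem_nhds hpV, fun x hx => (show ‖g x‖ < _ from h ⟨hx.2, hx.1⟩).le⟩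

variable {E F : Type*} [NormedAddCommGroup E] [NormedSpace ℝ E] [NormedAddCommGroup F]
  [NormedSpace ℝ F] {T U : Set E} {g : E → F} {p : E}

lemma ContDiffWithinAt.exists_fderiv_extension {m : WithTop ℕ∞} (hm : m ≠ ((⊤ : ℕ∞) : WithTop ℕ∞))
    (hg : ContDiffWithinAt ℝ (m + 1) g T p) (hp : p ∈ T) (hU : IsOpen U) (hUT : U ⊆ T) :
    ∃ g' : E → E →L[ℝ] F, ContDiffWithinAt ℝ m g' T p ∧
      ∃ V, IsOpen V ∧ p ∈ V ∧ ∀ x ∈ U ∩ V, HasFDerivAt g (g' x) x := by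
  obtain ⟨s, hs, -, -, g', hg', hgm⟩ := (contDiffWithinAt_succ_iff_hasFDerivWithinAt' hm).1 hg
  rw [insert_eq_of_mem hp] at hs
  obtain ⟨V, hV, hpV, hVs⟩ := mem_nhdsWithin.1 hs
  refine ⟨g', hgm, V, hV, hpV, fun x hx => ?_⟩
  exact (hg' x (hVs ⟨hx.2, hUT hx.1⟩)).hasFDerivAt
    (Filter.mem_of_superset (hU.mem_nhds hx.1) hUT)

lemma ContDiffWithinAt.exists_norm_fderiv_le (hg : ContDiffWithinAt ℝ 1 g T p) (hp : p ∈ T)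
    (hU : IsOpen U) (hUT : U ⊆ T) : ∃ C, ∃ V ∈ 𝓝 p, ∀ x ∈ U ∩ V, ‖fderiv ℝ g x‖ ≤ C := by
  obtain ⟨g', hg', V, hV, hpV, h⟩ := ContDiffWithinAt.exists_fderiv_extension (m := 0)
    (by simp) (by simpa using hg) hp hU hUT
  obtain ⟨W, hW, hb⟩ := hg'.continuousWithinAt.exists_norm_le
  refine ⟨‖g' p‖ + 1, V ∩ W, Filter.inter_mem (hV.mem_nhds hpV) hW, fun x hx => ?_⟩
  rw [(h x ⟨hx.1, hx.2.1⟩).fderiv]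
  exact hb x ⟨hUT hx.1, hx.2.2⟩

lemma ContDiffWithinAt.exists_norm_fderiv_fderiv_le (hg : ContDiffWithinAt ℝ 2 g T p) (hp : p ∈ T)
    (hU : IsOpen U) (hUT : U ⊆ T) :
    ∃ C, ∃ V ∈ 𝓝 p, ∀ x ∈ U ∩ V, ‖fderiv ℝ (fderiv ℝ g) x‖ ≤ C := by
  obtain ⟨g', hg', V, hV, hpV, h⟩ := ContDiffWithinAt.exists_fderiv_extension (m := 1)
    (by exact_mod_cast ENat.one_ne_top) (by rwa [one_add_one_eq_two]) hp hU hUT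
  obtain ⟨C, W, hW, hb⟩ := hg'.exists_norm_fderiv_le hp hU hUT
  refine ⟨C, V ∩ W, Filter.inter_mem (hV.mem_nhds hpV) hW, fun x hx => ?_⟩
  have e : fderiv ℝ g =ᶠ[𝓝 x] g' := by
    filter_upwards [(hU.inter hV).mem_nhds ⟨hx.1, hx.2.1⟩] with y hy
    exact (h y hy).fderiv
  rw [e.fderiv_eq]
  exact hb x ⟨hx.1, hx.2.2⟩

lemma ContDiffOn.exists_norm_fderiv_le {Z : Set E} (hg : ContDiffOn ℝ 1 g T) (hZ : IsCompact Z)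
    (hZT : Z ⊆ T) (hU : IsOpen U) (hUT : U ⊆ T) :
    ∃ C, 0 ≤ C ∧ ∀ x ∈ U ∩ Z, ‖fderiv ℝ g x‖ ≤ C :=
  hZ.exists_forall_inter_le fun p hp => (hg p (hZT hp)).exists_norm_fderiv_le (hZT hp) hU hUT

lemma ContDiffOn.exists_norm_fderiv_fderiv_le {Z : Set E} (hg : ContDiffOn ℝ 2 g T)
    (hZ : IsCompact Z) (hZT : Z ⊆ T) (hU : IsOpen U) (hUT : U ⊆ T) :
    ∃ C, 0 ≤ C ∧ ∀ x ∈ U ∩ Z, ‖fderiv ℝ (fderiv ℝ g) x‖ ≤ C :=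
  hZ.exists_forall_inter_le fun p hp =>
    (hg p (hZT hp)).exists_norm_fderiv_fderiv_le (hZT hp) hU hUT

end CompactBounds

section ChartExistence

open Metric

variable {n : ℕ}

lemma BoundaryCAt.exists_chart {Ω : Set (Eu n)} {p : Eu n} (hp : p ∈ frontier Ω)
    (h : BoundaryCAt 2 Ω p) : ∃ ρ M : ℝ, ∃ ψ : Eu n → ℝ, Chart Ω p ρ M ψ ∧ ψ p = 0 := by
  obtain ⟨f, s, hs, hps, hf, hdf, hfr, hin⟩ := h
  have hf2 : ContDiff ℝ 2 f := hf
  have hc : 0 < ‖fderiv ℝ f p‖ := norm_pos_iff.2 (hdf p hps)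
  set c := ‖fderiv ℝ f p‖⁻¹ with hcdef
  have hc0 : 0 < c := inv_pos.2 hc
  set ψ : Eu n → ℝ := fun x => -c * f x with hψ
  have hψ2 : ContDiff ℝ 2 ψ := contDiff_const.mul hf2
  have hfd : Differentiable ℝ f := hf2.differentiable (by norm_num)
  have hD : ∀ x, fderiv ℝ ψ x = -c • fderiv ℝ f x := fun x => fderiv_const_mul (hfd x) _
  have hD1 : Continuous (fderiv ℝ ψ) := hψ2.continuous_fderiv (by norm_num)
  have hD2 : Continuous (hess ψ) :=
    (hψ2.fderiv_right (m := 1) (by norm_num)).continuous_fderiv (by norm_num)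
  have e1 : ∀ᶠ x in 𝓝 p, ‖fderiv ℝ ψ x - fderiv ℝ ψ p‖ < 1 / 100 := by
    have : ContinuousAt (fun x => ‖fderiv ℝ ψ x - fderiv ℝ ψ p‖) p := by fun_prop
    exact this.eventually_lt_const (by simp)
  have e2 : ∀ᶠ x in 𝓝 p, ‖hess ψ x‖ < ‖hess ψ p‖ + 1 := by
    have : Continuous fun x => ‖hess ψ x‖ := (continuous_norm (E := Bil n)).comp hD2
    exact this.continuousAt.eventually_lt_const (lt_add_one _)
  obtain ⟨ρ, hρ, hb⟩ := Metric.eventually_nhds_iff_ball.1 (e1.and (e2.and (hs.mem_nhds hps)))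
  have hfr' : ∀ x ∈ s, (x ∈ frontier Ω ↔ f x = 0) := fun x hx => by
    have := Set.ext_iff.1 hfr x
    simpa [hx] using this
  have hin' : ∀ x ∈ s, (x ∈ Ω ↔ f x < 0) := fun x hx => by
    have := Set.ext_iff.1 hin x
    simpa [hx] using this
  refine ⟨ρ, ‖hess ψ p‖ + 1, ψ, ⟨hρ, by linarith [norm_nonneg (hess ψ p)], hψ2, ?_,
    fun x hx => (hb x hx).1.le, fun x hx => (hb x hx).2.1.le, fun x hx => ?_, fun x hx => ?_⟩, ?_⟩
  · rw [hD, norm_smul, norm_neg, Real.norm_eq_abs, abs_of_pos hc0, hcdef,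
      inv_mul_cancel₀ hc.ne']
  · rw [hin' x (hb x hx).2.2]
    simp only [hψ, neg_mul, Left.neg_pos_iff, mul_neg_iff, hc0, hc0.le, true_and, not_lt.2,
      false_and, or_false]
  · rw [hfr' x (hb x hx).2.2]
    simp [hψ, hc0.ne']
  · simp [hψ, (hfr' p hps).1 hp]

end ChartExistence

section Coefficients

open Metric

variable {n : ℕ}

lemma IsCompact.exists_ell {X : Type*} [TopologicalSpace X] {Z : Set X} (hZ : IsCompact Z)
    {a : Fin n → Fin n → X → ℝ} (ha : ∀ i j, ContinuousOn (a i j) Z)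
    (hsym : ∀ i j, ∀ z ∈ Z, a i j z = a j i z)
    (hpos : ∀ z ∈ Z, ∀ ξ : Eu n, ξ ≠ 0 → 0 < ∑ i, ∑ j, a i j z * ξ i * ξ j) :
    ∃ lam > (0 : ℝ), ∃ Lam ≥ (0 : ℝ), ∀ z ∈ Z, Ell lam Lam (Matrix.of fun i j => a i j z) := by
  have hcomp : IsCompact (Z ×ˢ sphere (0 : Eu n) 1) := hZ.prod (isCompact_sphere _ _)
  have hcont : ContinuousOn (fun q : X × Eu n => ∑ i, ∑ j, a i j q.1 * q.2 i * q.2 j)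
      (Z ×ˢ sphere (0 : Eu n) 1) := by
    refine continuousOn_finsetSum _ fun i _ => continuousOn_finsetSum _ fun j _ => ?_
    refine ContinuousOn.mul (ContinuousOn.mul ?_ ?_) ?_
    · exact (ha i j).comp continuousOn_fst fun q hq => hq.1
    · fun_prop
    · fun_prop
  obtain ⟨lam, hlam, hl⟩ := hcomp.exists_forall_le' hcont (a := 0) (fun q hq => hpos q.1 hq.1 q.2
    (by
      intro h0
      have := mem_sphere_zero_iff_norm.1 hq.2
      rw [h0, norm_zero] at this
      exact zero_ne_one this))
  obtain ⟨Lam, hL⟩ := hcomp.bddAbove_image hcont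
  have hom : ∀ z (ξ : Eu n), ∑ i, ∑ j, a i j z * ξ i * ξ j
      = ‖ξ‖ ^ 2 * ∑ i, ∑ j, a i j z * (‖ξ‖⁻¹ • ξ) i * (‖ξ‖⁻¹ • ξ) j := by
    intro z ξ
    rcases eq_or_ne ξ 0 with h0 | h0
    · simp [h0]
    · have hξ : ‖ξ‖ ≠ 0 := norm_ne_zero_iff.2 h0
      simp only [Finset.mul_sum, PiLp.smul_apply, smul_eq_mul]
      refine Finset.sum_congr rfl fun i _ => Finset.sum_congr rfl fun j _ => ?_
      field_simp
  have hsph : ∀ ξ : Eu n, ξ ≠ 0 → ‖ξ‖⁻¹ • ξ ∈ sphere (0 : Eu n) 1 := by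
    intro ξ h0
    rw [mem_sphere_zero_iff_norm, norm_smul, norm_inv, norm_norm,
      inv_mul_cancel₀ (norm_ne_zero_iff.2 h0)]
  refine ⟨lam, hlam, max Lam 0, le_max_right _ _, fun z hz => ⟨fun i j => ?_, fun ξ => ?_,
    fun ξ => ?_⟩⟩
  · exact hsym i j z hz
  · simp only [Matrix.of_apply]
    rcases eq_or_ne ξ 0 with h0 | h0
    · simp [h0]
    · rw [hom, mul_comm]
      gcongr
      exact hl (z, ‖ξ‖⁻¹ • ξ) ⟨hz, hsph ξ h0⟩
  · simp only [Matrix.of_apply]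
    rcases eq_or_ne ξ 0 with h0 | h0
    · simp [h0]
    · rw [hom, mul_comm _ (‖ξ‖ ^ 2)]
      gcongr
      exact (hL ⟨(z, ‖ξ‖⁻¹ • ξ), ⟨hz, hsph ξ h0⟩, rfl⟩).trans (le_max_left _ _)

/-- The one-jet `x ↦ (x, u x, Du x)` of a function. -/
noncomputable def jet (u : Eu n → ℝ) (x : Eu n) : Eu n × ℝ × Eu n := (x, u x, gradE u x)

lemma contDiffOn_jet {Ω : Set (Eu n)} (hΩ : IsOpen Ω) {u : Eu n → ℝ} (hu : ContDiffOn ℝ 2 u Ω) :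
    ContDiffOn ℝ 1 (jet u) Ω := by
  refine contDiffOn_id.prodMk ((hu.of_le (by norm_num)).prodMk ?_)
  exact (gradL n).contDiff.comp_contDiffOn (hu.fderiv_of_isOpen hΩ (by norm_num))

lemma norm_fderiv_jet_le {u : Eu n → ℝ} {x : Eu n} (hu : ContDiffAt ℝ 2 u x) (v : Eu n) :
    ‖fderiv ℝ (jet u) x v‖ ≤ (1 + ‖fderiv ℝ u x‖) * (‖hess u x v‖ + ‖v‖) := by
  have h1 : HasFDerivAt u (fderiv ℝ u x) x := (hu.differentiableAt (by norm_num)).hasFDerivAt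
  have h2 : HasFDerivAt (gradE u) ((gradL n).comp (hess u x)) x :=
    (gradL n).hasFDerivAt.comp x hu.differentiableAt_fderiv.hasFDerivAt
  have h3 : HasFDerivAt (jet u) _ x := (hasFDerivAt_id x).prodMk (h1.prodMk h2)
  rw [h3.fderiv]
  have hv := norm_nonneg v
  have hh := norm_nonneg (hess u x v)
  have hk := norm_nonneg (fderiv ℝ u x)
  have h4 : ‖fderiv ℝ u x v‖ ≤ ‖fderiv ℝ u x‖ * ‖v‖ := (fderiv ℝ u x).le_opNorm v
  have h5 : ‖gradL n (hess u x v)‖ = ‖hess u x v‖ := norm_gradL _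
  change ‖(v, fderiv ℝ u x v, gradL n (hess u x v))‖ ≤ _
  rw [Prod.norm_mk, Prod.norm_mk, h5]
  refine max_le ?_ (max_le ?_ ?_)
  · nlinarith [mul_nonneg hk hv, mul_nonneg hk hh]
  · nlinarith [mul_nonneg hk hv, mul_nonneg hk hh]
  · nlinarith [mul_nonneg hk hv, mul_nonneg hk hh]

lemma exists_gradSys {Ω : Set (Eu n)} (hΩ : IsOpen Ω) (hΩb : Bornology.IsBounded Ω)
    {a : Fin n → Fin n → Eu n × ℝ × Eu n → ℝ} {b : Eu n × ℝ × Eu n → ℝ}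
    (ha : ∀ i j, ContDiffOn ℝ 1 (a i j) (closure Ω ×ˢ (univ : Set (ℝ × Eu n))))
    (hb : ContDiffOn ℝ 1 b (closure Ω ×ˢ (univ : Set (ℝ × Eu n))))
    (hsym : ∀ i j x z p, x ∈ closure Ω → a i j (x, z, p) = a j i (x, z, p))
    (hell : ∀ x z p, x ∈ closure Ω → ∀ ξ : Eu n, ξ ≠ 0 →
      0 < ∑ i, ∑ j, a i j (x, z, p) * ξ i * ξ j)
    {u : Eu n → ℝ} (hu : ContDiffOn ℝ 2 u Ω)
    (hQ : ∀ x ∈ Ω, (∑ i, ∑ j, a i j (x, u x, gradE u x) * sdE u x i j) + b (x, u x, gradE u x) = 0)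
    {K : ℝ} (hK : 0 ≤ K) (hKb : ∀ x ∈ Ω, |u x| + ‖gradE u x‖ ≤ K) :
    ∃ lam > (0 : ℝ), ∃ Lam ≥ (0 : ℝ), ∃ D ≥ (0 : ℝ), ∃ C₀ ≥ (0 : ℝ),
      GradSys lam Lam K D Ω u (fun x => Matrix.of fun i j => a i j (jet u x))
        (fun x => b (jet u x)) ∧ ∀ x ∈ Ω, |b (jet u x)| ≤ C₀ := by
  set Z : Set (Eu n × ℝ × Eu n) := closure Ω ×ˢ (closedBall 0 K ×ˢ closedBall 0 K) with hZdef
  have hZ : IsCompact Z := hΩb.isCompact_closure.prod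
    ((isCompact_closedBall _ _).prod (isCompact_closedBall _ _))
  have hZT : Z ⊆ closure Ω ×ˢ (univ : Set (ℝ × Eu n)) := prod_mono_right (subset_univ _)
  set U : Set (Eu n × ℝ × Eu n) := Ω ×ˢ univ with hUdef
  have hU : IsOpen U := hΩ.prod isOpen_univ
  have hUT : U ⊆ closure Ω ×ˢ (univ : Set (ℝ × Eu n)) := prod_mono_left subset_closure
  have hjet : ∀ x ∈ Ω, jet u x ∈ U ∩ Z := by
    intro x hx
    have h1 := hKb x hx
    have h2 := abs_nonneg (u x)
    have h3 := norm_nonneg (gradE u x)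
    refine ⟨⟨hx, mem_univ _⟩, subset_closure hx, ?_, ?_⟩
    · rw [mem_closedBall_zero_iff, Real.norm_eq_abs]
      change |u x| ≤ K
      linarith
    · rw [mem_closedBall_zero_iff]
      change ‖gradE u x‖ ≤ K
      linarith
  obtain ⟨lam, hlam, Lam, hLam, hE⟩ := hZ.exists_ell (fun i j => (ha i j).continuousOn.mono hZT)
    (fun i j z hz => hsym i j z.1 z.2.1 z.2.2 hz.1)
    (fun z hz ξ hξ => hell z.1 z.2.1 z.2.2 hz.1 ξ hξ)
  choose Da hDa0 hDa using fun i j => (ha i j).exists_norm_fderiv_le hZ hZT hU hUT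
  obtain ⟨Db, hDb0, hDb⟩ := hb.exists_norm_fderiv_le hZ hZT hU hUT
  obtain ⟨C₀, hC₀⟩ := hZ.exists_bound_of_continuousOn (hb.continuousOn.mono hZT)
  set D₀ := Db + ∑ i, ∑ j, Da i j with hD₀
  have hDs : 0 ≤ ∑ i, ∑ j, Da i j :=
    Finset.sum_nonneg fun i _ => Finset.sum_nonneg fun j _ => hDa0 i j
  have hDi : ∀ i j, Da i j ≤ D₀ := by
    intro i j
    have h1 : Da i j ≤ ∑ j, Da i j :=
      Finset.single_le_sum (fun j _ => hDa0 i j) (Finset.mem_univ j)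
    have h2 : ∑ j, Da i j ≤ ∑ i, ∑ j, Da i j :=
      Finset.single_le_sum (f := fun i => ∑ j, Da i j)
        (fun i _ => Finset.sum_nonneg fun j _ => hDa0 i j) (Finset.mem_univ i)
    linarith
  have huat : ∀ x ∈ Ω, ContDiffAt ℝ 2 u x := fun x hx => hu.contDiffAt (hΩ.mem_nhds hx)
  have hfd : ∀ x ∈ Ω, ‖fderiv ℝ u x‖ ≤ K := by
    intro x hx
    have h1 := hKb x hx
    have h2 := abs_nonneg (u x)
    rw [gradE_eq_gradL, norm_gradL] at h1
    linarith
  have hmaps : MapsTo (jet u) Ω (closure Ω ×ˢ (univ : Set (ℝ × Eu n))) :=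
    fun x hx => hUT (hjet x hx).1
  have hder : ∀ (g : Eu n × ℝ × Eu n → ℝ) (C : ℝ), 0 ≤ C → C ≤ D₀ →
      ContDiffOn ℝ 1 g (closure Ω ×ˢ (univ : Set (ℝ × Eu n))) →
      (∀ z ∈ U ∩ Z, ‖fderiv ℝ g z‖ ≤ C) → ∀ x ∈ Ω, ∀ v,
      |fderiv ℝ (fun x => g (jet u x)) x v| ≤ D₀ * (1 + K) * (‖hess u x v‖ + ‖v‖) := by
    intro g C hC hCD hg hgC x hx v
    have h1 : HasFDerivAt g (fderiv ℝ g (jet u x)) (jet u x) :=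
      (((hg.mono hUT).contDiffAt (hU.mem_nhds (hjet x hx).1)).differentiableAt
        (by norm_num)).hasFDerivAt
    have h2 : HasFDerivAt (jet u) (fderiv ℝ (jet u) x) x :=
      (((contDiffOn_jet hΩ hu).contDiffAt (hΩ.mem_nhds hx)).differentiableAt
        (by norm_num)).hasFDerivAt
    have h3 : HasFDerivAt (fun x => g (jet u x)) _ x := h1.comp x h2
    rw [h3.fderiv]
    refine ((fderiv ℝ g (jet u x)).le_opNorm _).trans ?_
    have h4 := norm_fderiv_jet_le (huat x hx) v
    have h5 := (hgC _ (hjet x hx)).trans hCD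
    have h6 : ‖fderiv ℝ (jet u) x v‖ ≤ (1 + K) * (‖hess u x v‖ + ‖v‖) := by
      refine h4.trans ?_
      have := hfd x hx
      gcongr
    calc _ ≤ D₀ * ((1 + K) * (‖hess u x v‖ + ‖v‖)) := by
          have : 0 ≤ D₀ := hC.trans hCD
          change ‖fderiv ℝ g (jet u x)‖ * ‖fderiv ℝ (jet u) x v‖ ≤ _
          gcongr
      _ = _ := by ring
  refine ⟨lam, hlam, Lam, hLam, D₀ * (1 + K), by positivity, max C₀ 0, le_max_right _ _,
    ⟨hΩ, hu, hfd, ?_, ?_, fun x hx => hE _ (hjet x hx).2, fun x hx => ?_, ?_, ?_⟩, fun x hx => ?_⟩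
  · exact fun i j => (ha i j).comp (contDiffOn_jet hΩ hu) hmaps
  · exact hb.comp (contDiffOn_jet hΩ hu) hmaps
  · rw [← hQ x hx]
    simp only [trB, Matrix.of_apply, sdE_eq_hess (huat x hx), jet]
  · exact fun x hx i j v => hder (a i j) (Da i j) (hDa0 i j) (hDi i j) (ha i j) (hDa i j) x hx v
  · exact fun x hx v => hder b Db hDb0 (by linarith) hb hDb x hx v
  · exact (hC₀ _ (hjet x hx).2).trans (le_max_left _ _)

end Coefficients

section Global

open Metric Filter

lemma exists_holder_of_local {E V : Type*} [NormedAddCommGroup E] [NormedAddCommGroup V]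
    {Ω : Set E} {F : E → V} {K : ℝ} (hcomp : IsCompact (closure Ω)) (hK : ∀ x ∈ Ω, ‖F x‖ ≤ K)
    (hloc : ∀ p ∈ closure Ω, ∃ τ ∈ Ioo (0 : ℝ) 1, ∃ C > (0 : ℝ), ∃ r > (0 : ℝ),
      ∀ x ∈ Ω ∩ ball p r, ∀ y ∈ Ω ∩ ball p r, ‖F x - F y‖ ≤ C * ‖x - y‖ ^ τ) :
    ∃ τ ∈ Ioo (0 : ℝ) 1, ∃ C > (0 : ℝ), ∀ x ∈ Ω, ∀ y ∈ Ω, ‖F x - F y‖ ≤ C * ‖x - y‖ ^ τ := by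
  have hmono : ∀ {x y : E} {τ τ' C C' : ℝ}, 0 < τ → 0 ≤ C' → τ ≤ τ' → C' ≤ C → ‖x - y‖ < 1 →
      ‖F x - F y‖ ≤ C' * ‖x - y‖ ^ τ' → ‖F x - F y‖ ≤ C * ‖x - y‖ ^ τ := by
    intro x y τ τ' C C' hτ hC' hττ hCC hxy h
    refine h.trans ?_
    have : ‖x - y‖ ^ τ' ≤ ‖x - y‖ ^ τ :=
      Real.rpow_le_rpow_of_exponent_ge' (norm_nonneg _) hxy.le hτ.le hττ
    have := hC'.trans hCC
    gcongr
  have key : ∃ τ ∈ Ioo (0 : ℝ) 1, ∃ C > (0 : ℝ), ∃ r ∈ Ioc (0 : ℝ) 1,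
      ∀ x ∈ Ω ∩ closure Ω, ∀ y ∈ Ω, ‖x - y‖ < r → ‖F x - F y‖ ≤ C * ‖x - y‖ ^ τ := by
    refine hcomp.induction_on (p := fun s => ∃ τ ∈ Ioo (0 : ℝ) 1, ∃ C > (0 : ℝ), ∃ r ∈ Ioc (0 : ℝ) 1,
      ∀ x ∈ Ω ∩ s, ∀ y ∈ Ω, ‖x - y‖ < r → ‖F x - F y‖ ≤ C * ‖x - y‖ ^ τ) ?_ ?_ ?_ ?_
    · exact ⟨1 / 2, by norm_num, 1, one_pos, 1, by norm_num, by simp⟩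
    · rintro s t hst ⟨τ, hτ, C, hC, r, hr, h⟩
      exact ⟨τ, hτ, C, hC, r, hr, fun x hx => h x ⟨hx.1, hst hx.2⟩⟩
    · rintro s t ⟨τ, hτ, C, hC, r, hr, h⟩ ⟨τ', hτ', C', hC', r', hr', h'⟩
      have hτ0 : 0 < min τ τ' := lt_min hτ.1 hτ'.1
      refine ⟨min τ τ', ⟨hτ0, (min_le_left _ _).trans_lt hτ.2⟩, max C C', lt_max_of_lt_left hC,
        min r r', ⟨lt_min hr.1 hr'.1, (min_le_left _ _).trans hr.2⟩, fun x hx y hy hxy => ?_⟩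
      obtain ⟨h1, h2⟩ := lt_min_iff.1 hxy
      rcases hx.2 with hs | ht
      · exact hmono hτ0 hC.le (min_le_left _ _) (le_max_left _ _) (h1.trans_le hr.2)
          (h x ⟨hx.1, hs⟩ y hy h1)
      · exact hmono hτ0 hC'.le (min_le_right _ _) (le_max_right _ _) (h1.trans_le hr.2)
          (h' x ⟨hx.1, ht⟩ y hy h2)
    · intro p hp
      obtain ⟨τ, hτ, C, hC, r, hr, h⟩ := hloc p hp
      refine ⟨ball p (r / 2), mem_nhdsWithin_of_mem_nhds (ball_mem_nhds p (by positivity)),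
        τ, hτ, C, hC, min (r / 2) 1, ⟨by positivity, min_le_right _ _⟩, fun x hx y hy hxy => ?_⟩
      have hxp := hx.2
      rw [mem_ball] at hxp
      refine h x ⟨hx.1, ball_subset_ball (by linarith) hx.2⟩ y ⟨hy, ?_⟩
      rw [mem_ball]
      have h1 := dist_triangle y x p
      rw [dist_comm y x, dist_eq_norm x y] at h1
      linarith [min_le_left (r / 2) 1]
  obtain ⟨τ, hτ, C, hC, r, hr, h⟩ := key
  have hrτ : 0 < r ^ τ := Real.rpow_pos_of_pos hr.1 _
  refine ⟨τ, hτ, C + 2 * |K| / r ^ τ, by positivity, fun x hx y hy => ?_⟩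
  have h0 : 0 ≤ ‖x - y‖ ^ τ := by positivity
  have h1 : 0 ≤ 2 * |K| / r ^ τ := by positivity
  rcases lt_or_ge ‖x - y‖ r with hlt | hge
  · refine (h x ⟨hx, subset_closure hx⟩ y hy hlt).trans ?_
    gcongr
    linarith
  · have h2 : ‖F x - F y‖ ≤ 2 * |K| := by
      have := norm_sub_le (F x) (F y)
      linarith [hK x hx, hK y hy, le_abs_self K]
    have h3 : r ^ τ ≤ ‖x - y‖ ^ τ := Real.rpow_le_rpow hr.1.le hge hτ.1.le
    calc ‖F x - F y‖ ≤ 2 * |K| / r ^ τ * r ^ τ := by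
          rwa [div_mul_cancel₀ _ hrτ.ne']
      _ ≤ 2 * |K| / r ^ τ * ‖x - y‖ ^ τ := by gcongr
      _ ≤ _ := by
          gcongr
          linarith

lemma exists_holder_extension {E V : Type*} [NormedAddCommGroup E] [NormedAddCommGroup V]
    [CompleteSpace V] {Ω : Set E} {F : E → V} {τ C : ℝ} (hτ : 0 < τ)
    (h : ∀ x ∈ Ω, ∀ y ∈ Ω, ‖F x - F y‖ ≤ C * ‖x - y‖ ^ τ) :
    ∃ G : E → V, ContinuousOn G (closure Ω) ∧ (∀ x ∈ Ω, G x = F x) ∧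
      ∀ x ∈ closure Ω, ∀ y ∈ closure Ω, ‖G x - G y‖ ≤ C * ‖x - y‖ ^ τ := by
  have huc : UniformContinuousOn F Ω := by
    rw [Metric.uniformContinuousOn_iff]
    intro ε hε
    have ht : Tendsto (fun t : ℝ => C * t ^ τ) (𝓝 0) (𝓝 0) := by
      have : ContinuousAt (fun t : ℝ => C * t ^ τ) 0 :=
        continuousAt_const.mul (Real.continuousAt_rpow_const 0 τ (Or.inr hτ.le))
      simpa [ContinuousAt, Real.zero_rpow hτ.ne'] using this
    obtain ⟨δ, hδ, hb⟩ := Metric.eventually_nhds_iff.1 (ht.eventually_lt_const hε)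
    refine ⟨δ, hδ, fun x hx y hy hxy => ?_⟩
    rw [dist_eq_norm] at hxy ⊢
    refine (h x hx y hy).trans_lt (hb ?_)
    simpa using hxy
  have hlim : ∀ x ∈ closure Ω, ∃ y, Tendsto F (𝓝[Ω] x) (𝓝 y) := by
    intro x hx
    have : (𝓝[Ω] x).NeBot := mem_closure_iff_nhdsWithin_neBot.1 hx
    exact CompleteSpace.complete
      ((cauchy_nhds.mono (nhdsWithin_le_nhds (s := Ω) (a := x))).map_of_le huc
        (le_principal_iff.2 self_mem_nhdsWithin))
  have hG : ∀ x ∈ closure Ω, Tendsto F (𝓝[Ω] x) (𝓝 (extendFrom Ω F x)) := fun x hx =>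
    tendsto_extendFrom (hlim x hx)
  refine ⟨extendFrom Ω F, continuousOn_extendFrom subset_rfl hlim, fun x hx => ?_,
    fun x hx y hy => ?_⟩
  · exact extendFrom_eq (subset_closure hx) (huc.continuousOn x hx)
  · have hx' : (𝓝[Ω] x).NeBot := mem_closure_iff_nhdsWithin_neBot.1 hx
    have hy' : (𝓝[Ω] y).NeBot := mem_closure_iff_nhdsWithin_neBot.1 hy
    have t1 : Tendsto (fun q : E × E => ‖F q.1 - F q.2‖) (𝓝[Ω] x ×ˢ 𝓝[Ω] y)
        (𝓝 ‖extendFrom Ω F x - extendFrom Ω F y‖) :=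
      (((hG x hx).comp tendsto_fst).sub ((hG y hy).comp tendsto_snd)).norm
    have t2 : Tendsto (fun q : E × E => C * ‖q.1 - q.2‖ ^ τ) (𝓝[Ω] x ×ˢ 𝓝[Ω] y)
        (𝓝 (C * ‖x - y‖ ^ τ)) := by
      have a1 : Tendsto (fun q : E × E => q.1) (𝓝[Ω] x ×ˢ 𝓝[Ω] y) (𝓝 x) :=
        (tendsto_id.mono_left nhdsWithin_le_nhds).comp tendsto_fst
      have a2 : Tendsto (fun q : E × E => q.2) (𝓝[Ω] x ×ˢ 𝓝[Ω] y) (𝓝 y) :=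
        (tendsto_id.mono_left nhdsWithin_le_nhds).comp tendsto_snd
      exact ((a1.sub a2).norm.rpow_const (Or.inr hτ.le)).const_mul C
    refine le_of_tendsto_of_tendsto t1 t2 ?_
    filter_upwards [prod_mem_prod self_mem_nhdsWithin self_mem_nhdsWithin] with q hq
    exact h q.1 hq.1 q.2 hq.2

lemma exists_local_holder_of_mem {n : ℕ} {Ω : Set (Eu n)} (hΩ : IsOpen Ω) {u : Eu n → ℝ}
    (hu : ContDiffOn ℝ 2 u Ω) {p : Eu n} (hp : p ∈ Ω) :
    ∃ τ ∈ Ioo (0 : ℝ) 1, ∃ C > (0 : ℝ), ∃ r > (0 : ℝ), ∀ x ∈ Ω ∩ ball p r, ∀ y ∈ Ω ∩ ball p r,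
      ‖fderiv ℝ u x - fderiv ℝ u y‖ ≤ C * ‖x - y‖ ^ τ := by
  have h1 : ContDiffAt ℝ 1 (fderiv ℝ u) p :=
    (hu.contDiffAt (hΩ.mem_nhds hp)).fderiv_right (by norm_num)
  obtain ⟨L, t, ht, hL⟩ := h1.exists_lipschitzOnWith
  obtain ⟨r, hr, hrt⟩ := Metric.mem_nhds_iff.1 ht
  refine ⟨1 / 2, by norm_num, L + 1, by positivity, min r (1 / 2), by positivity,
    fun x hx y hy => ?_⟩
  have hxr := mem_ball.1 hx.2
  have hyr := mem_ball.1 hy.2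
  have hle := hL.norm_sub_le (hrt (ball_subset_ball (min_le_left _ _) hx.2))
    (hrt (ball_subset_ball (min_le_left _ _) hy.2))
  have hxy : ‖x - y‖ ≤ 1 := by
    rw [← dist_eq_norm]
    have := dist_triangle_right x y p
    linarith [min_le_right r (1 / 2)]
  have h2 : ‖x - y‖ ≤ ‖x - y‖ ^ (1 / 2 : ℝ) := by
    conv_lhs => rw [← Real.rpow_one ‖x - y‖]
    exact Real.rpow_le_rpow_of_exponent_ge' (norm_nonneg _) hxy (by norm_num) (by norm_num)
  calc _ ≤ (L : ℝ) * ‖x - y‖ := hle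
    _ ≤ (L + 1) * ‖x - y‖ ^ (1 / 2 : ℝ) := by
        gcongr
        linarith

end Global

/-- **Global `C^{1,τ}` boundary regularity** (Theorem on global Hölder gradient estimates):
if `u ∈ C⁰(Ω̄) ∩ C²(Ω)` solves the elliptic quasilinear equation `Q(u) = 0` in a bounded
`C²` domain `Ω ⊂ ℝⁿ` with `u = φ ∈ C²(Ω̄)` on `∂Ω` and `|u| + |Du| ≤ K` in `Ω`, then there
are `τ ∈ (0,1)` and `C > 0` such that `u ∈ C¹(Ω̄)` (its gradient extends continuously to `Ω̄`)
and the (extended) gradient is `τ`-Hölder on `Ω̄` with constant `C`; i.e. `u ∈ C^{1,τ}(Ω̄)`. -/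
theorem global_C1tau_regularity
    {n : ℕ} (hn : 2 ≤ n)
    (Ω : Set (EuclideanSpace ℝ (Fin n)))
    (hΩopen : IsOpen Ω) (hΩconn : IsConnected Ω) (hΩbdd : Bornology.IsBounded Ω)
    (hΩbd : HasCBoundary 2 Ω)
    (a : Fin n → Fin n → EuclideanSpace ℝ (Fin n) × ℝ × EuclideanSpace ℝ (Fin n) → ℝ)
    (b : EuclideanSpace ℝ (Fin n) × ℝ × EuclideanSpace ℝ (Fin n) → ℝ)
    (ha : ∀ i j, ContDiffOn ℝ 1 (a i j)
      (closure Ω ×ˢ (univ : Set (ℝ × EuclideanSpace ℝ (Fin n)))))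
    (hb : ContDiffOn ℝ 1 b (closure Ω ×ˢ (univ : Set (ℝ × EuclideanSpace ℝ (Fin n)))))
    (hsym : ∀ (i j : Fin n) (x : EuclideanSpace ℝ (Fin n)) (z : ℝ)
      (p : EuclideanSpace ℝ (Fin n)), x ∈ closure Ω → a i j (x, z, p) = a j i (x, z, p))
    (hell : ∀ (x : EuclideanSpace ℝ (Fin n)) (z : ℝ) (p : EuclideanSpace ℝ (Fin n)),
      x ∈ closure Ω → ∀ ξ : EuclideanSpace ℝ (Fin n), ξ ≠ 0 →
        0 < ∑ i, ∑ j, a i j (x, z, p) * ξ i * ξ j)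
    (φ u : EuclideanSpace ℝ (Fin n) → ℝ)
    (hφ : ContDiffOn ℝ 2 φ (closure Ω))
    (hu0 : ContinuousOn u (closure Ω)) (hu2 : ContDiffOn ℝ 2 u Ω)
    (hQ : ∀ x ∈ Ω,
      (∑ i, ∑ j, a i j (x, u x, gradE u x) * sdE u x i j) + b (x, u x, gradE u x) = 0)
    (hbc : ∀ x ∈ frontier Ω, u x = φ x)
    (K : ℝ) (hK : 0 < K) (hKbound : ∀ x ∈ Ω, |u x| + ‖gradE u x‖ ≤ K) :
    ∃ τ ∈ Ioo (0 : ℝ) 1, ∃ C > (0 : ℝ),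
      ∃ G : EuclideanSpace ℝ (Fin n) → EuclideanSpace ℝ (Fin n),
        ContinuousOn G (closure Ω) ∧ (∀ x ∈ Ω, G x = gradE u x) ∧
        ∀ x₁ ∈ closure Ω, ∀ x₂ ∈ closure Ω, ‖G x₁ - G x₂‖ ≤ C * ‖x₁ - x₂‖ ^ τ := by
  obtain ⟨lam, hlam, Lam, hLam, D, hD, C₀, hC₀, S, hS⟩ :=
    exists_gradSys hΩopen hΩbdd ha hb hsym hell hu2 hQ hK.le hKbound
  have hcomp : IsCompact (closure Ω) := hΩbdd.isCompact_closure
  obtain ⟨K₁, hK₁, hφ1⟩ := (hφ.of_le (by norm_num)).exists_norm_fderiv_le hcomp subset_rfl hΩopen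
    subset_closure
  obtain ⟨K₂, hK₂, hφ2⟩ := hφ.exists_norm_fderiv_fderiv_le hcomp subset_rfl hΩopen subset_closure
  have hloc : ∀ p ∈ closure Ω, ∃ τ ∈ Ioo (0 : ℝ) 1, ∃ C > (0 : ℝ), ∃ r > (0 : ℝ),
      ∀ x ∈ Ω ∩ Metric.ball p r, ∀ y ∈ Ω ∩ Metric.ball p r,
        ‖gradE u x - gradE u y‖ ≤ C * ‖x - y‖ ^ τ := by
    intro p hp
    simp only [gradE_eq_gradL, ← map_sub, norm_gradL]
    by_cases hpΩ : p ∈ Ω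
    · exact exists_local_holder_of_mem hΩopen hu2 hpΩ
    · have hpf : p ∈ frontier Ω := by
        rw [hΩopen.frontier_eq]
        exact ⟨hp, hpΩ⟩
      obtain ⟨ρ, M, ψ, hchart, hψp⟩ := (hΩbd p hpf).exists_chart hpf
      exact exists_local_holder_of_mem_frontier (by omega) hlam hLam hK.le hD hC₀
        (hK₁.trans (le_max_left K₁ K₂)) S hchart hψp (fun x hx => hS x hx.1)
        (hφ.mono subset_closure)
        (fun x hx => (hφ1 x ⟨hx.1, subset_closure hx.1⟩).trans (le_max_left _ _))
        (fun x hx => (hφ2 x ⟨hx.1, subset_closure hx.1⟩).trans (le_max_right _ _))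
        (hu0.sub hφ.continuousOn) hbc
  obtain ⟨τ, hτ, C, hC, h⟩ := exists_holder_of_local hcomp (K := K)
    (fun x hx => by linarith [hKbound x hx, abs_nonneg (u x)]) hloc
  obtain ⟨G, hG⟩ := exists_holder_extension hτ.1 h
  exact ⟨τ, hτ, C, hC, G, hG⟩
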